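/- (Proposition 4.7, pinned optimal profiles in the critical regime.) Fix γ ∈ (0,∞) and assume W is continuous and satisfies (H1)–(H4) and the normalization of the wells. Then there exist sequences ε_n → 0⁺, c_n ∈ ℝ³ with c_n → 0, and C² maps g_n : Q → ℝ³ independent of x₂, such that: ∫_Q |g_n − u₀|^p dx → 0, ∫_Q |∂₁g_n(x) − sign(x₁)·a|^p dx → 0, ∫_Q |∂₂g_n|^p dx → 0, ∫_Q |(γε_n)⁻¹∂₃g_n − b₀|^p dx → 0; g_n(x) = u₀(x) + γε_n x₃ b₀(x) on Q ∩ {x₁ > 1/4} and g_n(x) = u₀(x) + γε_n x₃ b₀(x) + c_n on Q ∩ {x₁ < −1/4}; and lim_{n→∞} F^{γε_n}_{ε_n}(g_n, Q) = K*_γ (in particular K*_γ < ∞). -/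

import Mathlib

open MeasureTheory Filter Topology ENNReal NNReal Set

noncomputable section

/-- Vectors in ℝ³. -/
abbrev V3 := Fin 3 → ℝ

/-- 3×3 matrices, represented as the triple of their columns. -/
abbrev M33 := Fin 3 → V3

/-- Euclidean norm on ℝ³. -/
def vnorm (v : V3) : ℝ := Real.sqrt (∑ i, (v i) ^ 2)

/-- Frobenius (Euclidean) norm on 3×3 matrices. -/
def mnorm (ξ : M33) : ℝ := Real.sqrt (∑ j, ∑ i, (ξ j i) ^ 2)

/-- dist(ξ,{A,B}). -/
def mdist (A B ξ : M33) : ℝ := min (mnorm (ξ - A)) (mnorm (ξ - B))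

/-- Spatial points of ℝ³ = ℝ × ℝ × ℝ. -/
abbrev Pt := ℝ × ℝ × ℝ

/-- Directional partial derivative of a map `u : ℝ³ → ℝ³`. -/
def pd (e : Pt) (u : Pt → V3) (x : Pt) : V3 := fderiv ℝ u x e

def e1 : Pt := (1, 0, 0)
def e2 : Pt := (0, 1, 0)
def e3 : Pt := (0, 0, 1)

/-- Rescaled gradient ∇_h u = (∂₁u, ∂₂u, h⁻¹ ∂₃u), as a 3×3 matrix of columns. -/
def gradh (h : ℝ) (u : Pt → V3) (x : Pt) : M33 :=
  ![pd e1 u x, pd e2 u x, h⁻¹ • pd e3 u x]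

/-- Squared rescaled Hessian |∇²_h u|². -/
def hessh (h : ℝ) (u : Pt → V3) (x : Pt) : ℝ :=
  (vnorm (pd e1 (pd e1 u) x)) ^ 2 + (vnorm (pd e2 (pd e2 u) x)) ^ 2
    + (h⁻¹) ^ 4 * (vnorm (pd e3 (pd e3 u) x)) ^ 2
    + 2 * (vnorm (pd e2 (pd e1 u) x)) ^ 2
    + 2 * (h⁻¹) ^ 2 * (vnorm (pd e3 (pd e1 u) x)) ^ 2
    + 2 * (h⁻¹) ^ 2 * (vnorm (pd e3 (pd e2 u) x)) ^ 2

/-- The energy F^h_ε(u, S) = ∫_S (1/ε) W(∇_h u) + ε |∇²_h u|², valued in [0,∞]. -/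
def F (W : M33 → ℝ) (h ε : ℝ) (u : Pt → V3) (S : Set Pt) : ℝ≥0∞ :=
  ∫⁻ x in S, ENNReal.ofReal (ε⁻¹ * W (gradh h u x) + ε * hessh h u x)

/-- Hypothesis (H1): W ≥ 0, {W = 0} = {A, B}, A ≠ B, and A' − B' = 2 a ⊗ ν̄ for
some a ∈ ℝ³ and a unit vector ν̄ ∈ ℝ². -/
def H1 (W : M33 → ℝ) (A B : M33) : Prop :=
  (∀ ξ, 0 ≤ W ξ) ∧ (∀ ξ, W ξ = 0 ↔ ξ = A ∨ ξ = B) ∧ A ≠ B ∧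
    ∃ (a : V3) (ν : ℝ × ℝ), ν.1 ^ 2 + ν.2 ^ 2 = 1 ∧
      A 0 - B 0 = (2 * ν.1) • a ∧ A 1 - B 1 = (2 * ν.2) • a

/-- Hypothesis (H2): p-growth from above and below. -/
def H2 (W : M33 → ℝ) (p : ℝ) : Prop :=
  ∃ C > (0 : ℝ), ∀ ξ, C⁻¹ * (mnorm ξ) ^ p - C ≤ W ξ ∧ W ξ ≤ C * (mnorm ξ) ^ p + C

/-- Hypothesis (H3): non-degeneracy near the wells. -/
def H3 (W : M33 → ℝ) (A B : M33) (p : ℝ) : Prop :=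
  ∃ ϱ > (0 : ℝ), ∃ C > (0 : ℝ), ∀ ξ, mdist A B ξ ≤ ϱ →
    C⁻¹ * (mdist A B ξ) ^ p ≤ W ξ ∧ W ξ ≤ C * (mdist A B ξ) ^ p

/-- Hypothesis (H4): W(ξ₁, 0, ξ₃) ≤ W(ξ). -/
def H4 (W : M33 → ℝ) : Prop := ∀ ξ : M33, W ![ξ 0, 0, ξ 2] ≤ W ξ

/-- Normalization of the wells: A = −B, first column of A is a, second column is 0. -/
def Wells (A B : M33) (a : V3) : Prop := A = -B ∧ A 0 = a ∧ A 1 = 0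

/-- ū₀(t) = |t| a. -/
def ub0 (a : V3) (t : ℝ) : V3 := |t| • a

/-- b̄₀(t) = A₃ for t ≥ 0, −A₃ (= B₃) for t < 0. -/
def bb0 (A3 : V3) (t : ℝ) : V3 := if 0 ≤ t then A3 else -A3

/-- u₀(x) = ū₀(x₁). -/
def u0 (a : V3) (x : Pt) : V3 := ub0 a x.1

/-- b₀(x) = b̄₀(x₁). -/
def b0 (A3 : V3) (x : Pt) : V3 := bb0 A3 x.1

/-- The interval I = (−1/2, 1/2). -/
def II : Set ℝ := Set.Ioo (-(1 / 2 : ℝ)) (1 / 2)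

/-- The unit cube Q = I × I × I. -/
def Q3 : Set Pt := II ×ˢ (II ×ˢ II)

/-- J_ρ = (ρ I) × J × I. -/
def Jrho (J : Set ℝ) (ρ : ℝ) : Set Pt := (Set.Ioo (-(ρ / 2)) (ρ / 2)) ×ˢ (J ×ˢ II)

/-- The rescaled thin domain Ω = ω × I. -/
def Om (ω : Set (ℝ × ℝ)) : Set Pt := {x | (x.1, x.2.1) ∈ ω ∧ x.2.2 ∈ II}

/-- L¹ convergence on a set U. -/
def TendsL1 (U : Set Pt) (f : ℕ → Pt → V3) (g : Pt → V3) : Prop :=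
  Tendsto (fun n => ∫⁻ x in U, ENNReal.ofReal (vnorm (f n x - g x))) atTop (nhds 0)

/-- L^q convergence on a set U. -/
def TendsLp (U : Set Pt) (q : ℝ) (f : ℕ → Pt → V3) (g : Pt → V3) : Prop :=
  Tendsto (fun n => ∫⁻ x in U, ENNReal.ofReal ((vnorm (f n x - g x)) ^ q)) atTop (nhds 0)

/-- The localized asymptotic energy 𝓔_γ(J, ρ). -/
def Egam (W : M33 → ℝ) (a A3 : V3) (γ : ℝ) (J : Set ℝ) (ρ : ℝ) : ℝ≥0∞ :=
  sInf { L : ℝ≥0∞ | ∃ (h ε : ℕ → ℝ) (u : ℕ → Pt → V3),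
    (∀ n, 0 < h n) ∧ (∀ n, 0 < ε n) ∧
    Tendsto h atTop (nhds 0) ∧ Tendsto ε atTop (nhds 0) ∧
    Tendsto (fun n => h n / ε n) atTop (nhds γ) ∧
    (∀ n, ContDiffOn ℝ 2 (u n) (Jrho J ρ)) ∧
    TendsL1 (Jrho J ρ) u (u0 a) ∧
    TendsL1 (Jrho J ρ) (fun n x => (h n)⁻¹ • pd e3 (u n) x) (b0 A3) ∧
    L = Filter.liminf (fun n => F W (h n) (ε n) (u n) (Jrho J ρ)) atTop }

/-- K*_γ = 𝓔_γ(I, 1). -/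
def Kstar (W : M33 → ℝ) (a A3 : V3) (γ : ℝ) : ℝ≥0∞ := Egam W a A3 γ II 1

/-- K*_∞ : the analogue of K*_γ for h/ε → ∞, on the unit cube Q. -/
def KstarInf (W : M33 → ℝ) (a A3 : V3) : ℝ≥0∞ :=
  sInf { L : ℝ≥0∞ | ∃ (h ε : ℕ → ℝ) (u : ℕ → Pt → V3),
    (∀ n, 0 < h n) ∧ (∀ n, 0 < ε n) ∧
    Tendsto h atTop (nhds 0) ∧ Tendsto ε atTop (nhds 0) ∧
    Tendsto (fun n => h n / ε n) atTop atTop ∧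
    (∀ n, ContDiffOn ℝ 2 (u n) Q3) ∧
    TendsL1 Q3 u (u0 a) ∧
    TendsL1 Q3 (fun n x => (h n)⁻¹ • pd e3 (u n) x) (b0 A3) ∧
    L = Filter.liminf (fun n => F W (h n) (ε n) (u n) Q3) atTop }

open Classical in
/-- The phase matrix: B on E, A off E. -/
def Mfun (A B : M33) (E : Set (ℝ × ℝ)) (x' : ℝ × ℝ) : M33 := if x' ∈ E then B else A

/-! ### Two-dimensional objects -/

abbrev Pt2 := ℝ × ℝ

/-- Directional partial derivative of a map `v : ℝ² → ℝ³`. -/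
def qd (e : Pt2) (v : Pt2 → V3) (y : Pt2) : V3 := fderiv ℝ v y e

def f1 : Pt2 := (1, 0)
def f2 : Pt2 := (0, 1)

/-- 𝒲(∇v) = W(∂₁v, 0, ∂₂v). -/
def W2 (W : M33 → ℝ) (v : Pt2 → V3) (y : Pt2) : ℝ := W ![qd f1 v y, 0, qd f2 v y]

/-- Squared 2D Hessian |∇²v|². -/
def hess2d (v : Pt2 → V3) (y : Pt2) : ℝ :=
  (vnorm (qd f1 (qd f1 v) y)) ^ 2 + 2 * (vnorm (qd f2 (qd f1 v) y)) ^ 2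
    + (vnorm (qd f2 (qd f2 v) y)) ^ 2

/-- The rectangle ℓI × γI. -/
def Rect (ℓ γ : ℝ) : Set Pt2 := Set.Ioo (-(ℓ / 2)) (ℓ / 2) ×ˢ Set.Ioo (-(γ / 2)) (γ / 2)

/-- The optimal-profile constant K_γ of the critical regime. -/
def Kgam (W : M33 → ℝ) (a A3 : V3) (γ : ℝ) : ℝ≥0∞ :=
  sInf { L : ℝ≥0∞ | ∃ ℓ > (0 : ℝ), ∃ v : Pt2 → V3,
    ContDiffOn ℝ 2 v (Rect ℓ γ) ∧
    (∃ δ > (0 : ℝ), ∀ y ∈ Rect ℓ γ, ℓ / 2 - δ < y.1 → qd f1 v y = a ∧ qd f2 v y = A3) ∧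
    (∃ δ > (0 : ℝ), ∀ y ∈ Rect ℓ γ, y.1 < -(ℓ / 2) + δ → qd f1 v y = -a ∧ qd f2 v y = -A3) ∧
    L = ENNReal.ofReal γ⁻¹ *
      ∫⁻ y in Rect ℓ γ, ENNReal.ofReal (W2 W v y + hess2d v y) }

/-- The 2D subcritical functional F⁰_ε(u, b, D). -/
def F0 (W : M33 → ℝ) (ε : ℝ) (u b : Pt2 → V3) (D : Set Pt2) : ℝ≥0∞ :=
  ∫⁻ y in D, ENNReal.ofReal (ε⁻¹ * W ![qd f1 u y, qd f2 u y, b y]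
    + ε * ((vnorm (qd f1 (qd f1 u) y)) ^ 2 + 2 * (vnorm (qd f2 (qd f1 u) y)) ^ 2
      + (vnorm (qd f2 (qd f2 u) y)) ^ 2
      + 2 * (vnorm (qd f1 b y)) ^ 2 + 2 * (vnorm (qd f2 b y)) ^ 2))

/-- K*₀: the subcritical cell constant. -/
def Kstar0 (W : M33 → ℝ) (a A3 : V3) : ℝ≥0∞ :=
  sInf { L : ℝ≥0∞ | ∃ (ε : ℕ → ℝ) (u b : ℕ → Pt2 → V3),
    (∀ n, 0 < ε n) ∧ Tendsto ε atTop (nhds 0) ∧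
    (∀ n, ContDiffOn ℝ 2 (u n) (II ×ˢ II)) ∧ (∀ n, ContDiffOn ℝ 1 (b n) (II ×ˢ II)) ∧
    Tendsto (fun n => ∫⁻ y in II ×ˢ II,
      ENNReal.ofReal (vnorm (u n y - ub0 a y.1) + vnorm (b n y - bb0 A3 y.1)))
      atTop (nhds 0) ∧
    L = Filter.liminf (fun n => F0 W (ε n) (u n) (b n) (II ×ˢ II)) atTop }

/-- K₀: the subcritical optimal-profile constant. -/
def K0 (W : M33 → ℝ) (a A3 : V3) : ℝ≥0∞ :=
  sInf { L : ℝ≥0∞ | ∃ ℓ > (0 : ℝ), ∃ φ1 φ2 : ℝ → V3,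
    ContDiffOn ℝ 1 φ1 (Set.Icc (-ℓ) ℓ) ∧ ContDiffOn ℝ 1 φ2 (Set.Icc (-ℓ) ℓ) ∧
    φ1 ℓ = a ∧ φ2 ℓ = A3 ∧ φ1 (-ℓ) = -a ∧ φ2 (-ℓ) = -A3 ∧
    L = ∫⁻ t in Set.Ioo (-ℓ) ℓ, ENNReal.ofReal (W ![φ1 t, 0, φ2 t]
      + (vnorm (derivWithin φ1 (Set.Icc (-ℓ) ℓ) t)) ^ 2
      + 2 * (vnorm (derivWithin φ2 (Set.Icc (-ℓ) ℓ) t)) ^ 2) }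

/-- K_∞ in the case λ = 0. -/
def KinfZero (W : M33 → ℝ) (a : V3) : ℝ≥0∞ :=
  sInf { L : ℝ≥0∞ | ∃ ℓ > (0 : ℝ), ∃ v : Pt2 → V3,
    ContDiff ℝ 2 v ∧ (∀ y : Pt2, v (y.1, y.2 + 1) = v y) ∧
    (∃ δ > (0 : ℝ), ∀ y : Pt2, |y.1 - 1 / 2| < δ → qd f1 v y = a ∧ qd f2 v y = 0) ∧
    (∃ δ > (0 : ℝ), ∀ y : Pt2, |y.1 + 1 / 2| < δ → qd f1 v y = -a ∧ qd f2 v y = 0) ∧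
    L = ∫⁻ y in II ×ˢ II, ENNReal.ofReal (ℓ * W2 W v y + ℓ⁻¹ * hess2d v y) }

/-- The unit normal ν_λ = (1+λ²)^{-1/2} (1, λ). -/
def nuv (lam : ℝ) : Pt2 := (1 / Real.sqrt (1 + lam ^ 2), lam / Real.sqrt (1 + lam ^ 2))

/-- The orthogonal direction ν_λ^⊥ = (1+λ²)^{-1/2} (−λ, 1). -/
def nupv (lam : ℝ) : Pt2 := (-lam / Real.sqrt (1 + lam ^ 2), 1 / Real.sqrt (1 + lam ^ 2))

/-- Dot product on ℝ². -/
def dotp (w y : Pt2) : ℝ := w.1 * y.1 + w.2 * y.2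

/-- The unit square Q'_λ centered at 0 with two sides orthogonal to ν_λ. -/
def Qlam (lam : ℝ) : Set Pt2 := {y | |dotp (nuv lam) y| < 1 / 2 ∧ |dotp (nupv lam) y| < 1 / 2}

/-- K_∞ for general λ. -/
def KinfL (W : M33 → ℝ) (a : V3) (lam : ℝ) : ℝ≥0∞ :=
  ENNReal.ofReal (Real.sqrt (1 + lam ^ 2)) *
    sInf { L : ℝ≥0∞ | ∃ ℓ > (0 : ℝ), ∃ v : Pt2 → V3,
      ContDiff ℝ 2 v ∧ (∀ y : Pt2, v (y + nupv lam) = v y) ∧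
      (∃ δ > (0 : ℝ), ∀ y : Pt2, |dotp (nuv lam) y - 1 / 2| < δ →
        qd f1 v y = a ∧ qd f2 v y = lam • a) ∧
      (∃ δ > (0 : ℝ), ∀ y : Pt2, |dotp (nuv lam) y + 1 / 2| < δ →
        qd f1 v y = -a ∧ qd f2 v y = -(lam • a)) ∧
      L = ∫⁻ y in Qlam lam, ENNReal.ofReal (ℓ * W2 W v y + ℓ⁻¹ * hess2d v y) }

/-- Number of interfaces strictly below t. -/
def cnt (m : ℕ) (α : Fin m → ℝ) (t : ℝ) : ℕ := (Finset.univ.filter (fun i => α i < t)).card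

end

/-! ### Norm comparisons and growth of the potential -/

theorem norm_le_vnorm (v : V3) : ‖v‖ ≤ vnorm v := by
  refine (pi_norm_le_iff_of_nonneg (Real.sqrt_nonneg _)).2 fun i => ?_
  refine Real.le_sqrt_of_sq_le ?_
  rw [Real.norm_eq_abs, sq_abs]
  exact Finset.single_le_sum (f := fun i => v i ^ 2) (fun i _ => sq_nonneg _) (Finset.mem_univ i)

theorem vnorm_nonneg (v : V3) : 0 ≤ vnorm v := Real.sqrt_nonneg _

theorem vnorm_sq_le (v : V3) : vnorm v ^ 2 ≤ 3 * ‖v‖ ^ 2 := by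
  rw [vnorm, Real.sq_sqrt (Finset.sum_nonneg fun i _ => sq_nonneg _)]
  calc ∑ i, v i ^ 2 ≤ ∑ _i : Fin 3, ‖v‖ ^ 2 := by
        refine Finset.sum_le_sum fun i _ => ?_
        rw [← sq_abs]
        exact pow_le_pow_left₀ (abs_nonneg _) (norm_le_pi_norm v i) 2
    _ = 3 * ‖v‖ ^ 2 := by simp

theorem vnorm_le (v : V3) : vnorm v ≤ 2 * ‖v‖ := by
  have := vnorm_sq_le v
  refine abs_le_of_sq_le_sq' ?_ (by positivity) |>.2
  nlinarith [norm_nonneg v, sq_nonneg ‖v‖]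

theorem norm_le_mnorm (ξ : M33) : ‖ξ‖ ≤ mnorm ξ := by
  refine (pi_norm_le_iff_of_nonneg (Real.sqrt_nonneg _)).2 fun j => ?_
  refine (norm_le_vnorm _).trans (Real.sqrt_le_sqrt ?_)
  exact Finset.single_le_sum (f := fun j => ∑ i, ξ j i ^ 2)
    (fun j _ => Finset.sum_nonneg fun i _ => sq_nonneg _) (Finset.mem_univ j)

theorem mnorm_nonneg (ξ : M33) : 0 ≤ mnorm ξ := Real.sqrt_nonneg _

theorem mnorm_le (ξ : M33) : mnorm ξ ≤ 3 * ‖ξ‖ := by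
  refine Real.sqrt_le_iff.2 ⟨by positivity, ?_⟩
  calc ∑ j, ∑ i, ξ j i ^ 2 ≤ ∑ _j : Fin 3, ∑ _i : Fin 3, ‖ξ‖ ^ 2 := by
        refine Finset.sum_le_sum fun j _ => Finset.sum_le_sum fun i _ => ?_
        rw [← sq_abs]
        exact pow_le_pow_left₀ (abs_nonneg _)
          ((norm_le_pi_norm (ξ j) i).trans (norm_le_pi_norm ξ j)) 2
    _ = (3 * ‖ξ‖) ^ 2 := by simp; ring

theorem continuous_vnorm : Continuous vnorm := by unfold vnorm; fun_prop

theorem continuous_mnorm : Continuous mnorm := by unfold mnorm; fun_prop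

/-- The potential is bounded by the `p`-th power of the distance to either well. -/
theorem exists_growth_upper {W : M33 → ℝ} {A : M33} {p : ℝ} (hp : 2 ≤ p)
    (h2 : H2 W p) (h3 : H3 W A (-A) p) :
    ∃ C > 0, ∀ ξ, W ξ ≤ C * ‖ξ - A‖ ^ p ∧ W ξ ≤ C * ‖ξ + A‖ ^ p := by
  obtain ⟨C1, hC1, hW⟩ := h2
  obtain ⟨r, hr, C2, hC2, hN⟩ := h3
  have hp0 : 0 ≤ p := by linarith
  have key : ∀ τ : ℝ, (τ = 1 ∨ τ = -1) → ∀ ξ, W ξ ≤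
      (C2 * 3 ^ p + (C1 * (3 * (1 + 3 * ‖A‖ / r)) ^ p + C1 * (3 / r) ^ p)) * ‖ξ - τ • A‖ ^ p := by
    intro τ hτ ξ
    have hmd : mdist A (-A) ξ ≤ 3 * ‖ξ - τ • A‖ := by
      rcases hτ with rfl | rfl
      · rw [one_smul]; exact (min_le_left _ _).trans (mnorm_le _)
      · rw [neg_one_smul]; exact (min_le_right _ _).trans (mnorm_le _)
    have hmd0 : 0 ≤ mdist A (-A) ξ := le_min (mnorm_nonneg _) (mnorm_nonneg _)
    have hτn : ‖τ • A‖ = ‖A‖ := by rcases hτ with rfl | rfl <;> simp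
    rw [add_mul]
    by_cases h : mdist A (-A) ξ ≤ r
    · have h4 := (hN ξ h).2
      have h5 : mdist A (-A) ξ ^ p ≤ 3 ^ p * ‖ξ - τ • A‖ ^ p := by
        rw [← Real.mul_rpow (by norm_num) (norm_nonneg _)]
        exact Real.rpow_le_rpow hmd0 hmd hp0
      have h6 : W ξ ≤ C2 * 3 ^ p * ‖ξ - τ • A‖ ^ p := by
        rw [mul_assoc]; exact h4.trans (mul_le_mul_of_nonneg_left h5 hC2.le)
      have : 0 ≤ (C1 * (3 * (1 + 3 * ‖A‖ / r)) ^ p + C1 * (3 / r) ^ p) * ‖ξ - τ • A‖ ^ p := by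
        positivity
      linarith
    · push Not at h
      have h7 : 1 ≤ 3 / r * ‖ξ - τ • A‖ := by
        rw [div_mul_eq_mul_div, le_div_iff₀ hr]; linarith
      have h8 : mnorm ξ ≤ 3 * (1 + 3 * ‖A‖ / r) * ‖ξ - τ • A‖ := by
        have h9 : ‖ξ‖ ≤ ‖ξ - τ • A‖ + ‖A‖ := by
          rw [← hτn]; exact norm_le_norm_sub_add _ _
        have h10 : ‖A‖ ≤ ‖A‖ * (3 / r * ‖ξ - τ • A‖) := le_mul_of_one_le_right (norm_nonneg _) h7
        have := mnorm_le ξ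
        calc mnorm ξ ≤ 3 * (‖ξ - τ • A‖ + ‖A‖ * (3 / r * ‖ξ - τ • A‖)) := by linarith
          _ = _ := by ring
      have h11 : mnorm ξ ^ p ≤ (3 * (1 + 3 * ‖A‖ / r)) ^ p * ‖ξ - τ • A‖ ^ p := by
        rw [← Real.mul_rpow (by positivity) (norm_nonneg _)]
        exact Real.rpow_le_rpow (mnorm_nonneg _) h8 hp0
      have h12 : 1 ≤ (3 / r) ^ p * ‖ξ - τ • A‖ ^ p := by
        rw [← Real.mul_rpow (by positivity) (norm_nonneg _)]
        exact Real.one_le_rpow h7 hp0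
      have h13 := (hW ξ).2
      have h14 : 0 ≤ C2 * 3 ^ p * ‖ξ - τ • A‖ ^ p := by positivity
      nlinarith [mul_le_mul_of_nonneg_left h11 hC1.le, mul_le_mul_of_nonneg_left h12 hC1.le]
  refine ⟨C2 * 3 ^ p + (C1 * (3 * (1 + 3 * ‖A‖ / r)) ^ p + C1 * (3 / r) ^ p), by positivity,
    fun ξ => ⟨?_, ?_⟩⟩
  · simpa using key 1 (Or.inl rfl) ξ
  · simpa using key (-1) (Or.inr rfl) ξ

/-- The `p`-th power of the distance to the wells is bounded by the potential. -/
theorem exists_growth_lower {W : M33 → ℝ} {A : M33} {p : ℝ} (hp : 2 ≤ p) (hWc : Continuous W)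
    (hW0 : ∀ ξ, 0 ≤ W ξ) (hWz : ∀ ξ, W ξ = 0 → ξ = A ∨ ξ = -A)
    (h2 : H2 W p) (h3 : H3 W A (-A) p) :
    ∃ C > 0, ∀ ξ, min ‖ξ - A‖ ‖ξ + A‖ ^ p ≤ C * W ξ := by
  obtain ⟨C1, hC1, hW⟩ := h2
  obtain ⟨r, hr, C2, hC2, hN⟩ := h3
  have hp0 : 0 ≤ p := by linarith
  set d : M33 → ℝ := fun ξ => min ‖ξ - A‖ ‖ξ + A‖ with hd
  have hdc : Continuous d := by fun_prop
  have hd0 : ∀ ξ, 0 ≤ d ξ := fun ξ => le_min (norm_nonneg _) (norm_nonneg _)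
  have hdm : ∀ ξ, d ξ ≤ mdist A (-A) ξ := fun ξ => by
    refine min_le_min (norm_le_mnorm _) ?_
    simpa using norm_le_mnorm (ξ + A)
  have hmc : Continuous (mdist A (-A)) := by
    unfold mdist
    exact (continuous_mnorm.comp (by fun_prop)).min (continuous_mnorm.comp (by fun_prop))
  -- far away
  set R : ℝ := (2 * C1 ^ 2) ^ (1 / p) + 1 with hR
  have hR1 : 0 ≤ (2 * C1 ^ 2) ^ (1 / p) := by positivity
  have hfar : ∀ ξ, R ≤ ‖ξ‖ → d ξ ^ p ≤ 2 * C1 * (1 + ‖A‖) ^ p * W ξ := by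
    intro ξ hξ
    have h5 : 1 ≤ ‖ξ‖ := by linarith
    have h6 : d ξ ≤ (1 + ‖A‖) * ‖ξ‖ := by
      have : d ξ ≤ ‖ξ‖ + ‖A‖ := (min_le_left _ _).trans (norm_sub_le _ _)
      nlinarith [norm_nonneg A]
    have h7 : d ξ ^ p ≤ (1 + ‖A‖) ^ p * ‖ξ‖ ^ p := by
      rw [← Real.mul_rpow (by positivity) (norm_nonneg _)]
      exact Real.rpow_le_rpow (hd0 _) h6 hp0
    have h8 : 2 * C1 ^ 2 ≤ ‖ξ‖ ^ p := by
      have : ((2 * C1 ^ 2) ^ (1 / p)) ^ p ≤ ‖ξ‖ ^ p :=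
        Real.rpow_le_rpow hR1 (by linarith) hp0
      rwa [← Real.rpow_mul (by positivity), one_div_mul_cancel (by linarith), Real.rpow_one] at this
    have h9 : ‖ξ‖ ^ p ≤ mnorm ξ ^ p := Real.rpow_le_rpow (norm_nonneg _) (norm_le_mnorm _) hp0
    have h10 := (hW ξ).1
    have h11 : ‖ξ‖ ^ p ≤ 2 * C1 * W ξ := by
      have : C1⁻¹ * ‖ξ‖ ^ p - C1 ≤ W ξ :=
        le_trans (by have := mul_le_mul_of_nonneg_left h9 (inv_pos.2 hC1).le; linarith) h10
      have h12 := mul_le_mul_of_nonneg_left this (by positivity : 0 ≤ 2 * C1)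
      have h13 : 2 * C1 * (C1⁻¹ * ‖ξ‖ ^ p - C1) = 2 * ‖ξ‖ ^ p - 2 * C1 ^ 2 := by
        field_simp
      linarith
    calc d ξ ^ p ≤ (1 + ‖A‖) ^ p * ‖ξ‖ ^ p := h7
      _ ≤ (1 + ‖A‖) ^ p * (2 * C1 * W ξ) := by gcongr
      _ = _ := by ring
  -- the intermediate compact region
  set K : Set M33 := Metric.closedBall 0 R ∩ {ξ | r ≤ mdist A (-A) ξ} with hK
  have hKc : IsCompact K :=
    (isCompact_closedBall 0 R).inter_right (isClosed_le continuous_const hmc)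
  have hpos : ∀ ξ ∈ K, 0 < W ξ := by
    intro ξ hξ
    refine lt_of_le_of_ne (hW0 ξ) fun h => ?_
    have hz : mdist A (-A) ξ = 0 := by
      rcases hWz ξ h.symm with rfl | rfl
      · refine le_antisymm ((min_le_left _ _).trans ?_) (le_min (mnorm_nonneg _) (mnorm_nonneg _))
        simp [mnorm]
      · refine le_antisymm ((min_le_right _ _).trans ?_) (le_min (mnorm_nonneg _) (mnorm_nonneg _))
        simp [mnorm]
    have := hξ.2
    simp only [mem_ofPred_eq, hz] at this
    linarith
  obtain ⟨C3, hC3, hmid⟩ : ∃ C3 > 0, ∀ ξ ∈ K, d ξ ^ p ≤ C3 * W ξ := by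
    have hcont : ContinuousOn (fun ξ => d ξ ^ p / W ξ) K :=
      ((hdc.rpow_const fun _ => Or.inr hp0).continuousOn).div hWc.continuousOn
        fun ξ hξ => (hpos ξ hξ).ne'
    obtain ⟨C3, h⟩ := hKc.bddAbove_image hcont
    refine ⟨max C3 1, by positivity, fun ξ hξ => ?_⟩
    rw [← div_le_iff₀ (hpos ξ hξ)]
    exact (h (mem_image_of_mem _ hξ)).trans (le_max_left _ _)
  refine ⟨C2 + C3 + 2 * C1 * (1 + ‖A‖) ^ p, by positivity, fun ξ => ?_⟩
  have hx := hW0 ξ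
  have e1 : 0 ≤ C2 * W ξ := by positivity
  have e2 : 0 ≤ C3 * W ξ := by positivity
  have e3 : 0 ≤ 2 * C1 * (1 + ‖A‖) ^ p * W ξ := by positivity
  rw [add_mul, add_mul]
  change d ξ ^ p ≤ _
  by_cases hfr : R ≤ ‖ξ‖
  · linarith [hfar ξ hfr]
  by_cases hnr : mdist A (-A) ξ ≤ r
  · have h4 := (hN ξ hnr).1
    have h5 : d ξ ^ p ≤ mdist A (-A) ξ ^ p := Real.rpow_le_rpow (hd0 _) (hdm _) hp0
    have h6 := mul_le_mul_of_nonneg_left h4 hC2.le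
    rw [mul_inv_cancel_left₀ hC2.ne'] at h6
    linarith
  · push Not at hfr hnr
    linarith [hmid ξ ⟨by simpa using hfr.le, hnr.le⟩]

/-! ### A convex gauge controlling both the `p`-th and the second power -/

/-- The gauge `x ↦ x ^ p + x ^ 2`. -/
noncomputable def Phi (p : ℝ) (x : ℝ≥0∞) : ℝ≥0∞ := x ^ p + x ^ (2 : ℝ)

theorem Phi_mono {p : ℝ} (hp : 2 ≤ p) : Monotone (Phi p) := fun x y h =>
  add_le_add (ENNReal.rpow_le_rpow h (by linarith)) (ENNReal.rpow_le_rpow h (by norm_num))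

theorem measurable_Phi (p : ℝ) : Measurable (Phi p) := by unfold Phi; fun_prop

theorem Phi_add_le {p : ℝ} (hp : 2 ≤ p) (x y : ℝ≥0∞) :
    Phi p (x + y) ≤ 2 ^ p * (Phi p x + Phi p y) := by
  have h1 := ENNReal.rpow_add_le_mul_rpow_add_rpow x y (p := p) (by linarith)
  have h2 := ENNReal.rpow_add_le_mul_rpow_add_rpow x y (p := 2) (by norm_num)
  have h3 : (2 : ℝ≥0∞) ^ (p - 1) ≤ 2 ^ p :=
    ENNReal.rpow_le_rpow_of_exponent_le (by norm_num) (by linarith)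
  have h4 : (2 : ℝ≥0∞) ^ ((2 : ℝ) - 1) ≤ 2 ^ p :=
    ENNReal.rpow_le_rpow_of_exponent_le (by norm_num) (by linarith)
  calc Phi p (x + y) ≤ 2 ^ p * (x ^ p + y ^ p) + 2 ^ p * (x ^ (2 : ℝ) + y ^ (2 : ℝ)) :=
        add_le_add (h1.trans (mul_le_mul_left h3 _)) (h2.trans (mul_le_mul_left h4 _))
    _ = _ := by unfold Phi; ring

theorem Phi_mul_le {p : ℝ} (hp : 2 ≤ p) (c x : ℝ≥0∞) : Phi p (c * x) ≤ Phi p c * Phi p x := by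
  unfold Phi
  rw [ENNReal.mul_rpow_of_nonneg _ _ (by linarith), ENNReal.mul_rpow_of_nonneg _ _ (by norm_num),
    add_mul, mul_add, mul_add]
  exact add_le_add le_self_add le_add_self

theorem Phi_ne_top {p : ℝ} (hp : 2 ≤ p) {x : ℝ≥0∞} (hx : x ≠ ∞) : Phi p x ≠ ∞ :=
  ENNReal.add_ne_top.2 ⟨ENNReal.rpow_ne_top_of_nonneg (by linarith) hx,
    ENNReal.rpow_ne_top_of_nonneg (by norm_num) hx⟩

theorem rpow_lintegral_le {α : Type*} [MeasurableSpace α] {μ : Measure α} [IsProbabilityMeasure μ]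
    {q : ℝ} (hq : 1 ≤ q) {f : α → ℝ≥0∞} (hf : AEMeasurable f μ) :
    (∫⁻ x, f x ∂μ) ^ q ≤ ∫⁻ x, f x ^ q ∂μ := by
  rcases hq.eq_or_lt with rfl | hq1
  · simp
  have h := ENNReal.lintegral_mul_le_Lp_mul_Lq μ (Real.HolderConjugate.conjExponent hq1) hf
    (aemeasurable_const (b := (1 : ℝ≥0∞)))
  simp only [Pi.mul_apply, mul_one, ENNReal.one_rpow, lintegral_one, measure_univ] at h
  calc (∫⁻ x, f x ∂μ) ^ q ≤ ((∫⁻ x, f x ^ q ∂μ) ^ (1 / q)) ^ q :=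
        ENNReal.rpow_le_rpow h (by linarith)
    _ = _ := by rw [← ENNReal.rpow_mul, one_div_mul_cancel (by linarith), ENNReal.rpow_one]

theorem Phi_lintegral_le {α : Type*} [MeasurableSpace α] {μ : Measure α} [IsProbabilityMeasure μ]
    {p : ℝ} (hp : 2 ≤ p) {f : α → ℝ≥0∞} (hf : AEMeasurable f μ) :
    Phi p (∫⁻ x, f x ∂μ) ≤ ∫⁻ x, Phi p (f x) ∂μ := by
  unfold Phi
  rw [lintegral_add_left' (hf.pow_const p)]
  exact add_le_add (rpow_lintegral_le (by linarith) hf) (rpow_lintegral_le (by norm_num) hf)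

/-! ### Planar profiles on the unit square -/

/-- The sign function with value `1` at the origin. -/
noncomputable def sg (t : ℝ) : ℝ := if 0 ≤ t then 1 else -1

/-- The unit square. -/
def Box : Set Pt2 := II ×ˢ II

/-- Rescaled planar Hessian. -/
noncomputable def hess2 (h : ℝ) (v : Pt2 → V3) (y : Pt2) : ℝ :=
  vnorm (qd f1 (qd f1 v) y) ^ 2 + (h⁻¹) ^ 4 * vnorm (qd f2 (qd f2 v) y) ^ 2
    + 2 * (h⁻¹) ^ 2 * vnorm (qd f2 (qd f1 v) y) ^ 2

/-- Planar energy density. -/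
noncomputable def dens2 (W : M33 → ℝ) (h ε : ℝ) (v : Pt2 → V3) (y : Pt2) : ℝ :=
  ε⁻¹ * W ![qd f1 v y, 0, h⁻¹ • qd f2 v y] + ε * hess2 h v y

/-- Planar energy. -/
noncomputable def E2 (W : M33 → ℝ) (h ε : ℝ) (v : Pt2 → V3) : ℝ≥0∞ :=
  ∫⁻ y in Box, ENNReal.ofReal (dens2 W h ε v y)

/-- Distance of the rescaled planar gradient to the limiting one. -/
noncomputable def gap (a A3 : V3) (h : ℝ) (v : Pt2 → V3) (y : Pt2) : ℝ≥0∞ :=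
  ‖qd f1 v y - sg y.1 • a‖ₑ + ‖h⁻¹ • qd f2 v y - sg y.1 • A3‖ₑ

theorem measurable_sg : Measurable sg :=
  Measurable.ite measurableSet_Ici measurable_const measurable_const

theorem bb0_eq (A3 : V3) (t : ℝ) : bb0 A3 t = sg t • A3 := by
  unfold bb0 sg; split_ifs <;> simp

theorem isOpen_II : IsOpen II := isOpen_Ioo

theorem isOpen_Box : IsOpen Box := isOpen_II.prod isOpen_II

theorem isOpen_Q3 : IsOpen Q3 := isOpen_II.prod (isOpen_II.prod isOpen_II)

theorem measurableSet_II : MeasurableSet II := measurableSet_Ioo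

theorem measurableSet_Box : MeasurableSet Box := isOpen_Box.measurableSet

theorem volume_II : volume II = 1 := by
  simp only [II, Real.volume_Ioo]; norm_num

instance isProbabilityMeasure_II : IsProbabilityMeasure (volume.restrict II) :=
  ⟨by rw [Measure.restrict_apply_univ, volume_II]⟩

theorem restrict_Box :
    (volume.restrict Box : Measure Pt2) = (volume.restrict II).prod (volume.restrict II) := by
  rw [Measure.prod_restrict]; rfl

instance isProbabilityMeasure_Box : IsProbabilityMeasure (volume.restrict Box) := by
  rw [restrict_Box]; infer_instance

theorem restrict_Q3 : (volume.restrict Q3 : Measure Pt) =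
    (volume.restrict II).prod ((volume.restrict II).prod (volume.restrict II)) := by
  rw [Measure.prod_restrict, Measure.prod_restrict]; rfl

theorem measurable_smul_vec {α : Type*} [MeasurableSpace α] {s : α → ℝ} (hs : Measurable s)
    (a : V3) : Measurable fun x => s x • a :=
  measurable_pi_lambda _ fun i => hs.mul_const (a i)

theorem measurable_vec_const_smul {α : Type*} [MeasurableSpace α] (c : ℝ) {f : α → V3}
    (hf : Measurable f) : Measurable fun x => c • f x :=
  measurable_pi_lambda _ fun i => ((measurable_pi_apply i).comp hf).const_mul c

theorem measurable_enorm_vec {α : Type*} [MeasurableSpace α] {f : α → V3}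
    (hf : Measurable f) : Measurable fun x => ‖f x‖ₑ := measurable_enorm.comp hf

theorem measurable_sub_vec {α : Type*} [MeasurableSpace α] {f g : α → V3}
    (hf : Measurable f) (hg : Measurable g) : Measurable fun x => f x - g x :=
  measurable_pi_lambda _ fun i =>
    ((measurable_pi_apply i).comp hf).sub ((measurable_pi_apply i).comp hg)

theorem measurable_qd (e : Pt2) (v : Pt2 → V3) : Measurable (qd e v) :=
  measurable_fderiv_apply_const ℝ v e

theorem measurable_pd (e : Pt) (u : Pt → V3) : Measurable (pd e u) :=
  measurable_fderiv_apply_const ℝ u e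

theorem measurable_gradh (h : ℝ) (u : Pt → V3) : Measurable (gradh h u) := by
  refine measurable_pi_lambda _ fun i => ?_
  fin_cases i
  · exact measurable_pd _ _
  · exact measurable_pd _ _
  · exact measurable_vec_const_smul _ (measurable_pd _ _)

theorem measurable_hessh (h : ℝ) (u : Pt → V3) : Measurable (hessh h u) := by
  have hm : ∀ e e', Measurable fun x => vnorm (pd e (pd e' u) x) := fun e e' =>
    continuous_vnorm.measurable.comp (measurable_pd _ _)
  unfold hessh
  have := hm e1 e1; have := hm e2 e2; have := hm e3 e3
  have := hm e2 e1; have := hm e3 e1; have := hm e3 e2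
  fun_prop

theorem measurable_hess2 (h : ℝ) (v : Pt2 → V3) : Measurable (hess2 h v) := by
  have hm : ∀ e e', Measurable fun x => vnorm (qd e (qd e' v) x) := fun e e' =>
    continuous_vnorm.measurable.comp (measurable_qd _ _)
  unfold hess2
  have := hm f1 f1; have := hm f2 f2; have := hm f2 f1
  fun_prop

theorem measurable_dens2 {W : M33 → ℝ} (hW : Continuous W) (h ε : ℝ) (v : Pt2 → V3) :
    Measurable (dens2 W h ε v) := by
  have h1 : Measurable fun y => (![qd f1 v y, 0, h⁻¹ • qd f2 v y] : M33) := by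
    refine measurable_pi_lambda _ fun i => ?_
    fin_cases i
    · exact measurable_qd _ _
    · exact measurable_const
    · exact measurable_vec_const_smul _ (measurable_qd _ _)
  have h2 := hW.measurable.comp h1
  have h3 := measurable_hess2 h v
  unfold dens2
  exact (h2.const_mul _).add (h3.const_mul _)

theorem measurable_gap (a A3 : V3) (h : ℝ) (v : Pt2 → V3) : Measurable (gap a A3 h v) := by
  have h1 := measurable_qd f1 v
  have h2 := measurable_qd f2 v
  have h3 : Measurable fun y : Pt2 => sg y.1 := measurable_sg.comp measurable_fst
  exact (measurable_enorm_vec (measurable_sub_vec h1 (measurable_smul_vec h3 a))).add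
    (measurable_enorm_vec (measurable_sub_vec (measurable_vec_const_smul _ h2)
      (measurable_smul_vec h3 A3)))

theorem hessh_nonneg (h : ℝ) (v : Pt → V3) (y : Pt) : 0 ≤ hessh h v y := by
  unfold hessh; positivity

/-! ### Chain rules for affine changes of variables -/

section Chain
variable {E G : Type*} [NormedAddCommGroup E] [NormedSpace ℝ E] [NormedAddCommGroup G]
  [NormedSpace ℝ G]

theorem fderiv_comp_affine {L : E → G} {L' : E →L[ℝ] G} (hL : ∀ y, HasFDerivAt L L' y)
    {u : G → V3} {y : E} (hu : DifferentiableAt ℝ u (L y)) (e : E) :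
    fderiv ℝ (fun z => u (L z)) y e = fderiv ℝ u (L y) (L' e) := by
  have := (hu.hasFDerivAt.comp y (hL y)).fderiv
  rw [Function.comp_def] at this
  rw [this]; rfl

theorem fderiv_fderiv_comp_affine {L : E → G} {L' : E →L[ℝ] G}
    (hL : ∀ y, HasFDerivAt L L' y) {U : Set G} (hU : IsOpen U) {u : G → V3}
    (hu : ContDiffOn ℝ 2 u U) {y : E} (hy : L y ∈ U) (e e' : E) :
    fderiv ℝ (fun z => fderiv ℝ (fun z => u (L z)) z e) y e' =
      fderiv ℝ (fun x => fderiv ℝ u x (L' e)) (L y) (L' e') := by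
  have hc : Continuous L := continuous_iff_continuousAt.2 fun y => (hL y).continuousAt
  have h1 : (fun z => fderiv ℝ (fun z => u (L z)) z e) =ᶠ[𝓝 y]
      fun z => (fun x => fderiv ℝ u x (L' e)) (L z) := by
    filter_upwards [(hU.preimage hc).mem_nhds hy] with z hz
    exact fderiv_comp_affine hL
      ((hu.differentiableOn (by norm_num)).differentiableAt (hU.mem_nhds hz)) e
  rw [h1.fderiv_eq]
  refine fderiv_comp_affine (u := fun x => fderiv ℝ u x (L' e)) hL ?_ e'
  have h2 : ContDiffOn ℝ 1 (fderiv ℝ u) U := hu.fderiv_of_isOpen hU (by norm_num)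
  exact ((h2.differentiableOn (by norm_num)).differentiableAt (hU.mem_nhds hy)).clm_apply
    (differentiableAt_const _)

end Chain

/-- The derivative of the slicing map. -/
noncomputable def sliceD : Pt2 →L[ℝ] Pt :=
  (ContinuousLinearMap.fst ℝ ℝ ℝ).prod
    ((0 : Pt2 →L[ℝ] ℝ).prod (ContinuousLinearMap.snd ℝ ℝ ℝ))

theorem hasFDerivAt_slice (x₂ : ℝ) (y : Pt2) :
    HasFDerivAt (fun y : Pt2 => ((y.1, x₂, y.2) : Pt)) sliceD y :=
  hasFDerivAt_fst.prodMk ((hasFDerivAt_const _ _).prodMk hasFDerivAt_snd)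

/-- The projection forgetting the second variable. -/
noncomputable def forgetD : Pt →L[ℝ] Pt2 :=
  (ContinuousLinearMap.fst ℝ ℝ (ℝ × ℝ)).prod
    ((ContinuousLinearMap.snd ℝ ℝ ℝ).comp (ContinuousLinearMap.snd ℝ ℝ (ℝ × ℝ)))

theorem hasFDerivAt_forget (x : Pt) :
    HasFDerivAt (fun x : Pt => ((x.1, x.2.2) : Pt2)) forgetD x := forgetD.hasFDerivAt

theorem sliceD_f1 : sliceD f1 = e1 := by simp [sliceD, f1, e1]
theorem sliceD_f2 : sliceD f2 = e3 := by simp [sliceD, f2, e3]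
theorem forgetD_e1 : forgetD e1 = f1 := by simp [forgetD, f1, e1]
theorem forgetD_e2 : forgetD e2 = 0 := by simp [forgetD, e2]
theorem forgetD_e3 : forgetD e3 = f2 := by simp [forgetD, f2, e3]

/-! ### Fubini on the cube -/

theorem lintegral_Q3 {f : Pt → ℝ≥0∞} (hf : AEMeasurable f (volume.restrict Q3)) :
    AEMeasurable (fun x₂ => ∫⁻ y in Box, f (y.1, x₂, y.2)) (volume.restrict II) ∧
    ∫⁻ x in Q3, f x = ∫⁻ x₂ in II, ∫⁻ y in Box, f (y.1, x₂, y.2) := by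
  set μ : Measure ℝ := volume.restrict II with hμ
  rw [restrict_Q3] at hf ⊢
  rw [restrict_Box]
  have hmp : MeasurePreserving (fun z : Pt => ((z.2.1, z.1, z.2.2) : Pt))
      (μ.prod (μ.prod μ)) (μ.prod (μ.prod μ)) := by
    have h1 := (measurePreserving_prodAssoc μ μ μ)
    have h2 := (Measure.measurePreserving_swap (μ := μ) (ν := μ)).prod (MeasurePreserving.id μ)
    exact (h1.comp h2).comp (h1.symm MeasurableEquiv.prodAssoc)
  have hf' : AEMeasurable (fun z : Pt => f (z.2.1, z.1, z.2.2)) (μ.prod (μ.prod μ)) :=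
    hf.comp_quasiMeasurePreserving hmp.quasiMeasurePreserving
  refine ⟨hf'.lintegral_prod_right', ?_⟩
  rw [← lintegral_prod _ hf']
  conv_lhs => rw [← hmp.map_eq]
  exact lintegral_map' (by rw [hmp.map_eq]; exact hf) hmp.measurable.aemeasurable

theorem exists_slice_le {f : Pt → ℝ≥0∞} (hf : AEMeasurable f (volume.restrict Q3)) :
    ∃ x₂ ∈ II, ∫⁻ y in Box, f (y.1, x₂, y.2) ≤ ∫⁻ x in Q3, f x := by
  obtain ⟨h1, h2⟩ := lintegral_Q3 hf
  rw [h2]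
  obtain ⟨x, hx, h⟩ := exists_le_setLAverage (μ := volume) (s := II) (by rw [volume_II]; simp)
    (by rw [volume_II]; simp) h1
  refine ⟨x, hx, h.trans_eq ?_⟩
  rw [setLAverage_eq, volume_II, div_one]

theorem lintegral_Q3_forget {f : Pt2 → ℝ≥0∞} (hf : AEMeasurable f (volume.restrict Box)) :
    ∫⁻ x in Q3, f (x.1, x.2.2) = ∫⁻ y in Box, f y := by
  have : AEMeasurable (fun x : Pt => f (x.1, x.2.2)) (volume.restrict Q3) := by
    rw [restrict_Q3]
    rw [restrict_Box] at hf
    have hmp : MeasurePreserving (fun x : Pt => ((x.1, x.2.2) : Pt2))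
        ((volume.restrict II).prod ((volume.restrict II).prod (volume.restrict II)))
        ((volume.restrict II).prod (volume.restrict II)) :=
      (MeasurePreserving.id _).prod measurePreserving_snd
    exact hf.comp_quasiMeasurePreserving hmp.quasiMeasurePreserving
  rw [(lintegral_Q3 this).2]
  simp

/-! ### Energy of slices and of extensions -/

theorem dens2_slice_le {W : M33 → ℝ} (hW0 : ∀ ξ, 0 ≤ W ξ) (h4 : H4 W) {h ε ε' η : ℝ}
    (hε : 0 < ε) (hε' : 0 < ε') (hη : 0 < η) (h1 : ε' ≤ η * ε) (h2 : ε ≤ η * ε')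
    {u : Pt → V3} (hu : ContDiffOn ℝ 2 u Q3) {x₂ : ℝ} (hx : x₂ ∈ II) {y : Pt2} (hy : y ∈ Box) :
    dens2 W h ε' (fun y => u (y.1, x₂, y.2)) y ≤
      η * (ε⁻¹ * W (gradh h u (y.1, x₂, y.2)) + ε * hessh h u (y.1, x₂, y.2)) := by
  set x : Pt := (y.1, x₂, y.2) with hxdef
  have hxQ : x ∈ Q3 := ⟨hy.1, hx, hy.2⟩
  have hd : DifferentiableAt ℝ u x :=
    (hu.differentiableOn (by norm_num)).differentiableAt (isOpen_Q3.mem_nhds hxQ)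
  have g1 : ∀ e, qd e (fun y => u (y.1, x₂, y.2)) y = pd (sliceD e) u x := fun e =>
    fderiv_comp_affine (hasFDerivAt_slice x₂) hd e
  have g2 : ∀ e e', qd e' (qd e (fun y => u (y.1, x₂, y.2))) y =
      pd (sliceD e') (pd (sliceD e) u) x := fun e e' =>
    fderiv_fderiv_comp_affine (hasFDerivAt_slice x₂) isOpen_Q3 hu hxQ e e'
  have hWle : W ![qd f1 (fun y => u (y.1, x₂, y.2)) y, 0,
      h⁻¹ • qd f2 (fun y => u (y.1, x₂, y.2)) y] ≤ W (gradh h u x) := by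
    rw [g1, g1, sliceD_f1, sliceD_f2]
    exact h4 (gradh h u x)
  have hH : hess2 h (fun y => u (y.1, x₂, y.2)) y ≤ hessh h u x := by
    unfold hess2 hessh
    rw [g2, g2, g2, sliceD_f1, sliceD_f2]
    nlinarith [sq_nonneg (vnorm (pd e2 (pd e2 u) x)), sq_nonneg (vnorm (pd e2 (pd e1 u) x)),
      mul_nonneg (sq_nonneg h⁻¹) (sq_nonneg (vnorm (pd e3 (pd e2 u) x)))]
  have hH0 := hessh_nonneg h u x
  unfold dens2
  have hinv : ε'⁻¹ ≤ η * ε⁻¹ := by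
    rw [inv_le_iff_one_le_mul₀ hε']
    have : η * ε⁻¹ * ε' = η * ε' / ε := by field_simp
    rw [this, le_div_iff₀ hε]; linarith
  calc _ ≤ ε'⁻¹ * W (gradh h u x) + ε' * hessh h u x := by gcongr
    _ ≤ (η * ε⁻¹) * W (gradh h u x) + (η * ε) * hessh h u x := by
        have := hW0 (gradh h u x)
        gcongr
    _ = _ := by ring

theorem pd_forget {v : Pt2 → V3} (hv : ContDiffOn ℝ 2 v Box) {x : Pt}
    (hx : ((x.1, x.2.2) : Pt2) ∈ Box) (e : Pt) :
    pd e (fun x => v (x.1, x.2.2)) x = qd (forgetD e) v (x.1, x.2.2) :=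
  fderiv_comp_affine hasFDerivAt_forget
    ((hv.differentiableOn (by norm_num)).differentiableAt (isOpen_Box.mem_nhds hx)) e

theorem F_forget {W : M33 → ℝ} (hWc : Continuous W) {h ε : ℝ} {v : Pt2 → V3}
    (hv : ContDiffOn ℝ 2 v Box) :
    F W h ε (fun x => v (x.1, x.2.2)) Q3 = E2 W h ε v := by
  unfold F E2
  rw [← lintegral_Q3_forget (f := fun y => ENNReal.ofReal (dens2 W h ε v y))
    (measurable_dens2 hWc h ε v).ennreal_ofReal.aemeasurable]
  refine setLIntegral_congr_fun isOpen_Q3.measurableSet fun x hx => ?_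
  have hxB : ((x.1, x.2.2) : Pt2) ∈ Box := ⟨hx.1, hx.2.2⟩
  have g2 : ∀ e e', pd e' (pd e (fun x => v (x.1, x.2.2))) x =
      qd (forgetD e') (qd (forgetD e) v) (x.1, x.2.2) := fun e e' =>
    fderiv_fderiv_comp_affine hasFDerivAt_forget isOpen_Box hv hxB e e'
  have hz : ∀ (u : Pt2 → V3) y, qd 0 u y = 0 := fun u y => by simp [qd]
  have hz' : ∀ e (u : Pt2 → V3) y, qd e (qd 0 u) y = 0 := fun e u y => by
    have : qd 0 u = fun _ => 0 := funext (hz u)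
    rw [this]; simp [qd]
  have hv0 : vnorm 0 = 0 := by simp [vnorm]
  simp only [dens2, hess2, hessh, gradh, g2, pd_forget hv hxB, forgetD_e1, forgetD_e2, forgetD_e3,
    hz, hz', hv0]
  congr 1
  ring

theorem Jrho_eq : Jrho II 1 = Q3 := rfl

/-- Near-optimal planar profiles with the exact ratio `γ` between thickness and `ε`. -/
theorem exists_planar_profile {W : M33 → ℝ} (hWc : Continuous W) (hW0 : ∀ ξ, 0 ≤ W ξ)
    (h4 : H4 W) {a A3 : V3} {γ : ℝ} (hγ : 0 < γ) (hK : Kstar W a A3 γ ≠ ⊤) {δ : ℝ}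
    (hδ : 0 < δ) :
    ∃ (ε : ℝ) (v : Pt2 → V3), 0 < ε ∧ ε < δ ∧ ContDiffOn ℝ 2 v Box ∧
      E2 W (γ * ε) ε v ≤ Kstar W a A3 γ + ENNReal.ofReal δ ∧
      ∫⁻ y in Box, ‖v y - |y.1| • a‖ₑ ≤ ENNReal.ofReal δ ∧
      ∫⁻ y in Box, ‖(γ * ε)⁻¹ • qd f2 v y - sg y.1 • A3‖ₑ ≤ ENNReal.ofReal δ := by
  set k := (Kstar W a A3 γ).toReal with hk
  have hk0 : 0 ≤ k := ENNReal.toReal_nonneg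
  have hKk : Kstar W a A3 γ = ENNReal.ofReal k := (ENNReal.ofReal_toReal hK).symm
  set η := min 1 (δ / (2 * k + 4)) with hη
  have hη0 : 0 < η := by positivity
  have hη1 : η ≤ 1 := min_le_left _ _
  have hη2 : η * (2 * k + 4) ≤ δ := by
    have := min_le_right 1 (δ / (2 * k + 4))
    rwa [le_div_iff₀ (by positivity)] at this
  have hlt : Kstar W a A3 γ < ENNReal.ofReal (k + η) := by
    rw [hKk]; exact (ENNReal.ofReal_lt_ofReal_iff (by positivity)).2 (by linarith)
  obtain ⟨L, ⟨h, ε, u, hh, hε, hh0, hε0, hr, hu, hc1, hc2, rfl⟩, hL⟩ := sInf_lt_iff.1 hlt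
  simp only [Jrho_eq] at hu hc1 hc2 hL
  have hfr := frequently_lt_of_liminf_lt (by isBoundedDefault) hL
  have ev1 : ∀ᶠ n in atTop, h n < γ * δ := hh0.eventually (gt_mem_nhds (by positivity))
  have ev2 : ∀ᶠ n in atTop, h n / ε n < γ * (1 + η) :=
    hr.eventually (gt_mem_nhds (by nlinarith))
  have ev3 : ∀ᶠ n in atTop, γ / (1 + η) < h n / ε n :=
    hr.eventually (lt_mem_nhds (by rw [div_lt_iff₀ (by positivity)]; nlinarith))
  have ev4 := hc1.eventually (gt_mem_nhds (by positivity : 0 < ENNReal.ofReal (η ^ 2 / 2)))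
  have ev5 := hc2.eventually (gt_mem_nhds (by positivity : 0 < ENNReal.ofReal (η ^ 2 / 2)))
  obtain ⟨n, hF, n1, n2, n3, n4, n5⟩ :=
    (hfr.and_eventually (ev1.and (ev2.and (ev3.and (ev4.and ev5))))).exists
  have hhn := hh n
  have hεn := hε n
  have hun := hu n
  have m1 : h n ≤ γ * (1 + η) * ε n := by
    rw [div_lt_iff₀ hεn] at n2; exact n2.le
  have m2 : γ * ε n ≤ (1 + η) * h n := by
    rw [div_lt_div_iff₀ (by positivity) hεn] at n3; linarith
  set ε' := h n / γ with hε'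
  have hγε : γ * ε' = h n := by rw [hε']; field_simp
  set f₁ : Pt → ℝ≥0∞ := fun x => ENNReal.ofReal (1 + η) *
    ENNReal.ofReal ((ε n)⁻¹ * W (gradh (h n) (u n) x) + ε n * hessh (h n) (u n) x) with hf₁
  set f₂ : Pt → ℝ≥0∞ := fun x => ENNReal.ofReal (vnorm (u n x - u0 a x)) with hf₂
  set f₃ : Pt → ℝ≥0∞ := fun x => ENNReal.ofReal (vnorm ((h n)⁻¹ • pd e3 (u n) x - b0 A3 x))
    with hf₃
  have hb0 : Measurable fun x : Pt => b0 A3 x := by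
    have : (fun x : Pt => b0 A3 x) = fun x => sg x.1 • A3 := funext fun x => bb0_eq _ _
    rw [this]; exact measurable_smul_vec (measurable_sg.comp measurable_fst) A3
  have hf₁m : Measurable f₁ := by
    refine Measurable.const_mul (Measurable.ennreal_ofReal ?_) _
    exact ((hWc.measurable.comp (measurable_gradh _ _)).const_mul _).add
      ((measurable_hessh _ _).const_mul _)
  have hf₃m : Measurable f₃ :=
    (continuous_vnorm.measurable.comp (measurable_sub_vec
      (measurable_vec_const_smul _ (measurable_pd _ _)) hb0)).ennreal_ofReal
  have hf₂m : AEMeasurable f₂ (volume.restrict Q3) := by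
    have hcont : ContinuousOn (fun x => vnorm (u n x - u0 a x)) Q3 := by
      refine continuous_vnorm.comp_continuousOn (hun.continuousOn.sub ?_)
      unfold u0 ub0; fun_prop
    exact (hcont.aemeasurable isOpen_Q3.measurableSet).ennreal_ofReal
  have hi2 : ∫⁻ x in Q3, f₂ x ≤ ENNReal.ofReal (η ^ 2 / 2) := n4.le
  have hi3 : ∫⁻ x in Q3, f₃ x ≤ ENNReal.ofReal (η ^ 2 / 2) := n5.le
  have hi1 : ∫⁻ x in Q3, f₁ x ≤ ENNReal.ofReal ((1 + η) * (k + η)) := by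
    rw [lintegral_const_mul' _ _ ENNReal.ofReal_ne_top, ENNReal.ofReal_mul (by positivity)]
    exact mul_le_mul_right hF.le _
  set f : Pt → ℝ≥0∞ := fun x => f₁ x + ENNReal.ofReal η⁻¹ * (f₂ x + f₃ x) with hf
  have hfm : AEMeasurable f (volume.restrict Q3) :=
    hf₁m.aemeasurable.add ((hf₂m.add hf₃m.aemeasurable).const_mul _)
  obtain ⟨x₂, hx₂, hle⟩ := exists_slice_le hfm
  have htot : ∫⁻ x in Q3, f x ≤ ENNReal.ofReal ((1 + η) * (k + η) + η) := by
    have hsplit : ∫⁻ x in Q3, ENNReal.ofReal η⁻¹ * (f₂ x + f₃ x) =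
        ENNReal.ofReal η⁻¹ * ((∫⁻ x in Q3, f₂ x) + (∫⁻ x in Q3, f₃ x)) := by
      rw [lintegral_const_mul' _ _ ENNReal.ofReal_ne_top, lintegral_add_right _ hf₃m]
    rw [hf, lintegral_add_left hf₁m, ENNReal.ofReal_add (by positivity) hη0.le]
    refine add_le_add hi1 (hsplit.trans_le ?_)
    calc _ ≤ ENNReal.ofReal η⁻¹ * (ENNReal.ofReal (η ^ 2 / 2) + ENNReal.ofReal (η ^ 2 / 2)) := by
          exact mul_le_mul_right (add_le_add hi2 hi3) _
      _ = ENNReal.ofReal η := by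
          rw [← ENNReal.ofReal_add (by positivity) (by positivity),
            ← ENNReal.ofReal_mul (by positivity)]
          congr 1; field_simp; ring
  replace hle := hle.trans htot
  have hB : ∀ {y : Pt2}, y ∈ Box → ((y.1, x₂, y.2) : Pt) ∈ Q3 := fun hy => ⟨hy.1, hx₂, hy.2⟩
  have hsmall : ∀ g : Pt2 → ℝ≥0∞, (∀ y ∈ Box, ENNReal.ofReal η⁻¹ * g y ≤ f (y.1, x₂, y.2)) →
      ∫⁻ y in Box, g y ≤ ENNReal.ofReal δ := by
    intro g hg
    have e1 : ENNReal.ofReal η⁻¹ * ∫⁻ y in Box, g y ≤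
        ENNReal.ofReal ((1 + η) * (k + η) + η) := by
      rw [← lintegral_const_mul' _ _ ENNReal.ofReal_ne_top]
      exact (setLIntegral_mono' measurableSet_Box hg).trans hle
    calc ∫⁻ y in Box, g y = ENNReal.ofReal η * (ENNReal.ofReal η⁻¹ * ∫⁻ y in Box, g y) := by
          rw [← mul_assoc, ← ENNReal.ofReal_mul hη0.le, mul_inv_cancel₀ hη0.ne']; simp
      _ ≤ ENNReal.ofReal η * ENNReal.ofReal ((1 + η) * (k + η) + η) := by gcongr
      _ = ENNReal.ofReal (η * ((1 + η) * (k + η) + η)) := (ENNReal.ofReal_mul hη0.le).symm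
      _ ≤ ENNReal.ofReal δ := by
          refine ENNReal.ofReal_le_ofReal ?_
          refine le_trans (mul_le_mul_of_nonneg_left ?_ hη0.le) hη2
          nlinarith
  have hgapd : ∀ y ∈ Box, qd f2 (fun y => u n (y.1, x₂, y.2)) y = pd e3 (u n) (y.1, x₂, y.2) := by
    intro y hy
    have hd : DifferentiableAt ℝ (u n) (y.1, x₂, y.2) :=
      (hun.differentiableOn (by norm_num)).differentiableAt (isOpen_Q3.mem_nhds (hB hy))
    rw [← sliceD_f2]
    exact fderiv_comp_affine (hasFDerivAt_slice x₂) hd f2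
  refine ⟨ε', fun y => u n (y.1, x₂, y.2), by positivity, ?_, ?_, ?_, ?_, ?_⟩
  · rw [hε', div_lt_iff₀ hγ]; linarith
  · refine hun.comp (ContDiff.contDiffOn ?_) fun y hy => hB hy
    fun_prop
  · rw [hγε, hKk, ← ENNReal.ofReal_add hk0 hδ.le]
    refine (le_trans (setLIntegral_mono' measurableSet_Box fun y hy => ?_) hle).trans
      (ENNReal.ofReal_le_ofReal (by nlinarith))
    refine le_trans ?_ (le_self_add (a := f₁ (y.1, x₂, y.2)))
    rw [hf₁]
    dsimp only
    rw [← ENNReal.ofReal_mul (by positivity)]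
    refine ENNReal.ofReal_le_ofReal
      (dens2_slice_le hW0 h4 hεn (by positivity) (by positivity) ?_ ?_ hun hx₂ hy)
    · rw [hε', div_le_iff₀ hγ]; linarith
    · rw [hε', ← mul_div_assoc, le_div_iff₀ hγ]; linarith
  · refine hsmall _ fun y hy => ?_
    refine le_trans ?_ (le_add_self (a := ENNReal.ofReal η⁻¹ * _) (b := f₁ _))
    refine mul_le_mul_right (le_trans ?_ le_self_add) _
    rw [← ofReal_norm]
    exact ENNReal.ofReal_le_ofReal (norm_le_vnorm _)
  · refine hsmall _ fun y hy => ?_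
    refine le_trans ?_ (le_add_self (a := ENNReal.ofReal η⁻¹ * _) (b := f₁ _))
    refine mul_le_mul_right (le_trans ?_ le_add_self) _
    rw [hgapd y hy, hγε, ← ofReal_norm, ← bb0_eq]
    exact ENNReal.ofReal_le_ofReal (norm_le_vnorm _)

/-! ### Interpolation with an affine map across a slab -/

/-- A smooth step with bounded derivatives. -/
theorem exists_step_bound : ∃ K : ℝ, 1 ≤ K ∧ ∀ t, |Real.smoothTransition t| ≤ 1 ∧
    |deriv Real.smoothTransition t| ≤ K ∧ |deriv (deriv Real.smoothTransition) t| ≤ K := by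
  have hs : ContDiff ℝ 2 Real.smoothTransition := Real.smoothTransition.contDiff
  have hd1 : ContDiff ℝ 1 (deriv Real.smoothTransition) := hs.deriv' 
  have hc1 : Continuous (deriv Real.smoothTransition) := hd1.continuous
  have hc2 : Continuous (deriv (deriv Real.smoothTransition)) := (hd1.deriv' (n := 0)).continuous
  have z1 : ∀ t, t ∉ Icc (0 : ℝ) 1 → deriv Real.smoothTransition t = 0 := by
    intro t ht
    rw [mem_Icc, not_and_or, not_le, not_le] at ht
    rcases ht with ht | ht
    · have : Real.smoothTransition =ᶠ[𝓝 t] fun _ => 0 := by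
        filter_upwards [gt_mem_nhds ht] with s hs
        exact Real.smoothTransition.zero_of_nonpos hs.le
      rw [this.deriv_eq]; simp
    · have : Real.smoothTransition =ᶠ[𝓝 t] fun _ => 1 := by
        filter_upwards [lt_mem_nhds ht] with s hs
        exact Real.smoothTransition.one_of_one_le hs.le
      rw [this.deriv_eq]; simp
  have z2 : ∀ t, t ∉ Icc (0 : ℝ) 1 → deriv (deriv Real.smoothTransition) t = 0 := by
    intro t ht
    have : deriv Real.smoothTransition =ᶠ[𝓝 t] fun _ => 0 := by
      filter_upwards [isClosed_Icc.isOpen_compl.mem_nhds ht] with s hs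
      exact z1 s hs
    rw [this.deriv_eq]; simp
  obtain ⟨K1, h1⟩ := isCompact_Icc.exists_bound_of_continuousOn (s := Icc (0 : ℝ) 1) hc1.continuousOn
  obtain ⟨K2, h2⟩ := isCompact_Icc.exists_bound_of_continuousOn (s := Icc (0 : ℝ) 1) hc2.continuousOn
  refine ⟨max 1 (max K1 K2), le_max_left _ _, fun t => ⟨?_, ?_, ?_⟩⟩
  · rw [abs_of_nonneg (Real.smoothTransition.nonneg t)]
    exact Real.smoothTransition.le_one t
  · by_cases ht : t ∈ Icc (0 : ℝ) 1
    · exact (h1 t ht).trans ((le_max_left _ _).trans (le_max_right _ _))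
    · rw [z1 t ht]; simp
  · by_cases ht : t ∈ Icc (0 : ℝ) 1
    · exact (h2 t ht).trans ((le_max_right _ _).trans (le_max_right _ _))
    · rw [z2 t ht]; simp

/-- The affine map with rescaled gradient `σ • (a, A3)`. -/
noncomputable def aff (σ : ℝ) (a A3 : V3) (h : ℝ) (c : V3) (y : Pt2) : V3 :=
  (σ * y.1) • a + (σ * h * y.2) • A3 + c

theorem contDiff_aff (σ : ℝ) (a A3 : V3) (h : ℝ) (c : V3) : ContDiff ℝ 2 (aff σ a A3 h c) := by
  unfold aff; fun_prop

theorem qd_aff (σ : ℝ) (a A3 : V3) (h : ℝ) (c : V3) (e y : Pt2) :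
    qd e (aff σ a A3 h c) y = (σ * e.1) • a + (σ * h * e.2) • A3 := by
  have : HasFDerivAt (aff σ a A3 h c) ((ContinuousLinearMap.fst ℝ ℝ ℝ).smulRight (σ • a) +
      (ContinuousLinearMap.snd ℝ ℝ ℝ).smulRight ((σ * h) • A3)) y := by
    have h1 := (((ContinuousLinearMap.fst ℝ ℝ ℝ).smulRight (σ • a) +
      (ContinuousLinearMap.snd ℝ ℝ ℝ).smulRight ((σ * h) • A3)).hasFDerivAt (x := y)).add_const c
    refine h1.congr_of_eventuallyEq (Eventually.of_forall fun z => ?_)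
    simp [aff, smul_smul, mul_comm]
  rw [qd, this.fderiv]
  simp [smul_smul, mul_comm]

theorem qd_qd_aff (σ : ℝ) (a A3 : V3) (h : ℝ) (c : V3) (e e' y : Pt2) :
    qd e' (qd e (aff σ a A3 h c)) y = 0 := by
  have : qd e (aff σ a A3 h c) = fun _ => (σ * e.1) • a + (σ * h * e.2) • A3 :=
    funext fun y => qd_aff ..
  rw [this]; simp [qd]

theorem qd_smul {ψ : ℝ → ℝ} {f : Pt2 → V3} {y : Pt2} (hψ : DifferentiableAt ℝ ψ y.1)
    (hf : DifferentiableAt ℝ f y) (e : Pt2) :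
    qd e (fun z => ψ z.1 • f z) y = ψ y.1 • qd e f y + (e.1 * deriv ψ y.1) • f y := by
  have h1 : HasFDerivAt (fun z : Pt2 => ψ z.1) _ y := hψ.hasDerivAt.hasFDerivAt.comp y hasFDerivAt_fst
  have h2 := h1.smul hf.hasFDerivAt
  unfold qd
  have h3 : (fun z : Pt2 => ψ z.1 • f z) = (fun z : Pt2 => ψ z.1) • f := rfl
  rw [h3, h2.fderiv]
  simp

theorem qd_const_add_add_smul {f g : Pt2 → V3} {y : Pt2} (b : V3) (r : ℝ) (e : Pt2)
    (hf : DifferentiableAt ℝ f y) (hg : DifferentiableAt ℝ g y) :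
    qd e (fun z => b + (f z + r • g z)) y = qd e f y + r • qd e g y := by
  have h := ((hf.hasFDerivAt.add (hg.hasFDerivAt.const_smul r)).const_add b).fderiv
  unfold qd
  exact (congrArg (fun L : Pt2 →L[ℝ] V3 => L e) h).trans rfl

/-- Interpolation between `u` (where `ψ = 1`) and `l` (where `ψ = 0`). -/
noncomputable def interp (ψ : ℝ → ℝ) (l u : Pt2 → V3) (y : Pt2) : V3 := l y + ψ y.1 • (u y - l y)

theorem contDiffOn_interp {ψ : ℝ → ℝ} {l u : Pt2 → V3} {U : Set Pt2} (hψ : ContDiff ℝ 2 ψ)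
    (hl : ContDiff ℝ 2 l) (hu : ContDiffOn ℝ 2 u U) : ContDiffOn ℝ 2 (interp ψ l u) U := by
  unfold interp
  exact hl.contDiffOn.add ((hψ.comp contDiff_fst).contDiffOn.smul (hu.sub hl.contDiffOn))

theorem qd_eventuallyEq {u v : Pt2 → V3} {y : Pt2} (h : u =ᶠ[𝓝 y] v) (e : Pt2) :
    qd e u =ᶠ[𝓝 y] qd e v := by
  filter_upwards [h.fderiv (𝕜 := ℝ)] with z hz
  simp only [qd, hz]

theorem dens2_congr {u v : Pt2 → V3} {y : Pt2} (h : u =ᶠ[𝓝 y] v) (W : M33 → ℝ) (k ε : ℝ) :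
    dens2 W k ε u y = dens2 W k ε v y := by
  have h1 := fun e => (qd_eventuallyEq h e).eq_of_nhds
  have h2 := fun e e' => (qd_eventuallyEq (qd_eventuallyEq h e) e').eq_of_nhds
  simp only [dens2, hess2, h1, h2]

theorem gap_congr {u v : Pt2 → V3} {y : Pt2} (h : u =ᶠ[𝓝 y] v) (a A3 : V3) (k : ℝ) :
    gap a A3 k u y = gap a A3 k v y := by
  have h1 := fun e => (qd_eventuallyEq h e).eq_of_nhds
  simp only [gap, h1]

section Interp
variable {ψ : ℝ → ℝ} {u : Pt2 → V3} {U : Set Pt2} {σ h : ℝ} {a A3 c : V3}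

theorem differentiableAt_qd (hU : IsOpen U) (hu : ContDiffOn ℝ 2 u U) {y : Pt2} (hy : y ∈ U)
    (e : Pt2) : DifferentiableAt ℝ (qd e u) y := by
  have h2 : ContDiffOn ℝ 1 (fderiv ℝ u) U := hu.fderiv_of_isOpen hU (by norm_num)
  exact ((h2.differentiableOn (by norm_num)).differentiableAt (hU.mem_nhds hy)).clm_apply
    (differentiableAt_const _)

theorem qd_interp (hψ : ContDiff ℝ 2 ψ) (hU : IsOpen U) (hu : ContDiffOn ℝ 2 u U)
    {y : Pt2} (hy : y ∈ U) (e : Pt2) :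
    qd e (interp ψ (aff σ a A3 h c) u) y = qd e (aff σ a A3 h c) y +
      (ψ y.1 • (qd e u y - qd e (aff σ a A3 h c) y) +
        (e.1 * deriv ψ y.1) • (u y - aff σ a A3 h c y)) := by
  have hud : DifferentiableAt ℝ u y :=
    (hu.differentiableOn (by norm_num)).differentiableAt (hU.mem_nhds hy)
  have hld : DifferentiableAt ℝ (aff σ a A3 h c) y :=
    (contDiff_aff σ a A3 h c).differentiable (by norm_num) y
  have hψd : DifferentiableAt ℝ ψ y.1 := hψ.differentiable (by norm_num) _
  have hw : qd e (fun z => u z - aff σ a A3 h c z) y = qd e u y - qd e (aff σ a A3 h c) y := by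
    unfold qd; rw [fderiv_fun_sub hud hld]; rfl
  have hs := qd_smul hψd (hud.sub hld) e
  have : qd e (interp ψ (aff σ a A3 h c) u) y = qd e (aff σ a A3 h c) y +
      qd e (fun z => ψ z.1 • (u z - aff σ a A3 h c z)) y := by
    have hd : DifferentiableAt ℝ (fun z => ψ z.1 • (u z - aff σ a A3 h c z)) y :=
      (hψd.comp y differentiableAt_fst).smul (hud.sub hld)
    unfold qd interp; rw [fderiv_fun_add hld hd]; rfl
  rw [this, ← hw]
  exact congrArg _ hs

theorem qd_qd_interp (hψ : ContDiff ℝ 2 ψ) (hU : IsOpen U) (hu : ContDiffOn ℝ 2 u U)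
    {y : Pt2} (hy : y ∈ U) (e e' : Pt2) :
    qd e' (qd e (interp ψ (aff σ a A3 h c) u)) y =
      ψ y.1 • qd e' (qd e u) y + (e'.1 * deriv ψ y.1) • (qd e u y - qd e (aff σ a A3 h c) y) +
      e.1 • (deriv ψ y.1 • (qd e' u y - qd e' (aff σ a A3 h c) y) +
        (e'.1 * deriv (deriv ψ) y.1) • (u y - aff σ a A3 h c y)) := by
  have hud : DifferentiableAt ℝ u y :=
    (hu.differentiableOn (by norm_num)).differentiableAt (hU.mem_nhds hy)
  have hld : DifferentiableAt ℝ (aff σ a A3 h c) y :=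
    (contDiff_aff σ a A3 h c).differentiable (by norm_num) y
  have hψd : DifferentiableAt ℝ ψ y.1 := hψ.differentiable (by norm_num) _
  have hψd2 : DifferentiableAt ℝ (deriv ψ) y.1 :=
    (hψ.deriv' (n := 1)).differentiable (by norm_num) _
  set b : V3 := (σ * e.1) • a + (σ * h * e.2) • A3 with hb
  have hqa : ∀ z, qd e (aff σ a A3 h c) z = b := fun z => qd_aff ..
  have hev : qd e (interp ψ (aff σ a A3 h c) u) =ᶠ[𝓝 y] fun z => b +
      (ψ z.1 • (qd e u z - b) + e.1 • (deriv ψ z.1 • (u z - aff σ a A3 h c z))) := by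
    filter_upwards [hU.mem_nhds hy] with z hz
    rw [qd_interp hψ hU hu hz, hqa, mul_smul]
  rw [(qd_eventuallyEq hev e').eq_of_nhds, hqa]
  have hqd := differentiableAt_qd hU hu hy e
  have d1 : DifferentiableAt ℝ (fun z => ψ z.1 • (qd e u z - b)) y :=
    (hψd.comp y differentiableAt_fst).smul (hqd.sub_const b)
  have d2 : DifferentiableAt ℝ (fun z => deriv ψ z.1 • (u z - aff σ a A3 h c z)) y :=
    (hψd2.comp y differentiableAt_fst).smul (hud.sub hld)
  have s1 := qd_smul hψd (hqd.sub_const b) e'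
  have s2 := qd_smul hψd2 (hud.sub hld) e'
  have w1 : qd e' (fun z => qd e u z - b) y = qd e' (qd e u) y := by
    unfold qd; rw [fderiv_sub_const]
  have w2 : qd e' (fun z => u z - aff σ a A3 h c z) y = qd e' u y - qd e' (aff σ a A3 h c) y := by
    unfold qd; rw [fderiv_fun_sub hud hld]; rfl
  have w3 : qd e' (fun z => b + (ψ z.1 • (qd e u z - b) +
      e.1 • (deriv ψ z.1 • (u z - aff σ a A3 h c z)))) y =
      qd e' (fun z => ψ z.1 • (qd e u z - b)) y +
      e.1 • qd e' (fun z => deriv ψ z.1 • (u z - aff σ a A3 h c z)) y :=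
    qd_const_add_add_smul b e.1 e' d1 d2
  rw [w3, s1, w1, ← w2]
  exact congrArg (fun z => _ + e.1 • z) s2

set_option maxHeartbeats 1000000 in
theorem interp_bound {W : M33 → ℝ} (hW0 : ∀ ξ, 0 ≤ W ξ) {p C K ε : ℝ} (hp : 2 ≤ p)
    (hC : 0 ≤ C) (hWC : ∀ ξ, W ξ ≤ C * ‖ξ - ![σ • a, 0, σ • A3]‖ ^ p) (hK : 1 ≤ K) (hε : 0 < ε)
    (hh : 0 < h) (hψ : ContDiff ℝ 2 ψ) (hU : IsOpen U) (hu : ContDiffOn ℝ 2 u U) {y : Pt2}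
    (hy : y ∈ U) (b0 : |ψ y.1| ≤ 1) (b1 : |deriv ψ y.1| ≤ K / ε)
    (b2 : |deriv (deriv ψ) y.1| ≤ K / ε ^ 2) :
    let R := ‖qd f1 u y - σ • a‖ + ‖h⁻¹ • qd f2 u y - σ • A3‖ +
      K / ε * ‖u y - aff σ a A3 h c y‖
    ‖qd f1 (interp ψ (aff σ a A3 h c) u) y - σ • a‖ +
      ‖h⁻¹ • qd f2 (interp ψ (aff σ a A3 h c) u) y - σ • A3‖ ≤ R ∧
    dens2 W h ε (interp ψ (aff σ a A3 h c) u) y ≤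
      ε⁻¹ * ((C + 36 * K ^ 2) * (R ^ p + R ^ 2)) + 6 * dens2 W h ε u y := by
  intro R
  set w := u y - aff σ a A3 h c y with hw
  set g := interp ψ (aff σ a A3 h c) u with hg
  have q1 : qd f1 (aff σ a A3 h c) y = σ • a := by rw [qd_aff]; simp [f1]
  have q2 : qd f2 (aff σ a A3 h c) y = (σ * h) • A3 := by rw [qd_aff]; simp [f2]
  set G1 := qd f1 u y - σ • a with hG1
  set G2 := h⁻¹ • qd f2 u y - σ • A3 with hG2
  have hG2' : qd f2 u y - (σ * h) • A3 = h • G2 := by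
    rw [hG2, smul_sub, smul_smul, smul_smul, mul_inv_cancel₀ hh.ne', one_smul, mul_comm h]
  have d1 : qd f1 g y - σ • a = ψ y.1 • G1 + deriv ψ y.1 • w := by
    rw [qd_interp hψ hU hu hy, q1]; simp [f1, hG1, hw]
  have d2 : h⁻¹ • qd f2 g y - σ • A3 = ψ y.1 • G2 := by
    rw [qd_interp hψ hU hu hy, q2, hG2']
    simp only [f2, zero_mul, zero_smul, add_zero, smul_add, smul_smul]
    rw [show h⁻¹ * (σ * h) = σ by field_simp, show h⁻¹ * (ψ y.1 * h) = ψ y.1 by field_simp]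
    simp
  have d11 : qd f1 (qd f1 g) y = ψ y.1 • qd f1 (qd f1 u) y +
      ((2 * deriv ψ y.1) • G1 + deriv (deriv ψ) y.1 • w) := by
    rw [qd_qd_interp hψ hU hu hy, q1]
    rw [← hG1, ← hw, show f1.1 = (1 : ℝ) from rfl, one_mul, one_mul, one_smul, two_mul, add_smul]
    abel
  have d21 : qd f2 (qd f1 g) y = ψ y.1 • qd f2 (qd f1 u) y + (h * deriv ψ y.1) • G2 := by
    rw [qd_qd_interp hψ hU hu hy, q1, q2, hG2']
    simp [f1, f2, smul_smul, mul_comm]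
  have d22 : qd f2 (qd f2 g) y = ψ y.1 • qd f2 (qd f2 u) y := by
    rw [qd_qd_interp hψ hU hu hy]
    simp [f2]
  have hKε : 0 ≤ K / ε := by positivity
  have nn : ∀ z : V3, ‖ψ y.1 • z‖ ≤ ‖z‖ := fun z => by
    rw [norm_smul, Real.norm_eq_abs]
    exact mul_le_of_le_one_left (norm_nonneg z) b0
  have n1 : ‖qd f1 g y - σ • a‖ ≤ ‖G1‖ + K / ε * ‖w‖ := by
    rw [d1]
    refine (norm_add_le _ _).trans (add_le_add (nn _) ?_)
    rw [norm_smul]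
    gcongr
    exact b1
  have n2 : ‖h⁻¹ • qd f2 g y - σ • A3‖ ≤ ‖G2‖ := by rw [d2]; exact nn _
  have hRdef : R = ‖G1‖ + ‖G2‖ + K / ε * ‖w‖ := rfl
  have hR0 : 0 ≤ R := by positivity
  have hRG1 : ‖G1‖ + K / ε * ‖w‖ ≤ R := by rw [hRdef]; linarith [norm_nonneg G2]
  have hRG2 : ‖G2‖ ≤ R := by
    rw [hRdef]; have : 0 ≤ K / ε * ‖w‖ := by positivity
    linarith [norm_nonneg G1]
  refine ⟨by rw [hRdef]; linarith, ?_⟩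
  have hWg : W ![qd f1 g y, 0, h⁻¹ • qd f2 g y] ≤ C * R ^ p := by
    refine (hWC _).trans ?_
    gcongr
    refine (pi_norm_le_iff_of_nonneg hR0).2 fun i => ?_
    fin_cases i
    · exact n1.trans hRG1
    · simpa using hR0
    · exact n2.trans hRG2
  have m11 : ‖qd f1 (qd f1 g) y‖ ≤ vnorm (qd f1 (qd f1 u) y) + 2 * K / ε * R := by
    rw [d11]
    refine (norm_add_le _ _).trans (add_le_add ((nn _).trans (norm_le_vnorm _)) ?_)
    refine (norm_add_le _ _).trans ?_
    rw [norm_smul, norm_smul, norm_mul, Real.norm_eq_abs, Real.norm_eq_abs, Real.norm_eq_abs]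
    calc |2| * |deriv ψ y.1| * ‖G1‖ + |deriv (deriv ψ) y.1| * ‖w‖
        ≤ 2 * (K / ε) * ‖G1‖ + K / ε ^ 2 * ‖w‖ := by
          rw [abs_two]; gcongr
      _ ≤ 2 * (K / ε) * ‖G1‖ + 2 * (K / ε) * (K / ε * ‖w‖) := by
          have : K / ε ^ 2 ≤ 2 * (K / ε) * (K / ε) := by
            rw [div_le_iff₀ (by positivity)]
            have : 2 * (K / ε) * (K / ε) * ε ^ 2 = 2 * K * K := by field_simp
            rw [this]; nlinarith
          have := mul_le_mul_of_nonneg_right this (norm_nonneg w)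
          linarith
      _ = 2 * K / ε * (‖G1‖ + K / ε * ‖w‖) := by ring
      _ ≤ 2 * K / ε * R := by gcongr
  have m21 : ‖qd f2 (qd f1 g) y‖ ≤ vnorm (qd f2 (qd f1 u) y) + h * (K / ε) * R := by
    rw [d21]
    refine (norm_add_le _ _).trans (add_le_add ((nn _).trans (norm_le_vnorm _)) ?_)
    rw [norm_smul, norm_mul, Real.norm_eq_abs, Real.norm_eq_abs, abs_of_pos hh]
    gcongr
  have m22 : ‖qd f2 (qd f2 g) y‖ ≤ vnorm (qd f2 (qd f2 u) y) := by
    rw [d22]; exact (nn _).trans (norm_le_vnorm _)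
  have sq : ∀ {x y z : ℝ}, 0 ≤ x → x ≤ y + z → x ^ 2 ≤ 2 * y ^ 2 + 2 * z ^ 2 := by
    intro x y z hx h
    nlinarith [sq_nonneg (y - z)]
  have k11 := (vnorm_sq_le (qd f1 (qd f1 g) y)).trans
    (mul_le_mul_of_nonneg_left (sq (norm_nonneg _) m11) (by norm_num))
  have k21 := (vnorm_sq_le (qd f2 (qd f1 g) y)).trans
    (mul_le_mul_of_nonneg_left (sq (norm_nonneg _) m21) (by norm_num))
  have k22 := (vnorm_sq_le (qd f2 (qd f2 g) y)).trans
    (mul_le_mul_of_nonneg_left (pow_le_pow_left₀ (norm_nonneg _) m22 2) (by norm_num))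
  have hHess : hess2 h g y ≤ 6 * hess2 h u y + 36 * (K / ε * R) ^ 2 := by
    have k21' := mul_le_mul_of_nonneg_left k21 (by positivity : 0 ≤ 2 * (h⁻¹) ^ 2)
    have k22' := mul_le_mul_of_nonneg_left k22 (by positivity : 0 ≤ (h⁻¹) ^ 4)
    have e1 : 2 * (h⁻¹) ^ 2 * (3 * (2 * vnorm (qd f2 (qd f1 u) y) ^ 2 +
        2 * (h * (K / ε) * R) ^ 2)) = 6 * (2 * (h⁻¹) ^ 2 * vnorm (qd f2 (qd f1 u) y) ^ 2) +
        12 * (K / ε * R) ^ 2 := by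
      field_simp; ring
    have e2 : 0 ≤ (h⁻¹) ^ 4 * vnorm (qd f2 (qd f2 u) y) ^ 2 := by positivity
    rw [e1] at k21'
    unfold hess2
    have e3 : (2 * K / ε * R) ^ 2 = 4 * (K / ε * R) ^ 2 := by ring
    rw [e3] at k11
    generalize (K / ε * R) ^ 2 = X at *
    generalize vnorm (qd f1 (qd f1 g) y) ^ 2 = a1 at *
    generalize vnorm (qd f1 (qd f1 u) y) ^ 2 = a2 at *
    have e4 : (h⁻¹) ^ 4 * (3 * vnorm (qd f2 (qd f2 u) y) ^ 2) =
      3 * ((h⁻¹) ^ 4 * vnorm (qd f2 (qd f2 u) y) ^ 2) := by ring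
    rw [e4] at k22'
    linarith
  have hWu : 0 ≤ ε⁻¹ * W ![qd f1 u y, 0, h⁻¹ • qd f2 u y] := mul_nonneg (by positivity) (hW0 _)
  unfold dens2
  have hRp : 0 ≤ R ^ p := Real.rpow_nonneg hR0 p
  calc _ ≤ ε⁻¹ * (C * R ^ p) + ε * (6 * hess2 h u y + 36 * (K / ε * R) ^ 2) := by gcongr
    _ = ε⁻¹ * (C * R ^ p + 36 * K ^ 2 * R ^ 2) + 6 * (ε * hess2 h u y) := by
        field_simp
        ring
    _ ≤ ε⁻¹ * ((C + 36 * K ^ 2) * (R ^ p + R ^ 2)) + 6 * (ε * hess2 h u y) := by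
      gcongr
      nlinarith [mul_nonneg hC (sq_nonneg R), mul_nonneg (sq_nonneg K) hRp]
    _ ≤ _ := by linarith

end Interp

/-! ### Finiteness of the cell constant -/

theorem exists_rescaled_step : ∃ K : ℝ, 1 ≤ K ∧ ∀ ε > 0, ∀ m k : ℝ, |m| ≤ 1 / ε →
    ContDiff ℝ 2 (fun s => Real.smoothTransition (m * s + k)) ∧
    ∀ t, |Real.smoothTransition (m * t + k)| ≤ 1 ∧
      |deriv (fun s => Real.smoothTransition (m * s + k)) t| ≤ K / ε ∧
      |deriv (deriv (fun s => Real.smoothTransition (m * s + k))) t| ≤ K / ε ^ 2 := by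
  obtain ⟨K, hK, hb⟩ := exists_step_bound
  refine ⟨K, hK, fun ε hε m k hm => ?_⟩
  have hs : ContDiff ℝ 2 Real.smoothTransition := Real.smoothTransition.contDiff
  have hd1 : ContDiff ℝ 1 (deriv Real.smoothTransition) := hs.deriv'
  have hl : ∀ t, HasDerivAt (fun s : ℝ => m * s + k) m t := fun t => by
    simpa using ((hasDerivAt_id t).const_mul m).add_const k
  have e1 : deriv (fun s => Real.smoothTransition (m * s + k)) =
      fun s => deriv Real.smoothTransition (m * s + k) * m := funext fun t =>
    (HasDerivAt.comp t (h₂ := Real.smoothTransition)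
      (hs.differentiable (by norm_num) (m * t + k)).hasDerivAt (hl t)).deriv
  have e2 : ∀ t, deriv (fun s => deriv Real.smoothTransition (m * s + k) * m) t =
      deriv (deriv Real.smoothTransition) (m * t + k) * m * m := fun t =>
    ((HasDerivAt.comp t (h₂ := deriv Real.smoothTransition)
      (hd1.differentiable (by norm_num) (m * t + k)).hasDerivAt (hl t)).mul_const m).deriv
  refine ⟨hs.comp (by fun_prop), fun t => ⟨(hb _).1, ?_, ?_⟩⟩
  · rw [e1, abs_mul, div_eq_mul_one_div]
    exact mul_le_mul (hb _).2.1 hm (abs_nonneg _) (by linarith)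
  · rw [e1, e2, abs_mul, abs_mul, show K / ε ^ 2 = K * (1 / ε) * (1 / ε) by field_simp]
    have := (hb (m * t + k)).2.2
    gcongr

theorem dens2_aff {W : M33 → ℝ} {σ : ℝ} {a A3 : V3} (hW : W ![σ • a, 0, σ • A3] = 0) {h : ℝ}
    (hh : 0 < h) (ε : ℝ) (c : V3) (y : Pt2) : dens2 W h ε (aff σ a A3 h c) y = 0 := by
  have q1 : qd f1 (aff σ a A3 h c) y = σ • a := by rw [qd_aff]; simp [f1]
  have q2 : h⁻¹ • qd f2 (aff σ a A3 h c) y = σ • A3 := by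
    rw [qd_aff]; simp [f2, smul_smul]; congr 1; field_simp
  simp [dens2, hess2, qd_qd_aff, q1, q2, hW, vnorm]

theorem setLIntegral_slab_le {f : Pt2 → ℝ≥0∞} {S : Set ℝ} (hS : MeasurableSet S) {c : ℝ≥0∞}
    (hf : ∀ y ∈ Box, f y ≤ (S ×ˢ II).indicator (fun _ => c) y) :
    ∫⁻ y in Box, f y ≤ c * volume S := by
  calc ∫⁻ y in Box, f y ≤ ∫⁻ y in Box, (S ×ˢ II).indicator (fun _ => c) y :=
        setLIntegral_mono' measurableSet_Box hf
    _ ≤ ∫⁻ y, (S ×ˢ II).indicator (fun _ => c) y := setLIntegral_le_lintegral _ _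
    _ = c * volume (S ×ˢ II) := lintegral_indicator_const (hS.prod measurableSet_II) c
    _ = c * volume S := by
        rw [Measure.volume_eq_prod, Measure.prod_prod, volume_II, mul_one]

/-- An explicit transition profile with bounded energy. -/
theorem exists_transition_profile {W : M33 → ℝ} (hW0 : ∀ ξ, 0 ≤ W ξ) {p C : ℝ} (hp : 2 ≤ p)
    (hC : 0 ≤ C) {a A3 : V3} (hA : W ![a, 0, A3] = 0) (hA' : W ![-a, 0, -A3] = 0)
    (hWC : ∀ ξ, W ξ ≤ C * ‖ξ - ![a, 0, A3]‖ ^ p) {γ : ℝ} (hγ : 0 < γ) :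
    ∃ M : ℝ, 0 ≤ M ∧ ∀ ε > 0, ∃ v : Pt2 → V3, ContDiffOn ℝ 2 v Box ∧
      E2 W (γ * ε) ε v ≤ ENNReal.ofReal M ∧
      (∀ y ∈ Box, ‖v y - |y.1| • a‖ ≤ M * ε) ∧
      ∫⁻ y in Box, ‖(γ * ε)⁻¹ • qd f2 v y - sg y.1 • A3‖ₑ ≤ ENNReal.ofReal (M * ε) := by
  obtain ⟨K, hK, hstep⟩ := exists_rescaled_step
  set R0 : ℝ := 2 * ‖a‖ + 2 * ‖A3‖ + K * (2 * ‖a‖ + 2 * γ * ‖A3‖) with hR0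
  have hR0' : 0 ≤ R0 := by positivity
  set M1 : ℝ := (C + 36 * K ^ 2) * (R0 ^ p + R0 ^ 2) with hM1
  have hM1' : 0 ≤ M1 := by positivity
  refine ⟨2 * M1 + 4 * ‖a‖ + 8 * ‖A3‖ + 3 * γ * ‖A3‖, by positivity, fun ε hε => ?_⟩
  set h := γ * ε with hh
  have hh0 : 0 < h := by positivity
  set m : ℝ := -(1 / (2 * ε)) with hm
  have hmabs : |m| ≤ 1 / ε := by
    rw [hm, abs_neg, abs_of_pos (by positivity)]
    exact one_div_le_one_div_of_le hε (by linarith)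
  obtain ⟨hψ, hψb⟩ := hstep ε hε m (1 / 2) hmabs
  set ψ : ℝ → ℝ := fun s => Real.smoothTransition (m * s + 1 / 2) with hψdef
  have ψ0 : ∀ s, ε ≤ s → ψ s = 0 := fun s hs => by
    refine Real.smoothTransition.zero_of_nonpos ?_
    have : m * s + 1 / 2 = (ε - s) / (2 * ε) := by rw [hm]; field_simp; ring
    rw [this]; exact div_nonpos_of_nonpos_of_nonneg (by linarith) (by positivity)
  have ψ1 : ∀ s, s ≤ -ε → ψ s = 1 := fun s hs => by
    refine Real.smoothTransition.one_of_one_le ?_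
    have : m * s + 1 / 2 = (ε - s) / (2 * ε) := by rw [hm]; field_simp; ring
    rw [this, le_div_iff₀ (by positivity)]; linarith
  have hvol : volume (Icc (-ε) ε) = ENNReal.ofReal (2 * ε) := by
    rw [Real.volume_Icc]; congr 1; ring
  set l := aff 1 a A3 h 0 with hl
  set u := aff (-1) a A3 h 0 with hu
  set v := interp ψ l u with hv
  have hl' : ContDiff ℝ 2 l := contDiff_aff ..
  have hu' : ContDiff ℝ 2 u := contDiff_aff ..
  have hoff : ∀ y : Pt2, y.1 ∉ Icc (-ε) ε → v =ᶠ[𝓝 y] l ∨ v =ᶠ[𝓝 y] u := by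
    intro y hy
    rw [mem_Icc, not_and_or, not_le, not_le] at hy
    rcases hy with hy | hy
    · right
      filter_upwards [continuous_fst.continuousAt.eventually (gt_mem_nhds hy)] with z hz
      simp only [hv, interp, ψ1 z.1 hz.le, one_smul]; abel
    · left
      filter_upwards [continuous_fst.continuousAt.eventually (lt_mem_nhds hy)] with z hz
      simp [hv, interp, ψ0 z.1 hz.le]
  have hform : ∀ y : Pt2, v y = (1 - 2 * ψ y.1) • (y.1 • a + (h * y.2) • A3) := by
    intro y
    simp only [hv, interp, hl, hu, aff]
    module
  have hq2 : ∀ y, h⁻¹ • qd f2 v y = (1 - 2 * ψ y.1) • A3 := by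
    intro y
    rw [hv, hl, qd_interp hψ isOpen_univ hu'.contDiffOn (mem_univ y), hu, qd_aff, qd_aff]
    simp only [f2, zero_mul, mul_zero, zero_smul, add_zero, zero_add, mul_one, one_mul]
    rw [smul_add, ← sub_smul, smul_smul, smul_smul, smul_smul, ← add_smul]
    congr 1
    field_simp
    ring
  have habs2 : ∀ y : Pt2, |1 - 2 * ψ y.1| ≤ 3 := fun y => by
    have := abs_le.1 (hψb y.1).1
    rw [abs_le]; constructor <;> linarith
  refine ⟨v, contDiffOn_interp hψ hl' hu'.contDiffOn, ?_, ?_, ?_⟩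
  · refine (setLIntegral_slab_le (S := Icc (-ε) ε) (c := ENNReal.ofReal (ε⁻¹ * M1))
      measurableSet_Icc fun y hy => ?_).trans ?_
    · by_cases hs : y.1 ∈ Icc (-ε) ε
      · rw [indicator_of_mem (show y ∈ Icc (-ε) ε ×ˢ II from ⟨hs, hy.2⟩)]
        refine ENNReal.ofReal_le_ofReal ?_
        have := (interp_bound (σ := 1) (a := a) (A3 := A3) (c := 0) hW0 hp hC (by simpa using hWC)
          hK hε hh0 hψ isOpen_univ hu'.contDiffOn (mem_univ y) (hψb y.1).1 (hψb y.1).2.1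
          (hψb y.1).2.2).2
        refine this.trans ?_
        rw [hu, dens2_aff (by simpa using hA') hh0, mul_zero, add_zero]
        have q1 : qd f1 (aff (-1) a A3 h 0) y = -a := by rw [qd_aff]; simp [f1]
        have q2 : h⁻¹ • qd f2 (aff (-1) a A3 h 0) y = -A3 := by
          rw [qd_aff]; simp [f2, smul_smul, hh0.ne']
        rw [q1, q2]
        have e1 : ‖-a - (1 : ℝ) • a‖ = 2 * ‖a‖ := by
          rw [show -a - (1 : ℝ) • a = (-2 : ℝ) • a by module, norm_smul]; norm_num
        have e2 : ‖-A3 - (1 : ℝ) • A3‖ = 2 * ‖A3‖ := by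
          rw [show -A3 - (1 : ℝ) • A3 = (-2 : ℝ) • A3 by module, norm_smul]; norm_num
        have e3 : ‖aff (-1) a A3 h 0 y - aff 1 a A3 h 0 y‖ ≤ ε * (2 * ‖a‖ + 2 * γ * ‖A3‖) := by
          have : aff (-1) a A3 h 0 y - aff 1 a A3 h 0 y =
              (-2 * y.1) • a + (-2 * h * y.2) • A3 := by unfold aff; module
          rw [this]
          refine (norm_add_le _ _).trans ?_
          rw [norm_smul, norm_smul, norm_mul, norm_mul, norm_mul]
          simp only [Real.norm_eq_abs, abs_neg, abs_two, abs_of_pos hh0]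
          have y1 : |y.1| ≤ ε := abs_le.2 hs
          have y2 : |y.2| ≤ 1 := abs_le.2 ⟨by linarith [hy.2.1], by linarith [hy.2.2]⟩
          calc 2 * |y.1| * ‖a‖ + 2 * h * |y.2| * ‖A3‖ ≤ 2 * ε * ‖a‖ + 2 * h * 1 * ‖A3‖ := by gcongr
            _ = _ := by rw [hh]; ring
        rw [e1, e2]
        have e4 : 2 * ‖a‖ + 2 * ‖A3‖ + K / ε * ‖aff (-1) a A3 h 0 y - aff 1 a A3 h 0 y‖ ≤ R0 := by
          rw [hR0]
          refine add_le_add le_rfl ?_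
          rw [div_mul_eq_mul_div, div_le_iff₀ hε]
          calc _ ≤ K * (ε * (2 * ‖a‖ + 2 * γ * ‖A3‖)) := by gcongr
            _ = _ := by ring
        rw [hM1]
        gcongr
      · have : dens2 W h ε v y = 0 := by
          rcases hoff y hs with he | he
          · rw [dens2_congr he, hl, dens2_aff (by simpa using hA) hh0]
          · rw [dens2_congr he, hu, dens2_aff (by simpa using hA') hh0]
        rw [this]; simp
    · rw [hvol, ← ENNReal.ofReal_mul (by positivity)]
      refine ENNReal.ofReal_le_ofReal ?_
      have : ε⁻¹ * M1 * (2 * ε) = 2 * M1 := by field_simp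
      rw [this]
      have : 0 ≤ 4 * ‖a‖ + 8 * ‖A3‖ + 3 * γ * ‖A3‖ := by positivity
      linarith
  · intro y hy
    have y2 : |y.2| ≤ 1 := abs_le.2 ⟨by linarith [hy.2.1], by linarith [hy.2.2]⟩
    have e1 : |(1 - 2 * ψ y.1) * y.1 - (|y.1|)| ≤ 4 * ε := by
      rcases le_or_gt ε y.1 with h1 | h1
      · rw [ψ0 _ h1, abs_of_nonneg (by linarith : 0 ≤ y.1)]; simp; linarith
      rcases le_or_gt y.1 (-ε) with h2 | h2
      · rw [ψ1 _ h2, abs_of_nonpos (by linarith : y.1 ≤ 0)]; norm_num; linarith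
      · have h3 : |y.1| ≤ ε := abs_le.2 ⟨h2.le, h1.le⟩
        calc _ ≤ |(1 - 2 * ψ y.1) * y.1| + |(|y.1|)| := abs_sub _ _
          _ ≤ 3 * ε + ε := by
            rw [abs_mul, abs_abs]
            have := habs2 y
            gcongr
          _ = _ := by ring
    rw [hform, show (1 - 2 * ψ y.1) • (y.1 • a + (h * y.2) • A3) - |y.1| • a =
      ((1 - 2 * ψ y.1) * y.1 - |y.1|) • a + ((1 - 2 * ψ y.1) * (h * y.2)) • A3 by module]
    refine (norm_add_le _ _).trans ?_
    rw [norm_smul, norm_smul, Real.norm_eq_abs, Real.norm_eq_abs, abs_mul, abs_mul,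
      abs_of_pos hh0]
    calc _ ≤ 4 * ε * ‖a‖ + 3 * (h * 1) * ‖A3‖ := by
          have := habs2 y
          gcongr
      _ = (4 * ‖a‖ + 3 * γ * ‖A3‖) * ε := by rw [hh]; ring
      _ ≤ _ := by
          refine mul_le_mul_of_nonneg_right ?_ hε.le
          linarith [norm_nonneg A3]
  · refine (setLIntegral_slab_le (S := Icc (-ε) ε) (c := ENNReal.ofReal (4 * ‖A3‖))
      measurableSet_Icc fun y hy => ?_).trans ?_
    · rw [hq2, ← sub_smul, ← ofReal_norm, norm_smul]
      by_cases hs : y.1 ∈ Icc (-ε) ε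
      · rw [indicator_of_mem (show y ∈ Icc (-ε) ε ×ˢ II from ⟨hs, hy.2⟩)]
        refine ENNReal.ofReal_le_ofReal (mul_le_mul_of_nonneg_right ?_ (norm_nonneg _))
        have := abs_le.1 (habs2 y)
        rw [Real.norm_eq_abs, abs_le]
        unfold sg
        split_ifs <;> constructor <;> linarith
      · have : 1 - 2 * ψ y.1 - sg y.1 = 0 := by
          rw [mem_Icc, not_and_or, not_le, not_le] at hs
          unfold sg
          rcases hs with hs | hs
          · rw [ψ1 _ hs.le, if_neg (by linarith)]; norm_num
          · rw [ψ0 _ hs.le, if_pos (by linarith)]; norm_num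
        rw [this]; simp
    · rw [hvol, ← ENNReal.ofReal_mul (by positivity)]
      refine ENNReal.ofReal_le_ofReal ?_
      have : 4 * ‖A3‖ * (2 * ε) = (8 * ‖A3‖) * ε := by ring
      rw [this]
      refine mul_le_mul_of_nonneg_right ?_ hε.le
      have : 0 ≤ 3 * γ * ‖A3‖ := by positivity
      linarith [norm_nonneg a]

theorem Kstar_le_liminf {W : M33 → ℝ} {a A3 : V3} {γ : ℝ} {h ε : ℕ → ℝ} {u : ℕ → Pt → V3}
    (hh : ∀ n, 0 < h n) (hε : ∀ n, 0 < ε n) (hh0 : Tendsto h atTop (𝓝 0))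
    (hε0 : Tendsto ε atTop (𝓝 0)) (hr : Tendsto (fun n => h n / ε n) atTop (𝓝 γ))
    (hu : ∀ n, ContDiffOn ℝ 2 (u n) Q3) (h1 : TendsL1 Q3 u (u0 a))
    (h2 : TendsL1 Q3 (fun n x => (h n)⁻¹ • pd e3 (u n) x) (b0 A3)) :
    Kstar W a A3 γ ≤ liminf (fun n => F W (h n) (ε n) (u n) Q3) atTop := by
  unfold Kstar Egam
  refine sInf_le ?_
  exact ⟨h, ε, u, hh, hε, hh0, hε0, hr, hu, h1, h2, rfl⟩

theorem Kstar_ne_top {W : M33 → ℝ} (hWc : Continuous W) (hW0 : ∀ ξ, 0 ≤ W ξ) {p C : ℝ}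
    (hp : 2 ≤ p) (hC : 0 ≤ C) {a A3 : V3} (hA : W ![a, 0, A3] = 0) (hA' : W ![-a, 0, -A3] = 0)
    (hWC : ∀ ξ, W ξ ≤ C * ‖ξ - ![a, 0, A3]‖ ^ p) {γ : ℝ} (hγ : 0 < γ) :
    Kstar W a A3 γ ≠ ⊤ := by
  obtain ⟨M, hM, hv⟩ := exists_transition_profile hW0 hp hC hA hA' hWC hγ
  set ε : ℕ → ℝ := fun n => 1 / ((n : ℝ) + 1) with hε
  have hε0 : ∀ n, 0 < ε n := fun n => by positivity
  have hεt : Tendsto ε atTop (𝓝 0) := tendsto_one_div_add_atTop_nhds_zero_nat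
  choose v hvc hvE hv1 hv2 using fun n => hv (ε n) (hε0 n)
  have hlim : Tendsto (fun n => ENNReal.ofReal (2 * (M * ε n))) atTop (𝓝 0) := by
    have : Tendsto (fun n => 2 * (M * ε n)) atTop (𝓝 (2 * (M * 0))) :=
      (hεt.const_mul M).const_mul 2
    simpa using ENNReal.tendsto_ofReal this
  have hvn : ∀ z : V3, ENNReal.ofReal (vnorm z) ≤ ENNReal.ofReal 2 * ‖z‖ₑ := fun z => by
    rw [← ofReal_norm, ← ENNReal.ofReal_mul (by norm_num)]
    exact ENNReal.ofReal_le_ofReal (vnorm_le z)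
  have hle : Kstar W a A3 γ ≤ ENNReal.ofReal M := by
    refine (Kstar_le_liminf (h := fun n => γ * ε n) (ε := ε)
      (u := fun n x => v n (x.1, x.2.2)) (fun n => mul_pos hγ (hε0 n))
      hε0 (by simpa using hεt.const_mul γ) hεt ?_ ?_ ?_ ?_).trans ?_
    · have : (fun n => γ * ε n / ε n) = fun _ => γ := funext fun n => by
        field_simp [(hε0 n).ne']
      rw [this]; exact tendsto_const_nhds
    · intro n
      exact (hvc n).comp (ContDiff.contDiffOn (by fun_prop)) fun x hx => ⟨hx.1, hx.2.2⟩
    · refine tendsto_of_tendsto_of_tendsto_of_le_of_le tendsto_const_nhds hlim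
        (fun _ => zero_le) fun n => ?_
      calc _ ≤ ∫⁻ x in Q3, ENNReal.ofReal (2 * (M * ε n)) := by
            refine setLIntegral_mono' isOpen_Q3.measurableSet fun x hx => ?_
            refine ENNReal.ofReal_le_ofReal ((vnorm_le _).trans ?_)
            exact mul_le_mul_of_nonneg_left (hv1 n (x.1, x.2.2) ⟨hx.1, hx.2.2⟩) (by norm_num)
        _ = _ := by
            rw [setLIntegral_const]
            have : volume Q3 = 1 := by
              rw [Q3, Measure.volume_eq_prod, Measure.prod_prod, Measure.volume_eq_prod,
                Measure.prod_prod, volume_II]; simp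
            rw [this, mul_one]
    · refine tendsto_of_tendsto_of_tendsto_of_le_of_le tendsto_const_nhds hlim
        (fun _ => zero_le) fun n => ?_
      set f : Pt2 → ℝ≥0∞ := fun y =>
        ENNReal.ofReal 2 * ‖(γ * ε n)⁻¹ • qd f2 (v n) y - sg y.1 • A3‖ₑ with hf
      have hfm : Measurable f := by
        refine (measurable_enorm_vec (measurable_sub_vec (measurable_vec_const_smul _
          (measurable_qd _ _)) (measurable_smul_vec (measurable_sg.comp measurable_fst) _))).const_mul _
      calc _ ≤ ∫⁻ x in Q3, f (x.1, x.2.2) := by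
            refine setLIntegral_mono' isOpen_Q3.measurableSet fun x hx => ?_
            dsimp only
            rw [pd_forget (hvc n) ⟨hx.1, hx.2.2⟩, forgetD_e3, b0, bb0_eq]
            exact hvn _
        _ = ∫⁻ y in Box, f y := lintegral_Q3_forget hfm.aemeasurable
        _ ≤ _ := by
            rw [hf, lintegral_const_mul' _ _ ENNReal.ofReal_ne_top,
              ENNReal.ofReal_mul (by norm_num)]
            exact mul_le_mul_right (hv2 n) _
    · refine liminf_le_of_le (by isBoundedDefault) fun b hb => ?_
      obtain ⟨n, hn⟩ := hb.exists
      refine hn.trans ?_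
      rw [F_forget hWc (hvc n)]
      exact hvE n
  exact ne_top_of_le_ne_top ENNReal.ofReal_ne_top hle

/-! ### Slabs of small energy and the Poincaré inequality on a slab -/

theorem lintegral_Icc_add {F : ℝ → ℝ≥0∞} (hF : Measurable F) (t ε : ℝ) :
    ∫⁻ r in Icc 0 ε, F (t + r) = ∫⁻ s in Icc t (t + ε), F s := by
  have h := (measurePreserving_add_left volume t).setLIntegral_comp_preimage
    (measurableSet_Icc (a := t) (b := t + ε)) hF
  rw [← h, preimage_const_add_Icc]
  simp

/-- Among the windows of length `ε` in an interval of length `1 / 8`, one carries at most a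
fraction `16 ε` of the mass. -/
theorem exists_window_le {F : ℝ → ℝ≥0∞} (hF : Measurable F) (α : ℝ) {ε : ℝ} (hε : 0 < ε)
    (hε' : ε ≤ 1 / 32) :
    ∃ t, α < t ∧ t + ε < α + 1 / 8 ∧
      ∫⁻ s in Icc t (t + ε), F s ≤ ENNReal.ofReal (16 * ε) * ∫⁻ s in Ioo α (α + 1 / 8), F s := by
  set J := Ioo α (α + 1 / 16) with hJ
  have hvol : volume J = ENNReal.ofReal (1 / 16) := by rw [hJ, Real.volume_Ioo]; congr 1; ring
  have hmeas : Measurable fun z : ℝ × ℝ => F (z.1 + z.2) := hF.comp (by fun_prop)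
  have hgm : Measurable fun t => ∫⁻ r in Icc 0 ε, F (t + r) := hmeas.lintegral_prod_right'
  obtain ⟨t, ht, hle⟩ := exists_le_setLAverage (μ := volume) (s := J) (by rw [hvol]; simp)
    (by rw [hvol]; simp) hgm.aemeasurable
  refine ⟨t, ht.1, by linarith [ht.2], ?_⟩
  rw [← lintegral_Icc_add hF]
  refine hle.trans ?_
  rw [setLAverage_eq, hvol, lintegral_lintegral_swap hmeas.aemeasurable]
  have h1 : ∀ r ∈ Icc 0 ε, ∫⁻ x in J, F (x + r) ≤ ∫⁻ s in Ioo α (α + 1 / 8), F s := by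
    intro r hr
    have h := (measurePreserving_add_right volume r).setLIntegral_comp_preimage
      (measurableSet_Ioo (a := α) (b := α + 1 / 8)) hF
    rw [← h]
    refine lintegral_mono_set fun x hx => ?_
    have h1 := hx.1
    have h2 := hx.2
    exact ⟨by linarith [hr.1], by linarith [hr.2]⟩
  have h2 : ∫⁻ r in Icc 0 ε, ∫⁻ x in J, F (x + r) ≤
      (∫⁻ s in Ioo α (α + 1 / 8), F s) * ENNReal.ofReal ε := by
    refine (setLIntegral_mono' measurableSet_Icc h1).trans ?_
    rw [setLIntegral_const, Real.volume_Icc, sub_zero]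
  calc _ ≤ (∫⁻ s in Ioo α (α + 1 / 8), F s) * ENNReal.ofReal ε / ENNReal.ofReal (1 / 16) := by
        gcongr
    _ = _ := by
        rw [div_eq_mul_inv, ← ENNReal.ofReal_inv_of_pos (by norm_num), mul_assoc,
          ← ENNReal.ofReal_mul hε.le, mul_comm]
        congr 2
        norm_num [mul_comm]

theorem enorm_sub_le_setLIntegral {f : ℝ → V3} {U S : Set ℝ} (hf : ContDiffOn ℝ 1 f U)
    (hS : S ⊆ U) (hSc : S.OrdConnected) {s s' : ℝ} (hs : s ∈ S) (hs' : s' ∈ S) :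
    ‖f s - f s'‖ₑ ≤ ∫⁻ r in S, ‖deriv f r‖ₑ := by
  wlog h : s' ≤ s generalizing s s'
  · rw [← enorm_neg, neg_sub]
    exact this hs' hs (le_of_not_ge h)
  have hsub : Icc s' s ⊆ S := hSc.out hs' hs
  exact (enorm_sub_le_lintegral_deriv_of_contDiffOn_Icc (hf.mono (hsub.trans hS)) h).trans
    (lintegral_mono_set hsub)

theorem deriv_horizontal {w : Pt2 → V3} {s r : ℝ} (hw : DifferentiableAt ℝ w (s, r)) :
    deriv (fun s => w (s, r)) s = qd f1 w (s, r) := by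
  have h : HasDerivAt (fun s : ℝ => ((s, r) : Pt2)) (1, 0) s :=
    (hasDerivAt_id s).prodMk (hasDerivAt_const s r)
  exact (HasFDerivAt.comp_hasDerivAt s hw.hasFDerivAt h).deriv

theorem deriv_vertical {w : Pt2 → V3} {s r : ℝ} (hw : DifferentiableAt ℝ w (s, r)) :
    deriv (fun r => w (s, r)) r = qd f2 w (s, r) := by
  have h : HasDerivAt (fun r : ℝ => ((s, r) : Pt2)) (0, 1) r :=
    (hasDerivAt_const r s).prodMk (hasDerivAt_id r)
  exact (HasFDerivAt.comp_hasDerivAt r hw.hasFDerivAt h).deriv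

theorem enorm_horizontal_le {w : Pt2 → V3} (hw : ContDiffOn ℝ 2 w Box) {S : Set ℝ} (hS : S ⊆ II)
    (hSm : MeasurableSet S) (hSc : S.OrdConnected) {s s' r : ℝ} (hs : s ∈ S) (hs' : s' ∈ S)
    (hr : r ∈ II) : ‖w (s, r) - w (s', r)‖ₑ ≤ ∫⁻ x in S, ‖qd f1 w (x, r)‖ₑ := by
  have h1 : ContDiffOn ℝ 1 (fun s => w (s, r)) II :=
    (hw.of_le (by norm_num)).comp (ContDiff.contDiffOn (by fun_prop)) fun x hx => ⟨hx, hr⟩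
  refine (enorm_sub_le_setLIntegral h1 hS hSc hs hs').trans_eq ?_
  refine setLIntegral_congr_fun hSm fun x hx => ?_
  rw [deriv_horizontal ((hw.differentiableOn (by norm_num)).differentiableAt
    (isOpen_Box.mem_nhds ⟨hS hx, hr⟩))]

theorem enorm_vertical_le {w : Pt2 → V3} (hw : ContDiffOn ℝ 2 w Box) {s r r' : ℝ} (hs : s ∈ II)
    (hr : r ∈ II) (hr' : r' ∈ II) : ‖w (s, r) - w (s, r')‖ₑ ≤ ∫⁻ x in II, ‖qd f2 w (s, x)‖ₑ := by
  have h1 : ContDiffOn ℝ 1 (fun r => w (s, r)) II :=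
    (hw.of_le (by norm_num)).comp (ContDiff.contDiffOn (by fun_prop)) fun x hx => ⟨hs, hx⟩
  refine (enorm_sub_le_setLIntegral h1 subset_rfl ordConnected_Ioo hr hr').trans_eq ?_
  refine setLIntegral_congr_fun measurableSet_II fun x hx => ?_
  rw [deriv_vertical ((hw.differentiableOn (by norm_num)).differentiableAt
    (isOpen_Box.mem_nhds ⟨hs, hx⟩))]

/-- Distance of the rescaled planar gradient to a single phase. -/
noncomputable def phaseGap (σ : ℝ) (a A3 : V3) (h : ℝ) (v : Pt2 → V3) (y : Pt2) : ℝ≥0∞ :=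
  ‖qd f1 v y - σ • a‖ₑ + ‖h⁻¹ • qd f2 v y - σ • A3‖ₑ

theorem measurable_phaseGap (σ : ℝ) (a A3 : V3) (h : ℝ) (v : Pt2 → V3) :
    Measurable (phaseGap σ a A3 h v) :=
  (measurable_enorm_vec (measurable_sub_vec (measurable_qd f1 v) measurable_const)).add
    (measurable_enorm_vec (measurable_sub_vec (measurable_vec_const_smul _ (measurable_qd f2 v))
      measurable_const))

theorem lintegral_prod_II {S : Set ℝ} {f : Pt2 → ℝ≥0∞} (hf : Measurable f) :
    ∫⁻ y in S ×ˢ II, f y = ∫⁻ s in S, ∫⁻ r in II, f (s, r) := by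
  rw [Measure.volume_eq_prod, ← Measure.prod_restrict, lintegral_prod _ hf.aemeasurable]

theorem lintegral_prod_II_symm {S : Set ℝ} {f : Pt2 → ℝ≥0∞} (hf : Measurable f) :
    ∫⁻ y in S ×ˢ II, f y = ∫⁻ r in II, ∫⁻ s in S, f (s, r) := by
  rw [Measure.volume_eq_prod, ← Measure.prod_restrict, lintegral_prod_symm _ hf.aemeasurable]

/-- Poincaré inequality on the slab `[t, t + ε] × I`, in gauge form. -/
theorem exists_slab_poincare {p : ℝ} (hp : 2 ≤ p) {σ γ ε t : ℝ} {a A3 : V3} (hγ : 0 < γ)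
    (hε : 0 < ε) (ht : Icc t (t + ε) ⊆ II) {v : Pt2 → V3} (hv : ContDiffOn ℝ 2 v Box) :
    ∃ c : V3, ∫⁻ y in Icc t (t + ε) ×ˢ II,
        Phi p (ENNReal.ofReal ε⁻¹ * ‖v y - aff σ a A3 (γ * ε) c y‖ₑ) ≤
      2 ^ p * (1 + Phi p (ENNReal.ofReal γ)) *
        ∫⁻ y in Icc t (t + ε) ×ˢ II, Phi p (phaseGap σ a A3 (γ * ε) v y) := by
  set S := Icc t (t + ε) with hS
  set h := γ * ε with hh
  have hh0 : 0 < h := by positivity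
  set G := phaseGap σ a A3 h v with hG
  have hGm : Measurable G := measurable_phaseGap ..
  have hPGm : Measurable fun y => Phi p (G y) := (measurable_Phi p).comp hGm
  have hvol : volume S = ENNReal.ofReal ε := by rw [hS, Real.volume_Icc]; congr 1; ring
  set w : Pt2 → V3 := fun y => v y - aff σ a A3 h 0 y with hw
  have hwc : ContDiffOn ℝ 2 w Box := hv.sub (contDiff_aff ..).contDiffOn
  have hqw : ∀ e, ∀ y ∈ Box, qd e w y = qd e v y - qd e (aff σ a A3 h 0) y := fun e y hy => by
    have h1 : DifferentiableAt ℝ v y :=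
      (hv.differentiableOn (by norm_num)).differentiableAt (isOpen_Box.mem_nhds hy)
    have h2 : DifferentiableAt ℝ (aff σ a A3 h 0) y :=
      (contDiff_aff σ a A3 h 0).differentiable (by norm_num) y
    rw [hw]; unfold qd; rw [fderiv_fun_sub h1 h2]; rfl
  have hw1 : ∀ y ∈ Box, ‖qd f1 w y‖ₑ ≤ G y := fun y hy => by
    have q1 : qd f1 (aff σ a A3 h 0) y = σ • a := by rw [qd_aff]; simp [f1]
    rw [hqw _ y hy, q1]
    exact le_self_add
  have hw2 : ∀ y ∈ Box, ‖qd f2 w y‖ₑ ≤ ENNReal.ofReal h * G y := fun y hy => by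
    have q2 : qd f2 (aff σ a A3 h 0) y = h • (σ • A3) := by
      rw [qd_aff]; simp [f2, smul_smul, mul_comm]
    have e : qd f2 v y - h • (σ • A3) = h • (h⁻¹ • qd f2 v y - σ • A3) := by
      rw [smul_sub, smul_smul h h⁻¹, mul_inv_cancel₀ hh0.ne', one_smul]
    rw [hqw _ y hy, q2, e, enorm_smul, Real.enorm_of_nonneg hh0.le]
    exact mul_le_mul_right le_add_self _
  set P := ∫⁻ y in S ×ˢ II, Phi p (G y) with hP
  have hP1 : P = ∫⁻ s in S, ∫⁻ r in II, Phi p (G (s, r)) := lintegral_prod_II hPGm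
  have hP2 : P = ∫⁻ r in II, ∫⁻ s in S, Phi p (G (s, r)) := lintegral_prod_II_symm hPGm
  obtain ⟨s₀, hs₀, hle⟩ := exists_le_setLAverage (μ := volume) (s := S)
    (f := fun s => ∫⁻ r in II, Phi p (G (s, r))) (by rw [hvol]; simpa using hε)
    (by rw [hvol]; simp) hPGm.lintegral_prod_right'.aemeasurable
  rw [setLAverage_eq, hvol, ← hP1, ENNReal.div_eq_inv_mul, ← ENNReal.ofReal_inv_of_pos hε] at hle
  have h0 : (0 : ℝ) ∈ II := by constructor <;> norm_num
  set c := w (s₀, 0) with hc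
  refine ⟨c, ?_⟩
  have hvw : ∀ y, v y - aff σ a A3 h c y = w y - c := fun y => by
    simp only [hw, aff]; abel
  have hpt : ∀ s ∈ S, ∀ r ∈ II, Phi p (ENNReal.ofReal ε⁻¹ * ‖w (s, r) - c‖ₑ) ≤
      2 ^ p * (ENNReal.ofReal ε⁻¹ * (∫⁻ x in S, Phi p (G (x, r))) +
        Phi p (ENNReal.ofReal γ) * (ENNReal.ofReal ε⁻¹ * P)) := by
    intro s hs r hr
    have g1 : ‖w (s, r) - w (s₀, r)‖ₑ ≤ ∫⁻ x in S, G (x, r) :=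
      (enorm_horizontal_le hwc ht measurableSet_Icc ordConnected_Icc hs hs₀ hr).trans
        (setLIntegral_mono' measurableSet_Icc fun x hx => hw1 _ ⟨ht hx, hr⟩)
    have g2 : ‖w (s₀, r) - c‖ₑ ≤ ENNReal.ofReal h * ∫⁻ x in II, G (s₀, x) := by
      refine (enorm_vertical_le hwc (ht hs₀) hr h0).trans ?_
      rw [← lintegral_const_mul' _ _ ENNReal.ofReal_ne_top]
      exact setLIntegral_mono' measurableSet_II fun x hx => hw2 _ ⟨ht hs₀, hx⟩
    have g3 : ENNReal.ofReal ε⁻¹ * ‖w (s, r) - c‖ₑ ≤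
        ENNReal.ofReal ε⁻¹ * (∫⁻ x in S, G (x, r)) +
          ENNReal.ofReal γ * ∫⁻ x in II, G (s₀, x) := by
      have : w (s, r) - c = (w (s, r) - w (s₀, r)) + (w (s₀, r) - c) := by abel
      rw [this]
      refine (mul_le_mul_right ((enorm_add_le _ _).trans (add_le_add g1 g2)) _).trans_eq ?_
      have e : ε⁻¹ * h = γ := by rw [hh]; field_simp
      rw [mul_add, ← mul_assoc (ENNReal.ofReal ε⁻¹) (ENNReal.ofReal h),
        ← ENNReal.ofReal_mul (by positivity), e]
    have j1 : Phi p (ENNReal.ofReal ε⁻¹ * ∫⁻ x in S, G (x, r)) ≤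
        ENNReal.ofReal ε⁻¹ * ∫⁻ x in S, Phi p (G (x, r)) := by
      have : IsProbabilityMeasure (ENNReal.ofReal ε⁻¹ • volume.restrict S) := ⟨by
        rw [Measure.smul_apply, Measure.restrict_apply_univ, hvol, smul_eq_mul,
          ← ENNReal.ofReal_mul (by positivity), inv_mul_cancel₀ hε.ne']; simp⟩
      have j := Phi_lintegral_le (μ := ENNReal.ofReal ε⁻¹ • volume.restrict S) hp
        (f := fun x => G (x, r)) (hGm.comp measurable_prodMk_right).aemeasurable
      rwa [lintegral_smul_measure, lintegral_smul_measure] at j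
    have j2 : Phi p (∫⁻ x in II, G (s₀, x)) ≤ ENNReal.ofReal ε⁻¹ * P :=
      (Phi_lintegral_le hp (hGm.comp measurable_prodMk_left).aemeasurable).trans hle
    refine (Phi_mono hp g3).trans ((Phi_add_le hp _ _).trans (mul_le_mul_right ?_ _))
    exact add_le_add j1 ((Phi_mul_le hp _ _).trans (mul_le_mul_right j2 _))
  have hcancel : ENNReal.ofReal ε * ENNReal.ofReal ε⁻¹ = 1 := by
    rw [← ENNReal.ofReal_mul hε.le, mul_inv_cancel₀ hε.ne', ENNReal.ofReal_one]
  have hBm : Measurable fun y : Pt2 => 2 ^ p * (ENNReal.ofReal ε⁻¹ *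
      (∫⁻ x in S, Phi p (G (x, y.2))) + Phi p (ENNReal.ofReal γ) * (ENNReal.ofReal ε⁻¹ * P)) := by
    have : Measurable fun r => ∫⁻ x in S, Phi p (G (x, r)) := hPGm.lintegral_prod_left'
    exact (((this.comp measurable_snd).const_mul _).add_const _).const_mul _
  calc _ ≤ ∫⁻ y in S ×ˢ II, 2 ^ p * (ENNReal.ofReal ε⁻¹ *
      (∫⁻ x in S, Phi p (G (x, y.2))) + Phi p (ENNReal.ofReal γ) * (ENNReal.ofReal ε⁻¹ * P)) := by
        refine setLIntegral_mono' (measurableSet_Icc.prod measurableSet_II) fun y hy => ?_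
        rw [hvw]
        exact hpt y.1 hy.1 y.2 hy.2
    _ = ENNReal.ofReal ε * (2 ^ p * (ENNReal.ofReal ε⁻¹ * P +
          Phi p (ENNReal.ofReal γ) * (ENNReal.ofReal ε⁻¹ * P))) := by
        rw [lintegral_prod_II hBm]
        dsimp only
        rw [setLIntegral_const, hvol, mul_comm]
        congr 1
        have hm1 : Measurable fun r => ∫⁻ x in S, Phi p (G (x, r)) := hPGm.lintegral_prod_left'
        rw [lintegral_const_mul _ ((hm1.const_mul _).add_const _),
          lintegral_add_right _ measurable_const, lintegral_const_mul _ hm1, ← hP2,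
          setLIntegral_const, volume_II, mul_one]
    _ = (ENNReal.ofReal ε * ENNReal.ofReal ε⁻¹) * (2 ^ p * (1 + Phi p (ENNReal.ofReal γ)) * P) := by
        ring
    _ = _ := by rw [hcancel, one_mul]

/-! ### Gluing a planar profile to an affine map in one phase -/

theorem sg_eq {σ s : ℝ} (hσ : σ = 1 ∨ σ = -1) (h : 0 < σ * s) : sg s = σ := by
  unfold sg
  rcases hσ with rfl | rfl
  · rw [if_pos (by linarith)]
  · rw [if_neg (by linarith)]

theorem gap_eq_phaseGap {σ : ℝ} (hσ : σ = 1 ∨ σ = -1) {y : Pt2} (h : 0 < σ * y.1) (a A3 : V3)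
    (k : ℝ) (v : Pt2 → V3) : gap a A3 k v y = phaseGap σ a A3 k v y := by
  unfold gap phaseGap
  rw [sg_eq hσ h]

theorem phaseGap_aff {σ : ℝ} {a A3 : V3} {h : ℝ} (hh : 0 < h) (c : V3) (y : Pt2) :
    phaseGap σ a A3 h (aff σ a A3 h c) y = 0 := by
  have q1 : qd f1 (aff σ a A3 h c) y = σ • a := by rw [qd_aff]; simp [f1]
  have q2 : h⁻¹ • qd f2 (aff σ a A3 h c) y = σ • A3 := by
    rw [qd_aff]; simp [f2, smul_smul]; congr 1; field_simp
  simp [phaseGap, q1, q2]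

theorem ofReal_rpow_add_sq {p R : ℝ} (hp : 2 ≤ p) (hR : 0 ≤ R) :
    ENNReal.ofReal (R ^ p + R ^ 2) = Phi p (ENNReal.ofReal R) := by
  unfold Phi
  rw [ENNReal.ofReal_add (by positivity) (by positivity),
    ENNReal.ofReal_rpow_of_nonneg hR (by linarith), ENNReal.ofReal_rpow_of_nonneg hR (by norm_num),
    Real.rpow_two]

theorem setLIntegral_le_add_slab {f g k : Pt2 → ℝ≥0∞} {S : Set ℝ} (hS : MeasurableSet S)
    (hg : Measurable g) (hout : ∀ y ∈ Box, y.1 ∉ S → f y ≤ g y)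
    (hin : ∀ y ∈ Box, y.1 ∈ S → f y ≤ g y + k y) :
    ∫⁻ y in Box, f y ≤ (∫⁻ y in Box, g y) + ∫⁻ y in S ×ˢ II, k y := by
  calc ∫⁻ y in Box, f y ≤ ∫⁻ y in Box, g y + (S ×ˢ II).indicator k y := by
        refine setLIntegral_mono' measurableSet_Box fun y hy => ?_
        by_cases h : y.1 ∈ S
        · have hm : y ∈ S ×ˢ II := ⟨h, hy.2⟩
          rw [indicator_of_mem hm]
          exact hin y hy h
        · rw [indicator_of_notMem fun h' => h h'.1, add_zero]
          exact hout y hy h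
    _ = (∫⁻ y in Box, g y) + ∫⁻ y in Box, (S ×ˢ II).indicator k y := lintegral_add_left hg _
    _ ≤ (∫⁻ y in Box, g y) + ∫⁻ y in S ×ˢ II, k y := by
        refine add_le_add le_rfl ?_
        refine (setLIntegral_le_lintegral _ _).trans_eq ?_
        exact lintegral_indicator (hS.prod measurableSet_II) _

/-- The gauge distance of the rescaled planar gradient to the limiting one. -/
noncomputable def gaugeGap (p : ℝ) (a A3 : V3) (h : ℝ) (v : Pt2 → V3) : ℝ≥0∞ :=
  ∫⁻ y in Box, Phi p (gap a A3 h v y)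

/-- Choice of a slab on which both the energy and the gauge distance to the phase are small. -/
theorem exists_good_slab {W : M33 → ℝ} (hWc : Continuous W) {p σ ε h : ℝ} {a A3 : V3}
    (hσ : σ = 1 ∨ σ = -1) (hε : 0 < ε) (hε' : ε ≤ 1 / 32) (v : Pt2 → V3) :
    ∃ t, 1 / 8 < σ * (t + ε / 2) - ε / 2 ∧ σ * (t + ε / 2) + ε / 2 < 1 / 4 ∧
      (∫⁻ y in Icc t (t + ε) ×ˢ II, ENNReal.ofReal (dens2 W h ε v y)) +
        ENNReal.ofReal ε⁻¹ * ∫⁻ y in Icc t (t + ε) ×ˢ II, Phi p (phaseGap σ a A3 h v y) ≤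
      16 * (ENNReal.ofReal ε * E2 W h ε v + gaugeGap p a A3 h v) := by
  set D : Pt2 → ℝ≥0∞ := fun y => ENNReal.ofReal (dens2 W h ε v y) with hD
  set P : Pt2 → ℝ≥0∞ := fun y => Phi p (phaseGap σ a A3 h v y) with hP
  have hDm : Measurable D := (measurable_dens2 hWc h ε v).ennreal_ofReal
  have hPm : Measurable P := (measurable_Phi p).comp (measurable_phaseGap ..)
  set N : Pt2 → ℝ≥0∞ := fun y => D y + ENNReal.ofReal ε⁻¹ * P y with hN
  have hNm : Measurable N := hDm.add (hPm.const_mul _)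
  set α : ℝ := if σ = 1 then 1 / 8 else -(1 / 4) with hα
  have hαs : ∀ s, α < s → s < α + 1 / 8 → 1 / 8 < σ * s ∧ σ * s < 1 / 4 ∧ s ∈ II := by
    intro s h1 h2
    rcases hσ with rfl | rfl
    · rw [if_pos rfl] at hα
      refine ⟨?_, ?_, ?_, ?_⟩ <;> linarith
    · rw [if_neg (by norm_num)] at hα
      refine ⟨?_, ?_, ?_, ?_⟩ <;> linarith
  obtain ⟨t, ht1, ht2, hle⟩ := exists_window_le (F := fun s => ∫⁻ r in II, N (s, r))
    hNm.lintegral_prod_right' α hε hε'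
  have k1 := hαs t ht1 (by linarith)
  have k2 := hαs (t + ε) (by linarith) ht2
  refine ⟨t, ?_, ?_, ?_⟩
  · rcases hσ with rfl | rfl
    · linarith
    · linarith
  · rcases hσ with rfl | rfl
    · linarith
    · linarith
  · rw [← lintegral_const_mul _ hPm, ← lintegral_add_left hDm, lintegral_prod_II hNm]
    refine hle.trans ?_
    rw [← lintegral_prod_II hNm]
    have e1 : ∫⁻ y in Ioo α (α + 1 / 8) ×ˢ II, N y ≤
        E2 W h ε v + ENNReal.ofReal ε⁻¹ * gaugeGap p a A3 h v := by
      calc _ ≤ ∫⁻ y in Ioo α (α + 1 / 8) ×ˢ II,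
            (D y + ENNReal.ofReal ε⁻¹ * Phi p (gap a A3 h v y)) := by
            refine setLIntegral_mono' (measurableSet_Ioo.prod measurableSet_II) fun y hy => ?_
            rw [gap_eq_phaseGap hσ (by linarith [(hαs _ hy.1.1 hy.1.2).1])]
        _ ≤ ∫⁻ y in Box, (D y + ENNReal.ofReal ε⁻¹ * Phi p (gap a A3 h v y)) :=
            lintegral_mono_set fun y hy => ⟨(hαs _ hy.1.1 hy.1.2).2.2, hy.2⟩
        _ = _ := by
            rw [lintegral_add_left hDm, lintegral_const_mul' _ _ ENNReal.ofReal_ne_top]; rfl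
    refine (mul_le_mul_right e1 _).trans_eq ?_
    rw [ENNReal.ofReal_mul (by norm_num), mul_assoc, mul_add, ← mul_assoc (ENNReal.ofReal ε)
      (ENNReal.ofReal ε⁻¹), ← ENNReal.ofReal_mul hε.le, mul_inv_cancel₀ hε.ne']
    norm_num

theorem exists_glued {W : M33 → ℝ} (hWc : Continuous W) (hW0 : ∀ ξ, 0 ≤ W ξ) {p C σ γ : ℝ}
    {a A3 : V3} (hp : 2 ≤ p) (hC : 0 ≤ C) (hσ : σ = 1 ∨ σ = -1)
    (hWC : ∀ ξ, W ξ ≤ C * ‖ξ - ![σ • a, 0, σ • A3]‖ ^ p) (hγ : 0 < γ) :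
    ∃ C' : ℝ≥0∞, C' ≠ ∞ ∧ ∀ ε, 0 < ε → ε ≤ 1 / 32 → ∀ v : Pt2 → V3, ContDiffOn ℝ 2 v Box →
      ∃ (g : Pt2 → V3) (c : V3), ContDiffOn ℝ 2 g Box ∧
        (∀ y ∈ Box, σ * y.1 < 1 / 8 → g y = v y) ∧
        (∀ y ∈ Box, 1 / 4 < σ * y.1 → g y = aff σ a A3 (γ * ε) c y) ∧
        E2 W (γ * ε) ε g ≤ E2 W (γ * ε) ε v +
          C' * (ENNReal.ofReal ε * E2 W (γ * ε) ε v + gaugeGap p a A3 (γ * ε) v) ∧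
        gaugeGap p a A3 (γ * ε) g ≤ gaugeGap p a A3 (γ * ε) v +
          C' * (ENNReal.ofReal ε * E2 W (γ * ε) ε v + gaugeGap p a A3 (γ * ε) v) := by
  obtain ⟨K, hK, hstep⟩ := exists_rescaled_step
  have hWz : W ![σ • a, 0, σ • A3] = 0 := by
    refine le_antisymm ((hWC _).trans_eq ?_) (hW0 _)
    rw [sub_self, norm_zero, Real.zero_rpow (by linarith), mul_zero]
  set c1 : ℝ≥0∞ := ENNReal.ofReal (C + 36 * K ^ 2) with hc1
  set c2 : ℝ≥0∞ := 2 ^ p * (1 + Phi p (ENNReal.ofReal K) *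
    (2 ^ p * (1 + Phi p (ENNReal.ofReal γ)))) with hc2
  have h2p : (2 : ℝ≥0∞) ^ p ≠ ∞ := ENNReal.rpow_ne_top_of_nonneg (by linarith) (by norm_num)
  have hc2t : c2 ≠ ∞ := by
    have h1 := Phi_ne_top hp (x := ENNReal.ofReal K) ENNReal.ofReal_ne_top
    have h2 := Phi_ne_top hp (x := ENNReal.ofReal γ) ENNReal.ofReal_ne_top
    rw [hc2]
    finiteness
  refine ⟨16 * (c1 * c2 + 6 + c2), by finiteness, ?_⟩
  intro ε hε hε' v hv
  set h := γ * ε with hh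
  have hh0 : 0 < h := by positivity
  obtain ⟨t, ht1, ht2, hslab⟩ := exists_good_slab (p := p) (h := h) (a := a) (A3 := A3) hWc hσ hε
    hε' v
  set S := Icc t (t + ε) with hS
  have hSσ : ∀ s ∈ S, 1 / 8 < σ * s ∧ s ∈ II := by
    intro s hs
    have q1 := hs.1
    have q2 := hs.2
    rcases hσ with rfl | rfl
    · refine ⟨?_, ?_, ?_⟩ <;> linarith
    · refine ⟨?_, ?_, ?_⟩ <;> linarith
  obtain ⟨c, hc⟩ := exists_slab_poincare (σ := σ) (a := a) (A3 := A3) hp hγ hε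
    (fun s hs => (hSσ s hs).2) hv
  set m : ℝ := -σ / ε with hm
  set k : ℝ := 1 / 2 + σ * (t + ε / 2) / ε with hk
  have hmk : ∀ s, m * s + k = 1 / 2 - σ * (s - (t + ε / 2)) / ε := fun s => by
    rw [hm, hk]; ring
  have hmabs : |m| ≤ 1 / ε := by
    rw [hm, abs_div, abs_of_pos hε]
    rcases hσ with rfl | rfl <;> simp
  obtain ⟨hψ, hψb⟩ := hstep ε hε m k hmabs
  set ψ : ℝ → ℝ := fun s => Real.smoothTransition (m * s + k) with hψd
  have hψ1 : ∀ s, σ * (s - (t + ε / 2)) ≤ -(ε / 2) → ψ s = 1 := fun s hs => by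
    refine Real.smoothTransition.one_of_one_le ?_
    have : σ * (s - (t + ε / 2)) / ε ≤ -(1 / 2) := by rw [div_le_iff₀ hε]; linarith
    rw [hmk]; linarith
  have hψ0 : ∀ s, ε / 2 ≤ σ * (s - (t + ε / 2)) → ψ s = 0 := fun s hs => by
    refine Real.smoothTransition.zero_of_nonpos ?_
    have : 1 / 2 ≤ σ * (s - (t + ε / 2)) / ε := by rw [le_div_iff₀ hε]; linarith
    rw [hmk]; linarith
  set g := interp ψ (aff σ a A3 h c) v with hg
  have hgv : ∀ y, σ * (y.1 - (t + ε / 2)) ≤ -(ε / 2) → g y = v y := fun y hy => by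
    rw [hg, interp, hψ1 _ hy, one_smul, add_sub_cancel]
  have hgl : ∀ y, ε / 2 ≤ σ * (y.1 - (t + ε / 2)) → g y = aff σ a A3 h c y := fun y hy => by
    rw [hg, interp, hψ0 _ hy, zero_smul, add_zero]
  have hcont : Continuous fun y : Pt2 => σ * (y.1 - (t + ε / 2)) := by fun_prop
  have hout : ∀ y ∈ Box, y.1 ∉ S → g =ᶠ[𝓝 y] v ∨ (g =ᶠ[𝓝 y] aff σ a A3 h c ∧ 0 < σ * y.1) := by
    intro y _ hyS
    rcases lt_or_ge (σ * (y.1 - (t + ε / 2))) (-(ε / 2)) with h1 | h1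
    · left
      filter_upwards [(isOpen_lt hcont continuous_const).mem_nhds h1] with z hz
      exact hgv z (le_of_lt hz)
    · right
      have h2 : ε / 2 < σ * (y.1 - (t + ε / 2)) := by
        by_contra h3
        push Not at h3
        refine hyS ?_
        rcases hσ with rfl | rfl
        · constructor <;> linarith
        · constructor <;> linarith
      refine ⟨?_, by linarith⟩
      filter_upwards [(isOpen_lt continuous_const hcont).mem_nhds h2] with z hz
      exact hgl z (le_of_lt hz)
  set D : Pt2 → ℝ≥0∞ := fun y => ENNReal.ofReal (dens2 W h ε v y) with hD
  have hDm : Measurable D := (measurable_dens2 hWc h ε v).ennreal_ofReal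
  have hGm : Measurable fun y => Phi p (gap a A3 h v y) :=
    (measurable_Phi p).comp (measurable_gap ..)
  set L : Pt2 → ℝ≥0∞ := fun y => Phi p (ENNReal.ofReal ε⁻¹ * ‖v y - aff σ a A3 h c y‖ₑ) with hL
  set G : Pt2 → ℝ≥0∞ := fun y => Phi p (phaseGap σ a A3 h v y) with hG
  have hGm' : Measurable G := (measurable_Phi p).comp (measurable_phaseGap ..)
  set X := ENNReal.ofReal ε * E2 W h ε v + gaugeGap p a A3 h v with hX
  set Y : Pt2 → ℝ≥0∞ := fun y => 2 ^ p * (G y + Phi p (ENNReal.ofReal K) * L y) with hY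
  have hin : ∀ y ∈ Box, y.1 ∈ S → ENNReal.ofReal (dens2 W h ε g y) ≤
      ENNReal.ofReal ε⁻¹ * (c1 * Y y) + 6 * D y ∧ Phi p (gap a A3 h g y) ≤ Y y := by
    intro y hy hyS
    obtain ⟨b0, b1, b2⟩ := hψb y.1
    obtain ⟨r1, r2⟩ := interp_bound (c := c) hW0 hp hC hWC hK hε hh0 hψ isOpen_Box hv hy b0 b1 b2
    set R := ‖qd f1 v y - σ • a‖ + ‖h⁻¹ • qd f2 v y - σ • A3‖ +
      K / ε * ‖v y - aff σ a A3 h c y‖ with hR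
    have hR0 : 0 ≤ R := by positivity
    have hRe : ENNReal.ofReal R = phaseGap σ a A3 h v y +
        ENNReal.ofReal K * (ENNReal.ofReal ε⁻¹ * ‖v y - aff σ a A3 h c y‖ₑ) := by
      rw [hR, ENNReal.ofReal_add (by positivity) (by positivity),
        ENNReal.ofReal_add (by positivity) (by positivity), div_eq_mul_inv,
        ENNReal.ofReal_mul (by positivity), ENNReal.ofReal_mul (by positivity), mul_assoc]
      simp only [ofReal_norm]
      rfl
    have hPR : Phi p (ENNReal.ofReal R) ≤ Y y := by
      rw [hRe]
      exact (Phi_add_le hp _ _).trans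
        (mul_le_mul_right (add_le_add_right (Phi_mul_le hp _ _) _) _)
    constructor
    · refine (ENNReal.ofReal_le_ofReal r2).trans (ENNReal.ofReal_add_le.trans ?_)
      refine add_le_add ?_ ?_
      · rw [ENNReal.ofReal_mul (by positivity), ENNReal.ofReal_mul (by positivity),
          ofReal_rpow_add_sq hp hR0]
        gcongr
      · rw [ENNReal.ofReal_mul (by norm_num)]
        norm_num [hD]
    · refine (Phi_mono hp ?_).trans hPR
      rw [gap_eq_phaseGap hσ (by linarith [(hSσ _ hyS).1])]
      refine le_trans (le_of_eq ?_) (ENNReal.ofReal_le_ofReal r1)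
      rw [ENNReal.ofReal_add (by positivity) (by positivity)]
      simp only [ofReal_norm]
      rfl
  have hYint : ∫⁻ y in S ×ˢ II, Y y ≤ c2 * ∫⁻ y in S ×ˢ II, G y := by
    rw [hY, lintegral_const_mul' _ _ h2p, lintegral_add_left hGm',
      lintegral_const_mul' _ _ (Phi_ne_top hp ENNReal.ofReal_ne_top)]
    calc _ ≤ 2 ^ p * ((∫⁻ y in S ×ˢ II, G y) + Phi p (ENNReal.ofReal K) *
          (2 ^ p * (1 + Phi p (ENNReal.ofReal γ)) * ∫⁻ y in S ×ˢ II, G y)) := by gcongr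
      _ = _ := by rw [hc2]; ring
  have hGX : ENNReal.ofReal ε⁻¹ * ∫⁻ y in S ×ˢ II, G y ≤ 16 * X := le_add_self.trans hslab
  have hDX : ∫⁻ y in S ×ˢ II, D y ≤ 16 * X := le_self_add.trans hslab
  have hGX' : ∫⁻ y in S ×ˢ II, G y ≤ 16 * X := by
    refine le_trans ?_ hGX
    refine le_mul_of_one_le_left zero_le ?_
    rw [ENNReal.one_le_ofReal, one_le_inv₀ hε]
    linarith
  refine ⟨g, c, contDiffOn_interp hψ (contDiff_aff ..) hv, fun y _ hy => hgv y ?_,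
    fun y _ hy => hgl y ?_, ?_, ?_⟩
  · linarith
  · linarith
  · refine (setLIntegral_le_add_slab (S := S)
      (k := fun y => ENNReal.ofReal ε⁻¹ * (c1 * Y y) + 6 * D y) measurableSet_Icc hDm ?_
      fun y hy hyS => (hin y hy hyS).1.trans le_add_self).trans ?_
    · intro y hy hyS
      rcases hout y hy hyS with h1 | ⟨h1, -⟩
      · rw [dens2_congr h1]
      · rw [dens2_congr h1, dens2_aff hWz hh0]
        simp
    · refine add_le_add le_rfl ?_
      rw [lintegral_add_right _ (hDm.const_mul _), lintegral_const_mul' _ _ ENNReal.ofReal_ne_top,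
        lintegral_const_mul' _ _ ENNReal.ofReal_ne_top, lintegral_const_mul _ hDm]
      calc _ ≤ ENNReal.ofReal ε⁻¹ * (c1 * (c2 * ∫⁻ y in S ×ˢ II, G y)) + 6 * (16 * X) := by gcongr
        _ = c1 * c2 * (ENNReal.ofReal ε⁻¹ * ∫⁻ y in S ×ˢ II, G y) + 6 * (16 * X) := by ring
        _ ≤ c1 * c2 * (16 * X) + 6 * (16 * X) := by gcongr
        _ ≤ c1 * c2 * (16 * X) + 6 * (16 * X) + c2 * (16 * X) := le_self_add
        _ = _ := by ring
  · refine (setLIntegral_le_add_slab (S := S) (k := Y) measurableSet_Icc hGm ?_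
      fun y hy hyS => (hin y hy hyS).2.trans le_add_self).trans ?_
    · intro y hy hyS
      rcases hout y hy hyS with h1 | ⟨h1, h2⟩
      · rw [gap_congr h1]
      · rw [gap_congr h1, gap_eq_phaseGap hσ h2, phaseGap_aff hh0]
        unfold Phi
        rw [ENNReal.zero_rpow_of_pos (by linarith), ENNReal.zero_rpow_of_pos (by norm_num)]
        simp
    · refine add_le_add le_rfl (hYint.trans ?_)
      calc _ ≤ c2 * (16 * X) := by gcongr
        _ ≤ c2 * (16 * X) + (c1 * c2 + 6) * (16 * X) := le_self_add
        _ = _ := by ring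

/-! ### Compactness: small energy forces the gradient to be close to the limiting one -/

/-- Rescaled planar gradient as a matrix. -/
noncomputable def grad2 (h : ℝ) (v : Pt2 → V3) (y : Pt2) : M33 :=
  ![qd f1 v y, 0, h⁻¹ • qd f2 v y]

theorem measurable_grad2 (h : ℝ) (v : Pt2 → V3) : Measurable (grad2 h v) := by
  refine measurable_pi_lambda _ fun i => ?_
  fin_cases i
  · exact measurable_qd _ _
  · exact measurable_const
  · exact measurable_vec_const_smul _ (measurable_qd _ _)

/-- Distance to the pair of wells `± A`. -/
noncomputable def wellDist (A ξ : M33) : ℝ := min ‖ξ - A‖ ‖ξ + A‖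

theorem wellDist_nonneg (A ξ : M33) : 0 ≤ wellDist A ξ := le_min (norm_nonneg _) (norm_nonneg _)

theorem measurable_wellDist (A : M33) : Measurable (wellDist A) := by
  have : Continuous (wellDist A) := by unfold wellDist; fun_prop
  exact this.measurable

theorem sg_sq (t : ℝ) : sg t = 1 ∨ sg t = -1 := by unfold sg; split_ifs <;> simp

theorem abs_entry_le (ξ : M33) (j i : Fin 3) : |ξ j i| ≤ ‖ξ‖ :=
  (norm_le_pi_norm (ξ j) i).trans (norm_le_pi_norm ξ j)

theorem norm_sub_smul_le {A : M33} {j i : Fin 3} (hA : A j i ≠ 0) (ξ : M33) {σ : ℝ}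
    (hσ : σ = 1 ∨ σ = -1) :
    ‖ξ - σ • A‖ ≤ (1 + 2 * ‖A‖ + 2 * ‖A‖ / |A j i|) *
      (wellDist A ξ + min 1 |ξ j i - σ * A j i|) := by
  set q := |A j i| with hq
  have hq0 : 0 < q := abs_pos.2 hA
  set d := wellDist A ξ with hd
  have hd0 : 0 ≤ d := wellDist_nonneg _ _
  set m := min 1 |ξ j i - σ * A j i| with hm
  have hm0 : 0 ≤ m := le_min zero_le_one (abs_nonneg _)
  have hN : 0 ≤ ‖A‖ := norm_nonneg A
  have hC1 : 0 ≤ 2 * ‖A‖ / q := by positivity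
  have hcase : ‖ξ - σ • A‖ = d ∨ ‖ξ + σ • A‖ = d := by
    rcases hσ with rfl | rfl <;> simp only [one_smul, neg_smul, sub_neg_eq_add, ← sub_eq_add_neg] <;>
      rcases min_choice ‖ξ - A‖ ‖ξ + A‖ with h | h <;> simp only [hd, wellDist, h, true_or, or_true]
  rcases hcase with h | h
  · rw [h]
    nlinarith [mul_nonneg hN hd0, mul_nonneg hC1 hd0, mul_nonneg hN hm0, mul_nonneg hC1 hm0]
  · have h1 : ‖ξ - σ • A‖ ≤ d + 2 * ‖A‖ := by
      have e : ξ - σ • A = (ξ + σ • A) - (2 * σ) • A := by rw [mul_smul, two_smul]; abel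
      rw [e]
      refine (norm_sub_le _ _).trans ?_
      rw [h, norm_smul]
      rcases hσ with rfl | rfl <;> norm_num
    have h2 : |ξ j i + σ * A j i| ≤ d := h ▸ abs_entry_le (ξ + σ • A) j i
    rcases le_total q d with h3 | h3
    · have : 2 * ‖A‖ ≤ 2 * ‖A‖ / q * d := by
        rw [div_mul_eq_mul_div, le_div_iff₀ hq0]
        exact mul_le_mul_of_nonneg_left h3 (by positivity)
      nlinarith [mul_nonneg hN hd0, mul_nonneg hC1 hd0, mul_nonneg hN hm0, mul_nonneg hC1 hm0]
    · have h4 : q ≤ |ξ j i - σ * A j i| := by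
        have e : 2 * q ≤ |ξ j i - σ * A j i| + |ξ j i + σ * A j i| := by
          have : 2 * q = |(ξ j i + σ * A j i) - (ξ j i - σ * A j i)| := by
            rw [show (ξ j i + σ * A j i) - (ξ j i - σ * A j i) = 2 * σ * A j i by ring, abs_mul]
            rcases hσ with rfl | rfl <;> norm_num [hq]
          rw [this]
          exact (abs_sub _ _).trans_eq (add_comm _ _)
        linarith
      have h5 : 2 * ‖A‖ ≤ (2 * ‖A‖ + 2 * ‖A‖ / q) * m := by
        rcases le_total 1 |ξ j i - σ * A j i| with h6 | h6
        · rw [hm, min_eq_left h6]; linarith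
        · have : 2 * ‖A‖ ≤ 2 * ‖A‖ / q * m := by
            rw [hm, min_eq_right h6, div_mul_eq_mul_div, le_div_iff₀ hq0]
            exact mul_le_mul_of_nonneg_left h4 (by positivity)
          nlinarith [mul_nonneg hN hm0]
      nlinarith [mul_nonneg hN hd0, mul_nonneg hC1 hd0, mul_nonneg hN hm0, mul_nonneg hC1 hm0]

theorem Phi_le_two_mul {p : ℝ} (hp : 2 ≤ p) {x : ℝ≥0∞} (hx : x ≤ 1) : Phi p x ≤ 2 * x := by
  unfold Phi
  have h1 := ENNReal.rpow_le_rpow_of_exponent_ge hx (show 1 ≤ p by linarith)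
  have h2 := ENNReal.rpow_le_rpow_of_exponent_ge hx (show (1 : ℝ) ≤ 2 by norm_num)
  rw [ENNReal.rpow_one] at h1 h2
  rw [two_mul]
  exact add_le_add h1 h2

theorem gap_le_grad2 (a A3 : V3) (h : ℝ) (v : Pt2 → V3) (y : Pt2) :
    gap a A3 h v y ≤ 2 * ENNReal.ofReal ‖grad2 h v y - sg y.1 • ![a, 0, A3]‖ := by
  have h1 : ∀ j, ‖grad2 h v y j - (sg y.1 • (![a, 0, A3] : M33)) j‖ₑ ≤
      ENNReal.ofReal ‖grad2 h v y - sg y.1 • ![a, 0, A3]‖ := fun j => by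
    rw [← ofReal_norm]
    exact ENNReal.ofReal_le_ofReal (norm_le_pi_norm (grad2 h v y - sg y.1 • ![a, 0, A3]) j)
  rw [two_mul]
  exact add_le_add (h1 0) (h1 2)

theorem gaugeGap_le_wellDist {p : ℝ} (hp : 2 ≤ p) {a A3 : V3} {j i : Fin 3}
    (hA : (![a, 0, A3] : M33) j i ≠ 0) :
    ∃ C : ℝ≥0∞, C ≠ ∞ ∧ ∀ h v, gaugeGap p a A3 h v ≤
      C * ((∫⁻ y in Box, Phi p (ENNReal.ofReal (wellDist ![a, 0, A3] (grad2 h v y)))) +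
        ∫⁻ y in Box, min 1 (ENNReal.ofReal |grad2 h v y j i - sg y.1 * (![a, 0, A3] : M33) j i|)) := by
  set A : M33 := ![a, 0, A3] with hAd
  set c := 1 + 2 * ‖A‖ + 2 * ‖A‖ / |A j i| with hc
  have hc0 : 0 ≤ c := by positivity
  set c' : ℝ≥0∞ := Phi p (2 * ENNReal.ofReal c) * 2 ^ p with hc'
  have h2p : (2 : ℝ≥0∞) ^ p ≠ ∞ := ENNReal.rpow_ne_top_of_nonneg (by linarith) (by norm_num)
  have hct : c' ≠ ∞ := by
    have := Phi_ne_top hp (x := 2 * ENNReal.ofReal c) (by finiteness)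
    finiteness
  refine ⟨c' * 2, by finiteness, fun h v => ?_⟩
  set d : Pt2 → ℝ≥0∞ := fun y => ENNReal.ofReal (wellDist A (grad2 h v y)) with hd
  set m : Pt2 → ℝ≥0∞ := fun y => min 1 (ENNReal.ofReal |grad2 h v y j i - sg y.1 * A j i|) with hm
  have hdm : Measurable fun y => Phi p (d y) := (measurable_Phi p).comp
    ((measurable_wellDist A).comp (measurable_grad2 h v)).ennreal_ofReal
  have hpt : ∀ y, Phi p (gap a A3 h v y) ≤ c' * (Phi p (d y) + 2 * m y) := fun y => by
    have h1 : gap a A3 h v y ≤ 2 * ENNReal.ofReal c * (d y + m y) := by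
      refine (gap_le_grad2 a A3 h v y).trans ?_
      rw [mul_assoc]
      refine mul_le_mul_right ?_ _
      refine (ENNReal.ofReal_le_ofReal (norm_sub_smul_le hA _ (sg_sq y.1))).trans_eq ?_
      rw [ENNReal.ofReal_mul hc0, ENNReal.ofReal_add (wellDist_nonneg _ _) (by positivity)]
      simp [hm, hd, ENNReal.ofReal_min]
    calc _ ≤ Phi p (2 * ENNReal.ofReal c * (d y + m y)) := Phi_mono hp h1
      _ ≤ Phi p (2 * ENNReal.ofReal c) * (2 ^ p * (Phi p (d y) + Phi p (m y))) :=
          (Phi_mul_le hp _ _).trans (mul_le_mul_right (Phi_add_le hp _ _) _)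
      _ ≤ Phi p (2 * ENNReal.ofReal c) * (2 ^ p * (Phi p (d y) + 2 * m y)) := by
          gcongr
          exact Phi_le_two_mul hp (min_le_left _ _)
      _ = _ := by rw [hc', mul_assoc]
  calc gaugeGap p a A3 h v ≤ ∫⁻ y in Box, c' * (Phi p (d y) + 2 * m y) := lintegral_mono hpt
    _ = c' * ((∫⁻ y in Box, Phi p (d y)) + 2 * ∫⁻ y in Box, m y) := by
        rw [lintegral_const_mul' _ _ hct, lintegral_add_left hdm,
          lintegral_const_mul' _ _ (by norm_num)]
    _ ≤ c' * (2 * (∫⁻ y in Box, Phi p (d y)) + 2 * ∫⁻ y in Box, m y) := by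
        gcongr
        exact le_mul_of_one_le_left zero_le (by norm_num)
    _ = _ := by ring

/-- One-dimensional extremality estimate. -/
theorem lintegral_abs_deriv_sub_le {f : ℝ → ℝ} {U : Set ℝ} (hU : IsOpen U)
    (hf : ContDiffOn ℝ 1 f U) {s t : ℝ} (hst : s ≤ t) (hsub : Icc s t ⊆ U) {τ q : ℝ}
    (hτ : τ = 1 ∨ τ = -1) :
    ∫⁻ x in Ioo s t, ENNReal.ofReal |τ * deriv f x - q| ≤
      ENNReal.ofReal |f t - τ * q * t| + ENNReal.ofReal |f s - τ * q * s| +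
        2 * ∫⁻ x in Ioo s t, ENNReal.ofReal (τ * deriv f x - q) := by
  set u : ℝ → ℝ := fun x => τ * deriv f x - q with hu
  have hdc : ContinuousOn (deriv f) U := hf.continuousOn_deriv_of_isOpen hU le_rfl
  have huc : ContinuousOn u (Icc s t) := (continuousOn_const.mul (hdc.mono hsub)).sub
    continuousOn_const
  have hui : IntegrableOn u (Ioo s t) := huc.integrableOn_Icc.mono_set Ioo_subset_Icc_self
  have hup : IntegrableOn (fun x => max (u x) 0) (Ioo s t) :=
    (huc.sup continuousOn_const).integrableOn_Icc.mono_set Ioo_subset_Icc_self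
  have hint : ∫ x in Ioo s t, u x = τ * (f t - f s) - q * (t - s) := by
    have hd : ∫ x in s..t, deriv f x = f t - f s := by
      refine intervalIntegral.integral_deriv_eq_sub (fun x hx => ?_) ?_
      · rw [uIcc_of_le hst] at hx
        exact (hf.differentiableOn (by norm_num)).differentiableAt (hU.mem_nhds (hsub hx))
      · exact ContinuousOn.intervalIntegrable (by rw [uIcc_of_le hst]; exact hdc.mono hsub)
    rw [← integral_Ioc_eq_integral_Ioo, ← intervalIntegral.integral_of_le hst, hu,
      intervalIntegral.integral_sub, intervalIntegral.integral_const_mul, hd]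
    · simp [mul_comm]
    · exact ContinuousOn.intervalIntegrable
        (by rw [uIcc_of_le hst]; exact continuousOn_const.mul (hdc.mono hsub))
    · simp
  have habs : ∫ x in Ioo s t, |u x| = -(∫ x in Ioo s t, u x) + 2 * ∫ x in Ioo s t, max (u x) 0 := by
    rw [← integral_neg, ← integral_const_mul, ← integral_add
      (show Integrable (fun x => -u x) _ from hui.neg) (hup.const_mul 2)]
    refine integral_congr_ae (Eventually.of_forall fun x => ?_)
    dsimp only
    rcases le_total 0 (u x) with h | h
    · rw [abs_of_nonneg h, max_eq_left h]; ring
    · rw [abs_of_nonpos h, max_eq_right h]; ring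
  have hb : -(∫ x in Ioo s t, u x) ≤ |f t - τ * q * t| + |f s - τ * q * s| := by
    rw [hint]
    have e : -(τ * (f t - f s) - q * (t - s)) =
        -τ * (f t - τ * q * t) + τ * (f s - τ * q * s) := by
      rcases hτ with rfl | rfl <;> ring
    rw [e]
    refine (le_abs_self _).trans ((abs_add_le _ _).trans_eq ?_)
    rw [abs_mul, abs_mul]
    rcases hτ with rfl | rfl <;> norm_num
  have l1 : ∫⁻ x in Ioo s t, ENNReal.ofReal |u x| = ENNReal.ofReal (∫ x in Ioo s t, |u x|) :=
    (ofReal_integral_eq_lintegral_ofReal hui.abs (Eventually.of_forall fun x => abs_nonneg _)).symm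
  have l2 : ∫⁻ x in Ioo s t, ENNReal.ofReal (u x) =
      ENNReal.ofReal (∫ x in Ioo s t, max (u x) 0) := by
    rw [ofReal_integral_eq_lintegral_ofReal hup (Eventually.of_forall fun x => le_max_right _ _)]
    refine lintegral_congr fun x => ?_
    rw [ENNReal.ofReal_max, ENNReal.ofReal_zero, max_eq_left zero_le]
  have hm0 : 0 ≤ ∫ x in Ioo s t, max (u x) 0 :=
    integral_nonneg fun x => le_max_right _ _
  rw [l1, l2, habs, ← ENNReal.ofReal_add (abs_nonneg _) (abs_nonneg _)]
  have : (2 : ℝ≥0∞) = ENNReal.ofReal 2 := by norm_num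
  rw [this, ← ENNReal.ofReal_mul (by norm_num), ← ENNReal.ofReal_add (by positivity) (by positivity)]
  exact ENNReal.ofReal_le_ofReal (by linarith)

theorem exists_slice_mean_le {f : Pt2 → ℝ≥0∞} (hf : ContinuousOn f Box) {β θ : ℝ} (hθ : 0 < θ)
    (hsub : Ioo β (β + θ) ⊆ II) :
    ∃ s ∈ Ioo β (β + θ), ∫⁻ r in II, f (s, r) ≤ (ENNReal.ofReal θ)⁻¹ * ∫⁻ y in Box, f y := by
  classical
  set g : Pt2 → ℝ≥0∞ := Box.piecewise f 0 with hg
  have hgm : Measurable g := hf.measurable_piecewise continuousOn_const measurableSet_Box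
  have hgf : ∀ y ∈ Box, g y = f y := fun y hy => piecewise_eq_of_mem _ _ _ hy
  have hvol : volume (Ioo β (β + θ)) = ENNReal.ofReal θ := by rw [Real.volume_Ioo]; congr 1; ring
  obtain ⟨s, hs, hle⟩ := exists_le_setLAverage (μ := volume) (s := Ioo β (β + θ))
    (f := fun s => ∫⁻ r in II, g (s, r)) (by rw [hvol]; simpa using hθ)
    (by rw [hvol]; simp) hgm.lintegral_prod_right'.aemeasurable
  refine ⟨s, hs, ?_⟩
  have e1 : ∫⁻ r in II, f (s, r) = ∫⁻ r in II, g (s, r) :=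
    setLIntegral_congr_fun measurableSet_II fun r hr => (hgf _ ⟨hsub hs, hr⟩).symm
  have e2 : ∫⁻ y in Box, f y = ∫⁻ y in Box, g y :=
    setLIntegral_congr_fun measurableSet_Box fun y hy => (hgf y hy).symm
  rw [e1, e2]
  refine hle.trans ?_
  rw [setLAverage_eq, hvol, ENNReal.div_eq_inv_mul, ← lintegral_prod_II hgm]
  exact mul_le_mul_right (lintegral_mono_set (prod_mono hsub subset_rfl)) _

theorem abs_sub_le_wellDist (A ξ : M33) (j i : Fin 3) : |ξ j i| - |A j i| ≤ wellDist A ξ := by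
  refine le_min ?_ ?_
  · exact (abs_sub_abs_le_abs_sub _ _).trans (abs_entry_le (ξ - A) j i)
  · have h := abs_sub_abs_le_abs_sub (ξ j i) (-A j i)
    rw [abs_neg, sub_neg_eq_add] at h
    exact h.trans (abs_entry_le (ξ + A) j i)

theorem lintegral_half_dev_le {σ h θ : ℝ} {a A3 : V3} {i : Fin 3} (hσ : σ = 1 ∨ σ = -1)
    (hθ : 0 < θ) (hθ' : θ ≤ 1 / 8) {v : Pt2 → V3} (hv : ContDiffOn ℝ 2 v Box) {α : ℝ}
    (hα : ∀ s ∈ Ioo α (α + 1 / 2), 0 < σ * s ∧ s ∈ II) :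
    ∫⁻ y in Ioo α (α + 1 / 2) ×ˢ II, min 1 (ENNReal.ofReal |qd f1 v y i - σ * a i|) ≤
      2 * ENNReal.ofReal θ + 2 * ((ENNReal.ofReal θ)⁻¹ * ∫⁻ y in Box, ‖v y - |y.1| • a‖ₑ) +
        2 * ∫⁻ y in Box, ENNReal.ofReal (wellDist ![a, 0, A3] (grad2 h v y)) := by
  set A : M33 := ![a, 0, A3] with hA
  set e : Pt2 → ℝ≥0∞ := fun y => ‖v y - |y.1| • a‖ₑ with he
  have hec : ContinuousOn e Box := by
    have h1 : ContinuousOn (fun y : Pt2 => v y - |y.1| • a) Box :=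
      hv.continuousOn.sub (Continuous.continuousOn (by fun_prop))
    exact continuous_enorm.comp_continuousOn h1
  set d : Pt2 → ℝ≥0∞ := fun y => ENNReal.ofReal (wellDist A (grad2 h v y)) with hd
  have hdm : Measurable d :=
    ((measurable_wellDist A).comp (measurable_grad2 h v)).ennreal_ofReal
  set m : Pt2 → ℝ≥0∞ := fun y => min 1 (ENNReal.ofReal |qd f1 v y i - σ * a i|) with hm
  have hmm : Measurable m := by
    have h1 : Measurable fun y => qd f1 v y i := (measurable_pi_apply i).comp (measurable_qd f1 v)
    have h2 : Measurable fun y => |qd f1 v y i - σ * a i| :=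
      continuous_abs.measurable.comp (h1.sub_const _)
    exact measurable_const.min h2.ennreal_ofReal
  obtain ⟨s, hs, hEs⟩ := exists_slice_mean_le hec hθ (β := α)
    fun x hx => (hα x ⟨hx.1, by linarith [hx.2]⟩).2
  obtain ⟨t, ht, hEt⟩ := exists_slice_mean_le hec hθ (β := α + 1 / 2 - θ)
    fun x hx => (hα x ⟨by linarith [hx.1], by linarith [hx.2]⟩).2
  have hst : s ≤ t := by linarith [hs.2, ht.1]
  have hIcc : ∀ x ∈ Icc s t, 0 < σ * x ∧ x ∈ II := fun x hx =>
    hα x ⟨hs.1.trans_le hx.1, by linarith [hx.2, ht.2]⟩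
  have habs : ∀ x ∈ Icc s t, |x| = σ * x := fun x hx => by
    have := (hIcc x hx).1
    rcases hσ with rfl | rfl
    · rw [abs_of_pos (by linarith), one_mul]
    · rw [abs_of_neg (by linarith), neg_one_mul]
  obtain ⟨τ, hτ, hτa⟩ : ∃ τ : ℝ, (τ = 1 ∨ τ = -1) ∧ τ * |a i| = σ * a i := by
    rcases le_total 0 (a i) with h0 | h0
    · exact ⟨σ, hσ, by rw [abs_of_nonneg h0]⟩
    · refine ⟨-σ, ?_, by rw [abs_of_nonpos h0]; ring⟩
      rcases hσ with rfl | rfl <;> simp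
  have hτ2 : τ * τ = 1 := by rcases hτ with rfl | rfl <;> norm_num
  have hτabs : |τ| = 1 := by rcases hτ with rfl | rfl <;> norm_num
  have hend : ∀ x ∈ Icc s t, ∀ r, ENNReal.ofReal |v (x, r) i - τ * |a i| * x| ≤ e (x, r) := by
    intro x hx r
    rw [hτa, he]
    dsimp only
    rw [← ofReal_norm]
    refine ENNReal.ofReal_le_ofReal ?_
    have := norm_le_pi_norm (v (x, r) - |x| • a) i
    rw [habs x hx] at this ⊢
    refine le_trans (le_of_eq ?_) this
    rw [Real.norm_eq_abs]
    congr 1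
    simp
    ring
  have hone : ∀ r ∈ II, ∫⁻ x in Ioo s t, ENNReal.ofReal |qd f1 v (x, r) i - σ * a i| ≤
      e (t, r) + e (s, r) + 2 * ∫⁻ x in II, d (x, r) := by
    intro r hr
    have hc : ContDiffOn ℝ 1 (fun x => v (x, r) i) II := by
      have h1 : ContDiffOn ℝ 1 (fun x => v (x, r)) II :=
        (hv.of_le (by norm_num)).comp (ContDiff.contDiffOn (by fun_prop)) fun x hx => ⟨hx, hr⟩
      exact (contDiffOn_pi.1 h1) i
    have hder : ∀ x ∈ II, deriv (fun x => v (x, r) i) x = qd f1 v (x, r) i := fun x hx => by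
      have hdv : DifferentiableAt ℝ v (x, r) :=
        (hv.differentiableOn (by norm_num)).differentiableAt (isOpen_Box.mem_nhds ⟨hx, hr⟩)
      have hd1 : HasDerivAt (fun x => v (x, r)) (qd f1 v (x, r)) x := by
        rw [← deriv_horizontal hdv]
        exact (hdv.comp x (by fun_prop : DifferentiableAt ℝ (fun x : ℝ => ((x, r) : Pt2)) x)
          ).hasDerivAt
      exact ((hasDerivAt_pi.1 hd1) i).deriv
    have h1 := lintegral_abs_deriv_sub_le isOpen_Ioo hc hst (fun x hx => (hIcc x hx).2)
      (q := |a i|) hτ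
    have e1 : ∫⁻ x in Ioo s t, ENNReal.ofReal |qd f1 v (x, r) i - σ * a i| =
        ∫⁻ x in Ioo s t, ENNReal.ofReal |τ * deriv (fun x => v (x, r) i) x - (|a i|)| := by
      refine setLIntegral_congr_fun measurableSet_Ioo fun x hx => ?_
      rw [hder x (hIcc x (Ioo_subset_Icc_self hx)).2, ← hτa]
      congr 1
      have : τ * qd f1 v (x, r) i - |a i| = τ * (qd f1 v (x, r) i - τ * |a i|) := by
        linear_combination (|a i|) * hτ2
      rw [this, abs_mul, hτabs, one_mul]
    rw [e1]
    refine h1.trans (add_le_add (add_le_add (hend t ⟨hst, le_rfl⟩ r) (hend s ⟨le_rfl, hst⟩ r)) ?_)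
    refine mul_le_mul_right ?_ _
    refine (setLIntegral_mono' measurableSet_Ioo (g := fun x => d (x, r)) fun x hx => ?_).trans
      (lintegral_mono_set fun x hx => (hIcc x (Ioo_subset_Icc_self hx)).2)
    refine ENNReal.ofReal_le_ofReal ?_
    rw [hder x (hIcc x (Ioo_subset_Icc_self hx)).2]
    refine le_trans ?_ (abs_sub_le_wellDist A (grad2 h v (x, r)) 0 i)
    refine sub_le_sub_right ?_ _
    refine (le_abs_self _).trans_eq ?_
    rw [abs_mul, hτabs, one_mul]
    rfl
  have htwo : ∀ r ∈ II, ∫⁻ x in Ioo α (α + 1 / 2), m (x, r) ≤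
      e (t, r) + (e (s, r) + (2 * (∫⁻ x in II, d (x, r)) + 2 * ENNReal.ofReal θ)) := by
    intro r hr
    have hcov : Ioo α (α + 1 / 2) ⊆ Ioo s t ∪ (Icc α (α + θ) ∪ Icc (α + 1 / 2 - θ) (α + 1 / 2)) := by
      intro x hx
      by_cases h1 : x ≤ s
      · exact Or.inr (Or.inl ⟨hx.1.le, by linarith [hs.2]⟩)
      · by_cases h2 : t ≤ x
        · exact Or.inr (Or.inr ⟨by linarith [ht.1], hx.2.le⟩)
        · exact Or.inl ⟨not_le.1 h1, not_le.1 h2⟩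
    have hle1 : ∀ S : Set ℝ, ∫⁻ x in S, m (x, r) ≤ volume S := fun S => by
      refine (lintegral_mono fun x => min_le_left _ _).trans_eq ?_
      simp
    calc _ ≤ ∫⁻ x in Ioo s t ∪ (Icc α (α + θ) ∪ Icc (α + 1 / 2 - θ) (α + 1 / 2)), m (x, r) :=
          lintegral_mono_set hcov
      _ ≤ (∫⁻ x in Ioo s t, m (x, r)) + ((∫⁻ x in Icc α (α + θ), m (x, r)) +
            ∫⁻ x in Icc (α + 1 / 2 - θ) (α + 1 / 2), m (x, r)) :=
          (lintegral_union_le _ _ _).trans (add_le_add le_rfl (lintegral_union_le _ _ _))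
      _ ≤ (e (t, r) + e (s, r) + 2 * ∫⁻ x in II, d (x, r)) +
            (ENNReal.ofReal θ + ENNReal.ofReal θ) := by
          refine add_le_add ((lintegral_mono fun x => min_le_right _ _).trans (hone r hr))
            (add_le_add ((hle1 _).trans_eq ?_) ((hle1 _).trans_eq ?_)) <;>
          · rw [Real.volume_Icc]; congr 1; ring
      _ = _ := by ring
  have hrow : ∀ x ∈ II, AEMeasurable (fun r => e (x, r)) (volume.restrict II) := fun x hx =>
    ContinuousOn.aemeasurable (hec.comp (Continuous.continuousOn (by fun_prop)) fun r hr => ⟨hx, hr⟩)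
      measurableSet_II
  rw [lintegral_prod_II_symm hmm]
  calc _ ≤ ∫⁻ r in II, (e (t, r) + (e (s, r) + (2 * (∫⁻ x in II, d (x, r)) +
        2 * ENNReal.ofReal θ))) := setLIntegral_mono' measurableSet_II htwo
    _ = (∫⁻ r in II, e (t, r)) + ((∫⁻ r in II, e (s, r)) + (2 * (∫⁻ y in Box, d y) +
        2 * ENNReal.ofReal θ)) := by
        have hdr : Measurable fun r => ∫⁻ x in II, d (x, r) := hdm.lintegral_prod_left'
        rw [lintegral_add_left' (hrow t (hIcc t ⟨hst, le_rfl⟩).2),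
          lintegral_add_left' (hrow s (hIcc s ⟨le_rfl, hst⟩).2),
          lintegral_add_left (hdr.const_mul _), lintegral_const_mul _ hdr, setLIntegral_const,
          volume_II, mul_one]
        have : ∫⁻ y in Box, d y = ∫⁻ r in II, ∫⁻ x in II, d (x, r) := lintegral_prod_II_symm hdm
        rw [this]
    _ ≤ (ENNReal.ofReal θ)⁻¹ * (∫⁻ y in Box, e y) + ((ENNReal.ofReal θ)⁻¹ * (∫⁻ y in Box, e y) +
        (2 * (∫⁻ y in Box, d y) + 2 * ENNReal.ofReal θ)) := by gcongr
    _ = _ := by ring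

theorem lintegral_Box_le_halves (f : Pt2 → ℝ≥0∞) :
    ∫⁻ y in Box, f y ≤ (∫⁻ y in Ioo 0 (0 + 1 / 2) ×ˢ II, f y) +
      ∫⁻ y in Ioo (-(1 / 2)) (-(1 / 2) + 1 / 2) ×ˢ II, f y := by
  have hcov : Box ⊆ (Ioo (0 : ℝ) (0 + 1 / 2) ×ˢ II) ∪
      ((Ioo (-(1 / 2 : ℝ)) (-(1 / 2) + 1 / 2) ×ˢ II) ∪ ({0} ×ˢ II)) := by
    intro y hy
    have h1 := hy.1.1
    have h2 := hy.1.2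
    rcases lt_trichotomy y.1 0 with h | h | h
    · exact Or.inr (Or.inl ⟨⟨h1, by linarith⟩, hy.2⟩)
    · exact Or.inr (Or.inr ⟨h, hy.2⟩)
    · exact Or.inl ⟨⟨h, by linarith⟩, hy.2⟩
  refine (lintegral_mono_set hcov).trans ((lintegral_union_le _ _ _).trans (add_le_add le_rfl ?_))
  refine (lintegral_union_le _ _ _).trans_eq ?_
  have : volume (({0} : Set ℝ) ×ˢ II) = 0 := by
    rw [Measure.volume_eq_prod, Measure.prod_prod]; simp
  rw [setLIntegral_measure_zero _ _ this, add_zero]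

theorem lintegral_dev_le {h θ : ℝ} (a A3 : V3) (i : Fin 3) (hθ : 0 < θ) (hθ' : θ ≤ 1 / 8)
    {v : Pt2 → V3} (hv : ContDiffOn ℝ 2 v Box) :
    ∫⁻ y in Box, min 1 (ENNReal.ofReal |qd f1 v y i - sg y.1 * a i|) ≤
      4 * ENNReal.ofReal θ + 4 * ((ENNReal.ofReal θ)⁻¹ * ∫⁻ y in Box, ‖v y - |y.1| • a‖ₑ) +
        4 * ∫⁻ y in Box, ENNReal.ofReal (wellDist ![a, 0, A3] (grad2 h v y)) := by
  have hα1 : ∀ s ∈ Ioo (0 : ℝ) (0 + 1 / 2), 0 < 1 * s ∧ s ∈ II := fun s hs => by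
    have := hs.1
    have := hs.2
    refine ⟨?_, ?_, ?_⟩ <;> linarith
  have hα2 : ∀ s ∈ Ioo (-(1 / 2) : ℝ) (-(1 / 2) + 1 / 2), 0 < (-1) * s ∧ s ∈ II := fun s hs => by
    have := hs.1
    have := hs.2
    refine ⟨?_, ?_, ?_⟩ <;> linarith
  refine (lintegral_Box_le_halves _).trans ?_
  have k1 := lintegral_half_dev_le (h := h) (a := a) (A3 := A3) (i := i) (Or.inl rfl) hθ hθ' hv hα1
  have k2 := lintegral_half_dev_le (h := h) (a := a) (A3 := A3) (i := i) (Or.inr rfl) hθ hθ' hv hα2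
  refine (add_le_add (le_trans (le_of_eq ?_) k1) (le_trans (le_of_eq ?_) k2)).trans_eq ?_
  · refine setLIntegral_congr_fun (measurableSet_Ioo.prod measurableSet_II) fun y hy => ?_
    rw [sg_eq (Or.inl rfl) (hα1 _ hy.1).1]
  · refine setLIntegral_congr_fun (measurableSet_Ioo.prod measurableSet_II) fun y hy => ?_
    rw [sg_eq (Or.inr rfl) (hα2 _ hy.1).1]
  · ring

theorem lintegral_wellDist_rpow_le {W : M33 → ℝ} {A : M33} {p C : ℝ}
    (hp : 2 ≤ p) (hC : 0 ≤ C) (hgr : ∀ ξ, wellDist A ξ ^ p ≤ C * W ξ) {h ε : ℝ} (hε : 0 < ε)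
    (v : Pt2 → V3) :
    ∫⁻ y in Box, ENNReal.ofReal (wellDist A (grad2 h v y)) ^ p ≤
      ENNReal.ofReal C * (ENNReal.ofReal ε * E2 W h ε v) := by
  unfold E2
  rw [← lintegral_const_mul' _ _ ENNReal.ofReal_ne_top,
    ← lintegral_const_mul' _ _ ENNReal.ofReal_ne_top]
  refine lintegral_mono fun y => ?_
  rw [ENNReal.ofReal_rpow_of_nonneg (wellDist_nonneg _ _) (by linarith), ← ENNReal.ofReal_mul hε.le,
    ← ENNReal.ofReal_mul hC]
  refine ENNReal.ofReal_le_ofReal ((hgr _).trans (mul_le_mul_of_nonneg_left ?_ hC))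
  have hh : 0 ≤ hess2 h v y := by
    unfold hess2
    have := vnorm_nonneg
    positivity
  have e : ε * dens2 W h ε v y = W (grad2 h v y) + ε ^ 2 * hess2 h v y := by
    unfold dens2 grad2
    field_simp
  rw [e]
  have : 0 ≤ ε ^ 2 * hess2 h v y := by positivity
  linarith

theorem exists_gaugeGap_le {W : M33 → ℝ} {a A3 : V3} {p c : ℝ}
    (hp : 2 ≤ p) (hc : 0 ≤ c) (hgr : ∀ ξ, wellDist ![a, 0, A3] ξ ^ p ≤ c * W ξ)
    (hA : a ≠ 0 ∨ A3 ≠ 0) :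
    ∃ C : ℝ≥0∞, C ≠ ∞ ∧ ∀ ε, 0 < ε → ∀ (h : ℝ) (v : Pt2 → V3), ContDiffOn ℝ 2 v Box →
      ∀ θ, 0 < θ → θ ≤ 1 / 8 → ∀ Z, Z = ENNReal.ofReal c * (ENNReal.ofReal ε * E2 W h ε v) →
      gaugeGap p a A3 h v ≤ C * (Z + Z ^ (2 / p) + Z ^ (1 / p) + ENNReal.ofReal θ +
        (ENNReal.ofReal θ)⁻¹ * (∫⁻ y in Box, ‖v y - |y.1| • a‖ₑ) +
        ∫⁻ y in Box, ‖h⁻¹ • qd f2 v y - sg y.1 • A3‖ₑ) := by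
  have hp0 : 0 < p := by linarith
  have hmain : ∀ ε, 0 < ε → ∀ (h : ℝ) (v : Pt2 → V3), ∀ Z,
      Z = ENNReal.ofReal c * (ENNReal.ofReal ε * E2 W h ε v) →
      (∫⁻ y in Box, Phi p (ENNReal.ofReal (wellDist ![a, 0, A3] (grad2 h v y)))) ≤ Z + Z ^ (2 / p) ∧
      (∫⁻ y in Box, ENNReal.ofReal (wellDist ![a, 0, A3] (grad2 h v y))) ≤ Z ^ (1 / p) := by
    intro ε hε h v Z hZ
    set d : Pt2 → ℝ≥0∞ := fun y => ENNReal.ofReal (wellDist ![a, 0, A3] (grad2 h v y)) with hd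
    have hdm : Measurable d :=
      ((measurable_wellDist _).comp (measurable_grad2 h v)).ennreal_ofReal
    have hZ1 : ∫⁻ y in Box, d y ^ p ≤ Z := hZ ▸ lintegral_wellDist_rpow_le hp hc hgr hε v
    have hlow : ∀ q : ℝ, 1 ≤ q → q ≤ p → ∫⁻ y in Box, d y ^ q ≤ Z ^ (q / p) := by
      intro q hq1 hqp
      have hq0 : 0 < q := by linarith
      have j := rpow_lintegral_le (μ := volume.restrict Box) (q := p / q)
        (by rwa [one_le_div hq0]) (f := fun y => d y ^ q) (hdm.pow_const q).aemeasurable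
      have e : ∀ y, (d y ^ q) ^ (p / q) = d y ^ p := fun y => by
        rw [← ENNReal.rpow_mul]; congr 1; field_simp
      simp only [e] at j
      have := ENNReal.rpow_le_rpow (j.trans hZ1) (show 0 ≤ q / p by positivity)
      rwa [← ENNReal.rpow_mul, show p / q * (q / p) = 1 by field_simp, ENNReal.rpow_one] at this
    constructor
    · unfold Phi
      rw [lintegral_add_left (hdm.pow_const p)]
      exact add_le_add hZ1 (hlow 2 (by norm_num) hp)
    · have := hlow 1 le_rfl (by linarith)
      simpa using this
  by_cases hA3 : A3 = 0
  · have ha : a ≠ 0 := hA.resolve_right (not_not.2 hA3)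
    obtain ⟨i, hi⟩ := Function.ne_iff.1 ha
    obtain ⟨C, hC, hb⟩ := gaugeGap_le_wellDist hp (a := a) (A3 := A3) (j := 0) (i := i) hi
    refine ⟨C * 4, by finiteness, fun ε hε h v hv θ hθ hθ' Z hZ => (hb h v).trans ?_⟩
    obtain ⟨k1, k2⟩ := hmain ε hε h v Z hZ
    have k3 := lintegral_dev_le (h := h) a A3 i hθ hθ' hv
    rw [mul_assoc]
    refine mul_le_mul_right ?_ _
    set D := ∫⁻ y in Box, ‖v y - |y.1| • a‖ₑ
    set D' := ∫⁻ y in Box, ‖h⁻¹ • qd f2 v y - sg y.1 • A3‖ₑ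
    calc _ ≤ (Z + Z ^ (2 / p)) + (4 * ENNReal.ofReal θ + 4 * ((ENNReal.ofReal θ)⁻¹ * D) +
          4 * Z ^ (1 / p)) := add_le_add k1 (k3.trans (by gcongr))
      _ ≤ 4 * (Z + Z ^ (2 / p)) + (4 * ENNReal.ofReal θ + 4 * ((ENNReal.ofReal θ)⁻¹ * D) +
          4 * Z ^ (1 / p)) + 4 * D' := by
          refine le_trans (add_le_add_left ?_ _) le_self_add
          exact le_mul_of_one_le_left zero_le (by norm_num)
      _ = _ := by ring
  · obtain ⟨i, hi⟩ := Function.ne_iff.1 hA3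
    obtain ⟨C, hC, hb⟩ := gaugeGap_le_wellDist hp (a := a) (A3 := A3) (j := 2) (i := i) hi
    refine ⟨C, hC, fun ε hε h v hv θ hθ hθ' Z hZ => (hb h v).trans ?_⟩
    obtain ⟨k1, -⟩ := hmain ε hε h v Z hZ
    refine mul_le_mul_right ?_ _
    set D := ∫⁻ y in Box, ‖v y - |y.1| • a‖ₑ
    have k3 : ∫⁻ y in Box, min 1 (ENNReal.ofReal
        |grad2 h v y 2 i - sg y.1 * (![a, 0, A3] : M33) 2 i|) ≤
        ∫⁻ y in Box, ‖h⁻¹ • qd f2 v y - sg y.1 • A3‖ₑ := by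
      refine lintegral_mono fun y => (min_le_right _ _).trans ?_
      rw [← ofReal_norm]
      exact ENNReal.ofReal_le_ofReal (norm_le_pi_norm (h⁻¹ • qd f2 v y - sg y.1 • A3) i)
    refine add_le_add (k1.trans ?_) k3
    rw [add_assoc, add_assoc (Z + Z ^ (2 / p))]
    exact le_self_add

/-! ### Planar profiles of almost minimal energy, pinned in both phases -/

/-- A planar profile `v` at scale `ε`, whose energy and gauge distance to the limiting gradient are
optimal up to an error `η`. -/
structure NearOptimal (W : M33 → ℝ) (p γ : ℝ) (a A3 : V3) (η ε : ℝ) (v : Pt2 → V3) : Prop where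
  pos : 0 < ε
  lt : ε < η
  contDiffOn : ContDiffOn ℝ 2 v Box
  energy_le : E2 W (γ * ε) ε v ≤ Kstar W a A3 γ + ENNReal.ofReal η
  gauge_le : gaugeGap p a A3 (γ * ε) v ≤ ENNReal.ofReal η

theorem exists_pos_le_of_tendsto {f : ℝ → ℝ≥0∞} (hf : Tendsto f (𝓝[>] 0) (𝓝 0)) {η δ : ℝ}
    (hη : 0 < η) (hδ : 0 < δ) : ∃ t, 0 < t ∧ t < δ ∧ f t ≤ ENNReal.ofReal η := by
  have h1 : ∀ᶠ t in 𝓝[>] (0 : ℝ), f t ≤ ENNReal.ofReal η :=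
    (hf.eventually_lt_const (ENNReal.ofReal_pos.2 hη)).mono fun _ h => h.le
  have h2 : ∀ᶠ t in 𝓝[>] (0 : ℝ), t ∈ Ioo 0 δ := Ioo_mem_nhdsGT hδ
  obtain ⟨t, ht1, ht2⟩ := (h1.and h2).exists
  exact ⟨t, ht2.1, ht2.2, ht1⟩

theorem tendsto_ofReal_nhdsGT_zero :
    Tendsto ENNReal.ofReal (𝓝[>] (0 : ℝ)) (𝓝 0) := by
  have := (ENNReal.continuous_ofReal.tendsto (0 : ℝ)).mono_left (nhdsWithin_le_nhds (s := Ioi 0))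
  rwa [ENNReal.ofReal_zero] at this

theorem tendsto_rpow_zero {α : Type*} {l : Filter α} {f : α → ℝ≥0∞} (hf : Tendsto f l (𝓝 0))
    {q : ℝ} (hq : 0 < q) : Tendsto (fun t => f t ^ q) l (𝓝 0) := by
  have := (ENNReal.continuous_rpow_const (y := q)).tendsto 0 |>.comp hf
  rwa [ENNReal.zero_rpow_of_pos hq] at this

theorem tendsto_const_mul_zero {α : Type*} {l : Filter α} {f : α → ℝ≥0∞} (hf : Tendsto f l (𝓝 0))
    {C : ℝ≥0∞} (hC : C ≠ ∞) : Tendsto (fun t => C * f t) l (𝓝 0) := by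
  have := ENNReal.Tendsto.const_mul (a := C) hf (Or.inr hC)
  rwa [mul_zero] at this

theorem tendsto_add_zero {α : Type*} {l : Filter α} {f g : α → ℝ≥0∞} (hf : Tendsto f l (𝓝 0))
    (hg : Tendsto g l (𝓝 0)) : Tendsto (fun t => f t + g t) l (𝓝 0) := by
  have := hf.add hg
  rwa [add_zero] at this

theorem exists_nearOptimal {W : M33 → ℝ} (hWc : Continuous W) (hW0 : ∀ ξ, 0 ≤ W ξ) (h4 : H4 W)
    {a A3 : V3} {p c γ : ℝ} (hp : 2 ≤ p) (hc : 0 ≤ c)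
    (hgr : ∀ ξ, wellDist ![a, 0, A3] ξ ^ p ≤ c * W ξ) (hA : a ≠ 0 ∨ A3 ≠ 0) (hγ : 0 < γ)
    (hK : Kstar W a A3 γ ≠ ⊤) {η : ℝ} (hη : 0 < η) :
    ∃ ε v, NearOptimal W p γ a A3 η ε v := by
  obtain ⟨C, hC, hgap⟩ := exists_gaugeGap_le hp hc hgr hA
  set M : ℝ≥0∞ := Kstar W a A3 γ + 1 with hM
  have hMt : M ≠ ∞ := by finiteness
  set z : ℝ → ℝ≥0∞ := fun θ => ENNReal.ofReal c * (ENNReal.ofReal (θ * θ) * M) with hz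
  have hsq : Tendsto (fun θ : ℝ => ENNReal.ofReal (θ * θ)) (𝓝[>] 0) (𝓝 0) := by
    have h : Continuous fun θ : ℝ => ENNReal.ofReal (θ * θ) :=
      ENNReal.continuous_ofReal.comp (by fun_prop)
    have := (h.tendsto 0).mono_left (nhdsWithin_le_nhds (s := Ioi 0))
    simpa using this
  have hz0 : Tendsto z (𝓝[>] 0) (𝓝 0) := by
    refine tendsto_const_mul_zero ?_ ENNReal.ofReal_ne_top
    simp only [mul_comm _ M]
    exact tendsto_const_mul_zero hsq hMt
  have hlim : Tendsto (fun θ => C * (z θ + z θ ^ (2 / p) + z θ ^ (1 / p) + ENNReal.ofReal θ +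
      ENNReal.ofReal θ + ENNReal.ofReal (θ * θ))) (𝓝[>] 0) (𝓝 0) :=
    tendsto_const_mul_zero (tendsto_add_zero (tendsto_add_zero (tendsto_add_zero (tendsto_add_zero
      (tendsto_add_zero hz0 (tendsto_rpow_zero hz0 (by positivity)))
      (tendsto_rpow_zero hz0 (by positivity))) tendsto_ofReal_nhdsGT_zero)
      tendsto_ofReal_nhdsGT_zero) hsq) hC
  obtain ⟨θ, hθ, hθ', hle⟩ := exists_pos_le_of_tendsto hlim hη
    (lt_min (by norm_num : (0 : ℝ) < 1 / 8) hη)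
  have hθ8 := hθ'.le.trans (min_le_left _ _)
  have hθη := hθ'.le.trans (min_le_right _ _)
  have hθθ : θ * θ ≤ θ := by nlinarith
  obtain ⟨ε, v, hε, hεθ, hv, hE, hD, hD'⟩ :=
    exists_planar_profile hWc hW0 h4 hγ hK (mul_pos hθ hθ)
  have hZ : ENNReal.ofReal c * (ENNReal.ofReal ε * E2 W (γ * ε) ε v) ≤ z θ := by
    have : E2 W (γ * ε) ε v ≤ M := hE.trans (add_le_add le_rfl (by
      rw [← ENNReal.ofReal_one]; exact ENNReal.ofReal_le_ofReal (by linarith)))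
    exact mul_le_mul_right (mul_le_mul' (ENNReal.ofReal_le_ofReal hεθ.le) this) _
  refine ⟨ε, v, hε, by linarith, hv, hE.trans (add_le_add le_rfl (ENNReal.ofReal_le_ofReal
    (hθθ.trans hθη))), ?_⟩
  refine (hgap ε hε _ v hv θ hθ hθ8 _ rfl).trans (le_trans ?_ hle)
  refine mul_le_mul_right ?_ _
  have hinv : (ENNReal.ofReal θ)⁻¹ * (∫⁻ y in Box, ‖v y - |y.1| • a‖ₑ) ≤ ENNReal.ofReal θ := by
    refine (mul_le_mul_right hD _).trans_eq ?_
    rw [ENNReal.ofReal_mul hθ.le, ← mul_assoc, ENNReal.inv_mul_cancel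
      (ENNReal.ofReal_pos.2 hθ).ne' ENNReal.ofReal_ne_top, one_mul]
  have hp0 : 0 < p := by linarith
  refine add_le_add (add_le_add (add_le_add (add_le_add (add_le_add hZ
    (ENNReal.rpow_le_rpow hZ (by positivity))) (ENNReal.rpow_le_rpow hZ (by positivity))) le_rfl)
    hinv) hD'

theorem exists_glued_nearOptimal {W : M33 → ℝ} (hWc : Continuous W) (hW0 : ∀ ξ, 0 ≤ W ξ)
    {p C σ γ : ℝ} {a A3 : V3} (hp : 2 ≤ p) (hC : 0 ≤ C) (hσ : σ = 1 ∨ σ = -1)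
    (hWC : ∀ ξ, W ξ ≤ C * ‖ξ - ![σ • a, 0, σ • A3]‖ ^ p) (hγ : 0 < γ)
    (hK : Kstar W a A3 γ ≠ ⊤) {η : ℝ} (hη : 0 < η) :
    ∃ η' > 0, ∀ ε v, NearOptimal W p γ a A3 η' ε v → ∃ g c, NearOptimal W p γ a A3 η ε g ∧
      (∀ y ∈ Box, σ * y.1 < 1 / 8 → g y = v y) ∧
      (∀ y ∈ Box, 1 / 4 < σ * y.1 → g y = aff σ a A3 (γ * ε) c y) := by
  obtain ⟨C', hC', hglue⟩ := exists_glued hWc hW0 hp hC hσ hWC hγ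
  set M : ℝ≥0∞ := Kstar W a A3 γ + 1 with hM
  have hMt : M + 1 ≠ ∞ := by finiteness
  have hlim : Tendsto (fun t : ℝ => ENNReal.ofReal t + C' * ((M + 1) * ENNReal.ofReal t))
      (𝓝[>] 0) (𝓝 0) :=
    tendsto_add_zero tendsto_ofReal_nhdsGT_zero (tendsto_const_mul_zero
      (tendsto_const_mul_zero tendsto_ofReal_nhdsGT_zero hMt) hC')
  obtain ⟨t, ht, ht', hle⟩ := exists_pos_le_of_tendsto hlim hη
    (lt_min (by norm_num : (0 : ℝ) < 1 / 32) hη)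
  refine ⟨t, ht, fun ε v hv => ?_⟩
  have ht32 := ht'.le.trans (min_le_left _ _)
  have htη := ht'.le.trans (min_le_right _ _)
  obtain ⟨g, c, hg, hg1, hg2, hE, hG⟩ := hglue ε hv.pos (hv.lt.le.trans ht32) v hv.contDiffOn
  have hr : C' * (ENNReal.ofReal ε * E2 W (γ * ε) ε v + gaugeGap p a A3 (γ * ε) v) ≤
      C' * ((M + 1) * ENNReal.ofReal t) := by
    refine mul_le_mul_right ?_ _
    have h1 : E2 W (γ * ε) ε v ≤ M := hv.energy_le.trans (add_le_add le_rfl (by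
      rw [← ENNReal.ofReal_one]; exact ENNReal.ofReal_le_ofReal (by linarith)))
    calc _ ≤ ENNReal.ofReal t * M + ENNReal.ofReal t :=
          add_le_add (mul_le_mul' (ENNReal.ofReal_le_ofReal hv.lt.le) h1) hv.gauge_le
      _ = _ := by ring
  refine ⟨g, c, ⟨hv.pos, hv.lt.trans_le htη, hg, ?_, ?_⟩, hg1, hg2⟩
  · refine hE.trans ((add_le_add hv.energy_le hr).trans ?_)
    rw [add_assoc]
    exact add_le_add le_rfl hle
  · exact hG.trans ((add_le_add hv.gauge_le hr).trans hle)

theorem qd_sub_const (v : Pt2 → V3) (c : V3) (e : Pt2) : qd e (fun y => v y - c) = qd e v :=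
  funext fun y => by unfold qd; rw [fderiv_sub_const]

theorem NearOptimal.sub_const {W : M33 → ℝ} {p γ : ℝ} {a A3 : V3} {η ε : ℝ} {v : Pt2 → V3}
    (hv : NearOptimal W p γ a A3 η ε v) (c : V3) :
    NearOptimal W p γ a A3 η ε (fun y => v y - c) := by
  refine ⟨hv.pos, hv.lt, hv.contDiffOn.sub contDiffOn_const, ?_, ?_⟩
  · refine le_trans (le_of_eq ?_) hv.energy_le
    unfold E2 dens2 hess2
    simp only [qd_sub_const]
  · refine le_trans (le_of_eq ?_) hv.gauge_le
    unfold gaugeGap gap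
    simp only [qd_sub_const]

/-- Almost optimal profiles which are affine in each phase away from the interface. -/
theorem exists_pinned_nearOptimal {W : M33 → ℝ} (hWc : Continuous W) (hW0 : ∀ ξ, 0 ≤ W ξ)
    (h4 : H4 W) {a A3 : V3} {p c C γ : ℝ} (hp : 2 ≤ p) (hc : 0 ≤ c) (hC : 0 ≤ C)
    (hgr : ∀ ξ, wellDist ![a, 0, A3] ξ ^ p ≤ c * W ξ)
    (hWC : ∀ ξ, W ξ ≤ C * ‖ξ - ![a, 0, A3]‖ ^ p ∧ W ξ ≤ C * ‖ξ + ![a, 0, A3]‖ ^ p)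
    (hA : a ≠ 0 ∨ A3 ≠ 0) (hγ : 0 < γ) (hK : Kstar W a A3 γ ≠ ⊤) {η : ℝ} (hη : 0 < η) :
    ∃ ε g d, NearOptimal W p γ a A3 η ε g ∧
      (∀ y ∈ Box, 1 / 4 < y.1 → g y = aff 1 a A3 (γ * ε) 0 y) ∧
      (∀ y ∈ Box, y.1 < -(1 / 4) → g y = aff (-1) a A3 (γ * ε) d y) := by
  have hneg : (-(![a, 0, A3] : M33)) = ![(-1 : ℝ) • a, 0, (-1 : ℝ) • A3] := by
    funext i; fin_cases i <;> simp
  obtain ⟨η₁, hη₁, hgl₂⟩ := exists_glued_nearOptimal (σ := -1) hWc hW0 hp hC (Or.inr rfl)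
    (fun ξ => by rw [← hneg, sub_neg_eq_add]; exact (hWC ξ).2) hγ hK hη
  obtain ⟨η₂, hη₂, hgl₁⟩ := exists_glued_nearOptimal (σ := 1) hWc hW0 hp hC (Or.inl rfl)
    (fun ξ => by rw [one_smul, one_smul]; exact (hWC ξ).1) hγ hK hη₁
  obtain ⟨ε, v, hv⟩ := exists_nearOptimal hWc hW0 h4 hp hc hgr hA hγ hK hη₂
  obtain ⟨g₁, c₁, hg₁, -, haff₁⟩ := hgl₁ ε v hv
  obtain ⟨g₂, c₂, hg₂, heq, haff₂⟩ := hgl₂ ε g₁ hg₁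
  refine ⟨ε, fun y => g₂ y - c₁, c₂ - c₁, hg₂.sub_const c₁, fun y hy h => ?_, fun y hy h => ?_⟩
  · dsimp only
    rw [heq y hy (by linarith), haff₁ y hy (by linarith)]
    simp [aff]
  · dsimp only
    rw [haff₂ y hy (by linarith)]
    simp only [aff]
    abel

/-! ### Distance of a pinned profile to the limiting map -/

theorem lintegral_rpow_gap_le {p : ℝ} (a A3 : V3) (h : ℝ) (v : Pt2 → V3) :
    ∫⁻ y in Box, gap a A3 h v y ^ p ≤ gaugeGap p a A3 h v :=
  lintegral_mono fun _ => le_self_add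

theorem enorm_smul_le_of_mem_II {r : ℝ} (hr : r ∈ II) (v : V3) : ‖r • v‖ₑ ≤ ‖v‖ₑ := by
  rw [enorm_smul]
  refine mul_le_of_le_one_left zero_le ?_
  rw [← ofReal_norm, ← ENNReal.ofReal_one]
  refine ENNReal.ofReal_le_ofReal ?_
  rw [Real.norm_eq_abs, abs_le]
  constructor <;> linarith [hr.1, hr.2]

theorem enorm_sub_abs_le {a A3 : V3} {h : ℝ} {g : Pt2 → V3} (hg : ContDiffOn ℝ 2 g Box)
    (hpin : ∀ y ∈ Box, 1 / 4 < y.1 → g y = aff 1 a A3 h 0 y) {y : Pt2} (hy : y ∈ Box) :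
    ‖g y - |y.1| • a‖ₑ ≤ ‖h • A3‖ₑ + ∫⁻ x in II, ‖qd f1 g (x, y.2) - sg x • a‖ₑ := by
  obtain ⟨s, r⟩ := y
  have hr : r ∈ II := hy.2
  have hs : s ∈ II := hy.1
  set G : ℝ → ℝ≥0∞ := fun x => ‖qd f1 g (x, r) - sg x • a‖ₑ with hG
  have hside : ∀ (σ : ℝ) (S : Set ℝ), S ⊆ II → MeasurableSet S →
      S.OrdConnected → (∀ᵐ x ∂volume.restrict S, sg x = σ) → ∀ s ∈ S, ∀ s' ∈ S,
      ‖(g (s, r) - (σ * s) • a) - (g (s', r) - (σ * s') • a)‖ₑ ≤ ∫⁻ x in S, G x := by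
    intro σ S hS hSm hSc hsg s hs s' hs'
    have hw : ContDiffOn ℝ 2 (fun y => g y - aff σ a A3 0 0 y) Box :=
      hg.sub (contDiff_aff ..).contDiffOn
    have := enorm_horizontal_le hw hS hSm hSc hs hs' hr
    simp only [aff, mul_zero, zero_mul, zero_smul, add_zero] at this
    refine this.trans_eq (lintegral_congr_ae ?_)
    filter_upwards [hsg, ae_restrict_mem hSm] with x hx hxS
    have hq : qd f1 (fun y : Pt2 => g y - (σ * y.1) • a) (x, r) = qd f1 g (x, r) - σ • a := by
      have h1 : DifferentiableAt ℝ g (x, r) :=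
        (hg.differentiableOn (by norm_num)).differentiableAt (isOpen_Box.mem_nhds ⟨hS hxS, hr⟩)
      have h2 := qd_aff σ a A3 0 0 f1 (x, r)
      have h3 : DifferentiableAt ℝ (aff σ a A3 0 0) (x, r) :=
        (contDiff_aff σ a A3 0 0).differentiable (by norm_num) _
      have h4 : (fun y : Pt2 => g y - (σ * y.1) • a) = fun y => g y - aff σ a A3 0 0 y := by
        funext y; simp [aff]
      rw [h4]
      unfold qd at h2 ⊢
      rw [fderiv_fun_sub h1 h3, sub_apply, h2]
      simp [f1]
    rw [hq, hG, ← hx]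
  set R : Set ℝ := Ico 0 (1 / 2)
  set L : Set ℝ := Ioc (-(1 / 2)) 0
  have hRII : R ⊆ II := fun x hx => ⟨by linarith [hx.1], hx.2⟩
  have hLII : L ⊆ II := fun x hx => ⟨hx.1, by linarith [hx.2]⟩
  have hR : ∀ᵐ x ∂volume.restrict R, sg x = 1 :=
    (ae_restrict_mem measurableSet_Ico).mono fun x hx => if_pos hx.1
  have hL : ∀ᵐ x ∂volume.restrict L, sg x = -1 := by
    filter_upwards [ae_restrict_mem measurableSet_Ioc,
      ae_restrict_of_ae (Measure.ae_ne volume (0 : ℝ))] with x hx hx0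
    exact if_neg (not_le.2 (lt_of_le_of_ne hx.2 hx0))
  have h38 : (3 / 8 : ℝ) ∈ R := ⟨by norm_num, by norm_num⟩
  have h0R : (0 : ℝ) ∈ R := ⟨le_rfl, by norm_num⟩
  have h0L : (0 : ℝ) ∈ L := ⟨by norm_num, le_rfl⟩
  have hpin' : ‖g (3 / 8, r) - (1 * (3 / 8) : ℝ) • a‖ₑ ≤ ‖h • A3‖ₑ := by
    rw [hpin _ ⟨hRII h38, hr⟩ (by norm_num)]
    have : aff 1 a A3 h 0 (3 / 8, r) - (1 * (3 / 8) : ℝ) • a = r • (h • A3) := by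
      simp only [aff, smul_smul]
      rw [one_mul h, mul_comm h r]; abel
    rw [this]
    exact enorm_smul_le_of_mem_II hr _
  have key : ∀ x y : V3, ‖x‖ₑ ≤ ‖y‖ₑ + ‖x - y‖ₑ := fun x y => by
    calc ‖x‖ₑ = ‖y + (x - y)‖ₑ := by rw [add_sub_cancel]
      _ ≤ _ := enorm_add_le _ _
  rcases le_or_gt 0 s with hs0 | hs0
  · have hsR : s ∈ R := ⟨hs0, hs.2⟩
    have h1 := hside 1 R hRII measurableSet_Ico ordConnected_Ico hR s hsR _ h38
    have e : g (s, r) - |s| • a = g (s, r) - (1 * s) • a := by rw [abs_of_nonneg hs0, one_mul]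
    change ‖g (s, r) - |s| • a‖ₑ ≤ _
    rw [e]
    exact (key _ _).trans (add_le_add hpin' (h1.trans (lintegral_mono_set hRII)))
  · have hsL : s ∈ L := ⟨hs.1, hs0.le⟩
    have h1 := hside 1 R hRII measurableSet_Ico ordConnected_Ico hR 0 h0R _ h38
    have h2 := hside (-1) L hLII measurableSet_Ioc ordConnected_Ioc hL s hsL 0 h0L
    have e : g (s, r) - |s| • a = g (s, r) - (-1 * s) • a := by
      rw [abs_of_neg hs0, neg_one_mul]
    have e0 : g (0, r) - (-1 * 0 : ℝ) • a = g (0, r) - (1 * 0 : ℝ) • a := by simp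
    rw [e0] at h2
    change ‖g (s, r) - |s| • a‖ₑ ≤ _
    rw [e]
    have hLR : (∫⁻ x in R, G x) + ∫⁻ x in L, G x ≤ ∫⁻ x in II, G x := by
      have : ∫⁻ x in R, G x = ∫⁻ x in Ioo 0 (1 / 2), G x :=
        (setLIntegral_congr Ioo_ae_eq_Ico).symm
      rw [this, ← lintegral_union measurableSet_Ioc]
      · exact lintegral_mono_set (union_subset (fun x hx => hRII ⟨hx.1.le, hx.2⟩) hLII)
      · exact Set.disjoint_left.2 fun x hx hx' => absurd hx.1 (not_lt.2 hx'.2)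
    calc _ ≤ ‖g (0, r) - (1 * 0 : ℝ) • a‖ₑ + _ := key _ _
      _ ≤ (‖h • A3‖ₑ + ∫⁻ x in R, G x) + ∫⁻ x in L, G x :=
          add_le_add ((key _ _).trans (add_le_add hpin' h1)) h2
      _ ≤ _ := by rw [add_assoc]; exact add_le_add le_rfl hLR

theorem lintegral_enorm_sub_abs_rpow_le {p : ℝ} (hp : 2 ≤ p) {a A3 : V3} {h : ℝ} {g : Pt2 → V3}
    (hg : ContDiffOn ℝ 2 g Box) (hpin : ∀ y ∈ Box, 1 / 4 < y.1 → g y = aff 1 a A3 h 0 y) :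
    ∫⁻ y in Box, ‖g y - |y.1| • a‖ₑ ^ p ≤
      2 ^ (p - 1) * (‖h • A3‖ₑ ^ p + gaugeGap p a A3 h g) := by
  set G : Pt2 → ℝ≥0∞ := fun y => ‖qd f1 g y - sg y.1 • a‖ₑ with hG
  have hGm : Measurable G := measurable_enorm_vec (measurable_sub_vec (measurable_qd _ _)
    (measurable_smul_vec (measurable_sg.comp measurable_fst) a))
  have hGp : Measurable fun y => G y ^ p := hGm.pow_const p
  have hP : Measurable fun y : Pt2 => ∫⁻ x in II, G (x, y.2) ^ p :=
    (hGp.lintegral_prod_left' (μ := volume.restrict II)).comp measurable_snd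
  calc _ ≤ ∫⁻ y in Box, 2 ^ (p - 1) * (‖h • A3‖ₑ ^ p + ∫⁻ x in II, G (x, y.2) ^ p) := by
        refine setLIntegral_mono' measurableSet_Box fun y hy => ?_
        refine (ENNReal.rpow_le_rpow (enorm_sub_abs_le hg hpin hy) (by linarith)).trans ?_
        refine (ENNReal.rpow_add_le_mul_rpow_add_rpow _ _ (by linarith)).trans ?_
        refine mul_le_mul_right (add_le_add le_rfl ?_) _
        exact rpow_lintegral_le (by linarith) (hGm.comp measurable_prodMk_right).aemeasurable
    _ = 2 ^ (p - 1) * (‖h • A3‖ₑ ^ p + ∫⁻ y in Box, G y ^ p) := by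
        rw [lintegral_const_mul _ (hP.const_add _), lintegral_add_left measurable_const,
          lintegral_const, measure_univ, mul_one]
        congr 2
        refine (lintegral_prod_II (S := II) hP).trans ?_
        dsimp only
        rw [setLIntegral_const, volume_II, mul_one]
        exact (lintegral_prod_II_symm hGp).symm
    _ ≤ _ := by
        refine mul_le_mul_right (add_le_add le_rfl ?_) _
        refine le_trans (lintegral_mono fun y => ?_) (lintegral_rpow_gap_le a A3 h g)
        exact ENNReal.rpow_le_rpow le_self_add (by linarith)

/-- The offset between the two affine pieces of a pinned profile. -/
theorem enorm_offset_le {p : ℝ} (hp : 2 ≤ p) {a A3 d : V3} {h : ℝ} {g : Pt2 → V3}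
    (hg : ContDiffOn ℝ 2 g Box) (hpin : ∀ y ∈ Box, 1 / 4 < y.1 → g y = aff 1 a A3 h 0 y)
    (hpin' : ∀ y ∈ Box, y.1 < -(1 / 4) → g y = aff (-1) a A3 h d y) :
    ‖d‖ₑ ≤ 2 * ‖h • A3‖ₑ + gaugeGap p a A3 h g ^ (1 / p) := by
  have hp0 : 0 < p := by linarith
  set G : Pt2 → ℝ≥0∞ := fun y => ‖qd f1 g y - sg y.1 • a‖ₑ with hG
  have hGm : Measurable G := measurable_enorm_vec (measurable_sub_vec (measurable_qd _ _)
    (measurable_smul_vec (measurable_sg.comp measurable_fst) a))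
  have hm : Measurable fun r => ∫⁻ x in II, G (x, r) := hGm.lintegral_prod_left'
  have hpt : ∀ r ∈ II, ‖d‖ₑ ≤ 2 * ‖h • A3‖ₑ + ∫⁻ x in II, G (x, r) := by
    intro r hr
    have hy : ((-(3 / 8), r) : Pt2) ∈ Box := ⟨⟨by norm_num, by norm_num⟩, hr⟩
    have h1 := enorm_sub_abs_le hg hpin hy
    have e : d = (g (-(3 / 8), r) - |(-(3 / 8) : ℝ)| • a) + r • (h • A3) := by
      rw [hpin' _ hy (by norm_num), abs_of_neg (by norm_num)]
      simp only [aff]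
      module
    calc ‖d‖ₑ = ‖(g (-(3 / 8), r) - |(-(3 / 8) : ℝ)| • a) + r • (h • A3)‖ₑ := by rw [← e]
      _ ≤ _ := enorm_add_le _ _
      _ ≤ (‖h • A3‖ₑ + ∫⁻ x in II, G (x, r)) + ‖h • A3‖ₑ :=
          add_le_add h1 (enorm_smul_le_of_mem_II hr _)
      _ = _ := by ring
  have hint : ∫⁻ y in Box, G y ≤ gaugeGap p a A3 h g ^ (1 / p) := by
    have h1 := (rpow_lintegral_le (μ := volume.restrict Box) (q := p) (by linarith)
      hGm.aemeasurable).trans ((lintegral_mono fun y => ENNReal.rpow_le_rpow (le_self_add :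
        G y ≤ gap a A3 h g y) hp0.le).trans (lintegral_rpow_gap_le a A3 h g))
    have := ENNReal.rpow_le_rpow h1 (show 0 ≤ 1 / p by positivity)
    rwa [← ENNReal.rpow_mul, mul_one_div_cancel hp0.ne', ENNReal.rpow_one] at this
  calc ‖d‖ₑ = ∫⁻ r in II, ‖d‖ₑ := by rw [setLIntegral_const, volume_II, mul_one]
    _ ≤ ∫⁻ r in II, (2 * ‖h • A3‖ₑ + ∫⁻ x in II, G (x, r)) :=
        setLIntegral_mono' measurableSet_II hpt
    _ = 2 * ‖h • A3‖ₑ + ∫⁻ y in Box, G y := by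
        rw [lintegral_add_left measurable_const, setLIntegral_const, volume_II, mul_one]
        congr 1
        exact (lintegral_prod_II_symm (S := II) hGm).symm
    _ ≤ _ := add_le_add le_rfl hint

/-! ### Transfer to the cube -/

theorem lintegral_vnorm_rpow_le {p : ℝ} (hp : 0 ≤ p) {f : Pt → V3} {k : Pt2 → ℝ≥0∞}
    (hk : AEMeasurable k (volume.restrict Box))
    (h : ∀ᵐ x ∂volume.restrict Q3, ‖f x‖ₑ ≤ k (x.1, x.2.2)) :
    ∫⁻ x in Q3, ENNReal.ofReal (vnorm (f x) ^ p) ≤ 2 ^ p * ∫⁻ y in Box, k y ^ p := by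
  rw [← lintegral_const_mul' _ _ (by finiteness),
    ← lintegral_Q3_forget (f := fun y => 2 ^ p * k y ^ p) ((hk.pow_const p).const_mul _)]
  refine lintegral_mono_ae (h.mono fun x hx => ?_)
  rw [← ENNReal.ofReal_rpow_of_nonneg (vnorm_nonneg _) hp, ← ENNReal.mul_rpow_of_nonneg _ _ hp]
  refine ENNReal.rpow_le_rpow (le_trans ?_ (mul_le_mul_right hx 2)) hp
  refine (ENNReal.ofReal_le_ofReal (vnorm_le _)).trans_eq ?_
  rw [ENNReal.ofReal_mul zero_le_two, ofReal_norm, ENNReal.ofReal_ofNat]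

instance isProbabilityMeasure_Q3 : IsProbabilityMeasure (volume.restrict Q3) := by
  rw [restrict_Q3]; infer_instance

theorem TendsLp.tendsL1 {p : ℝ} (hp : 1 ≤ p) {f : ℕ → Pt → V3} {g : Pt → V3}
    (h : TendsLp Q3 p f g)
    (hm : ∀ n, AEMeasurable (fun x => f n x - g x) (volume.restrict Q3)) : TendsL1 Q3 f g := by
  have hp0 : 0 < p := by linarith
  refine tendsto_of_tendsto_of_tendsto_of_le_of_le tendsto_const_nhds
    (tendsto_rpow_zero h (q := 1 / p) (by positivity)) (fun _ => zero_le) fun n => ?_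
  have h1 := rpow_lintegral_le hp
    (continuous_vnorm.measurable.comp_aemeasurable (hm n)).ennreal_ofReal
  have h2 := ENNReal.rpow_le_rpow h1 (show 0 ≤ 1 / p by positivity)
  rw [← ENNReal.rpow_mul, mul_one_div_cancel hp0.ne', ENNReal.rpow_one] at h2
  refine h2.trans_eq ?_
  congr 1
  refine lintegral_congr fun x => ?_
  exact ENNReal.ofReal_rpow_of_nonneg (vnorm_nonneg _) hp0.le

theorem ae_fst_ne_zero : ∀ᵐ x : Pt ∂volume.restrict Q3, x.1 ≠ 0 := by
  refine ae_restrict_of_ae ?_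
  exact (Measure.quasiMeasurePreserving_fst (μ := (volume : Measure ℝ))
    (ν := (volume : Measure (ℝ × ℝ)))).ae (Measure.ae_ne volume (0 : ℝ))

theorem sign_eq_sg {t : ℝ} (ht : t ≠ 0) : Real.sign t = sg t := by
  unfold sg
  rcases lt_or_gt_of_ne ht with h | h
  · rw [Real.sign_of_neg h, if_neg (not_le.2 h)]
  · rw [Real.sign_of_pos h, if_pos h.le]

theorem aff_eq_pinned {σ : ℝ} (hσ : σ = 1 ∨ σ = -1) (a A3 : V3) (h : ℝ) (c : V3) {x : Pt}
    (hx : 0 < σ * x.1) :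
    aff σ a A3 h c (x.1, x.2.2) = u0 a x + (h * x.2.2) • b0 A3 x + c := by
  have habs : |x.1| = σ * x.1 := by
    rcases hσ with rfl | rfl
    · rw [one_mul] at hx ⊢; exact abs_of_pos hx
    · rw [abs_of_neg (by linarith)]; ring
  simp only [aff, u0, ub0, b0, bb0_eq, sg_eq hσ hx, habs, smul_smul]
  rw [show h * x.2.2 * σ = σ * h * x.2.2 by ring]

/-- Proposition 4.7, pinned optimal profiles in the critical regime. -/
theorem statement9 (p : ℝ) (hp : 2 ≤ p) (A B : M33) (W : M33 → ℝ) (a : V3)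
    (hWc : Continuous W) (h1 : H1 W A B) (h2 : H2 W p) (h3 : H3 W A B p) (h4 : H4 W)
    (hwells : Wells A B a) (γ : ℝ) (hγ : 0 < γ) :
    ∃ (ε : ℕ → ℝ) (c : ℕ → V3) (g : ℕ → Pt → V3),
      (∀ n, 0 < ε n) ∧ Tendsto ε atTop (nhds 0) ∧
      Tendsto c atTop (nhds 0) ∧
      (∀ n, ContDiffOn ℝ 2 (g n) Q3) ∧
      (∀ n x₁ x₂ x₂' x₃, g n (x₁, x₂, x₃) = g n (x₁, x₂', x₃)) ∧
      TendsLp Q3 p g (u0 a) ∧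
      Tendsto (fun n => ∫⁻ x in Q3,
        ENNReal.ofReal ((vnorm (pd e1 (g n) x - Real.sign x.1 • a)) ^ p)) atTop (nhds 0) ∧
      Tendsto (fun n => ∫⁻ x in Q3,
        ENNReal.ofReal ((vnorm (pd e2 (g n) x)) ^ p)) atTop (nhds 0) ∧
      TendsLp Q3 p (fun n x => (γ * ε n)⁻¹ • pd e3 (g n) x) (b0 (A 2)) ∧
      (∀ n, ∀ x ∈ Q3, 1 / 4 < x.1 →
        g n x = u0 a x + (γ * ε n * x.2.2) • b0 (A 2) x) ∧
      (∀ n, ∀ x ∈ Q3, x.1 < -(1 / 4) →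
        g n x = u0 a x + (γ * ε n * x.2.2) • b0 (A 2) x + c n) ∧
      Kstar W a (A 2) γ ≠ ⊤ ∧
      Tendsto (fun n => F W (γ * ε n) (ε n) (g n) Q3) atTop
        (nhds (Kstar W a (A 2) γ)) := by
  obtain ⟨hW0, hWz, hAB, -⟩ := h1
  obtain ⟨rfl, rfl, hA1⟩ := hwells
  set A := -B with hAdef
  have hBA : B = -A := by rw [hAdef, neg_neg]
  have hAeq : A = ![A 0, 0, A 2] := by
    funext i
    fin_cases i
    · rfl
    · exact hA1
    · rfl
  set a := A 0 with ha
  set A3 := A 2 with hA3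
  rw [hBA] at hWz h3 hAB
  have hne : a ≠ 0 ∨ A3 ≠ 0 := by
    by_contra! hcon
    refine hAB ?_
    rw [hAeq, hcon.1, hcon.2]
    funext i
    fin_cases i <;> simp
  have hneg : -A = ![-a, 0, -A3] := by
    rw [hAeq]
    funext i
    fin_cases i <;> simp
  obtain ⟨C, hC, hup⟩ := exists_growth_upper hp h2 h3
  obtain ⟨c₀, hc₀, hlow⟩ := exists_growth_lower hp hWc hW0 (fun ξ => (hWz ξ).1) h2 h3
  have hK : Kstar W a A3 γ ≠ ⊤ :=
    Kstar_ne_top hWc hW0 hp hC.le (hAeq ▸ (hWz A).2 (Or.inl rfl))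
      (hneg ▸ (hWz (-A)).2 (Or.inr rfl)) (fun ξ => by rw [← hAeq]; exact (hup ξ).1) hγ
  have hp0 : 0 < p := by linarith
  set η : ℕ → ℝ := fun n => 1 / ((n : ℝ) + 1) with hη
  have hη0 : ∀ n, 0 < η n := fun n => by positivity
  have hηt : Tendsto η atTop (𝓝 0) := tendsto_one_div_add_atTop_nhds_zero_nat
  choose ε v c hv hpin hpin' using fun n => exists_pinned_nearOptimal hWc hW0 h4 hp hc₀.le hC.le
    (fun ξ => by rw [← hAeq]; exact hlow ξ) (fun ξ => by rw [← hAeq]; exact hup ξ) hne hγ hK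
    (hη0 n)
  have hε0 : ∀ n, 0 < ε n := fun n => (hv n).pos
  have hεt : Tendsto ε atTop (𝓝 0) :=
    tendsto_of_tendsto_of_tendsto_of_le_of_le tendsto_const_nhds hηt (fun n => (hε0 n).le)
      fun n => (hv n).lt.le
  have hh0 : ∀ n, 0 < γ * ε n := fun n => mul_pos hγ (hε0 n)
  have hht : Tendsto (fun n => γ * ε n) atTop (𝓝 0) := by simpa using hεt.const_mul γ
  have hηt' : Tendsto (fun n => ENNReal.ofReal (η n)) atTop (𝓝 0) := by
    simpa using ENNReal.tendsto_ofReal hηt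
  have hGt : Tendsto (fun n => gaugeGap p a A3 (γ * ε n) (v n)) atTop (𝓝 0) :=
    tendsto_of_tendsto_of_tendsto_of_le_of_le tendsto_const_nhds hηt' (fun _ => zero_le)
      fun n => (hv n).gauge_le
  have hhA : Tendsto (fun n => ‖(γ * ε n) • A3‖ₑ) atTop (𝓝 0) := by
    have h : Tendsto (fun n => (γ * ε n) • A3) atTop (𝓝 0) := by
      simpa using hht.smul_const A3
    simpa using h.enorm
  have hg : ∀ n, ContDiffOn ℝ 2 (fun x : Pt => v n (x.1, x.2.2)) Q3 := fun n =>
    (hv n).contDiffOn.comp (ContDiff.contDiffOn (by fun_prop)) fun x hx => ⟨hx.1, hx.2.2⟩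
  have hQ : ∀ x ∈ Q3, ((x.1, x.2.2) : Pt2) ∈ Box := fun x hx => ⟨hx.1, hx.2.2⟩
  have haeQ := ae_restrict_mem (μ := volume) isOpen_Q3.measurableSet
  have hgapm : ∀ n, AEMeasurable (gap a A3 (γ * ε n) (v n)) (volume.restrict Box) := fun n =>
    (measurable_gap _ _ _ _).aemeasurable
  have hgrad : ∀ f : ℕ → Pt → V3,
      (∀ n, ∀ᵐ x ∂volume.restrict Q3, ‖f n x‖ₑ ≤ gap a A3 (γ * ε n) (v n) (x.1, x.2.2)) →
      Tendsto (fun n => ∫⁻ x in Q3, ENNReal.ofReal (vnorm (f n x) ^ p)) atTop (𝓝 0) :=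
    fun f hf => tendsto_of_tendsto_of_tendsto_of_le_of_le tendsto_const_nhds
      (tendsto_const_mul_zero hGt (C := 2 ^ p) (by finiteness)) (fun _ => zero_le) fun n =>
      (lintegral_vnorm_rpow_le hp0.le (hgapm n) (hf n)).trans
        (mul_le_mul_right (lintegral_rpow_gap_le _ _ _ _) _)
  have hL : TendsLp Q3 p (fun n x => v n (x.1, x.2.2)) (u0 a) := by
    refine tendsto_of_tendsto_of_tendsto_of_le_of_le tendsto_const_nhds
      (tendsto_const_mul_zero (tendsto_const_mul_zero
        (tendsto_add_zero (tendsto_rpow_zero hhA hp0) hGt) (C := 2 ^ (p - 1)) (by finiteness))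
        (C := 2 ^ p) (by finiteness)) (fun _ => zero_le) fun n => ?_
    refine (lintegral_vnorm_rpow_le hp0.le (k := fun y => ‖v n y - |y.1| • a‖ₑ) ?_ ?_).trans
      (mul_le_mul_right (lintegral_enorm_sub_abs_rpow_le hp (hv n).contDiffOn (hpin n)) _)
    · exact (ContinuousOn.aemeasurable (((hv n).contDiffOn.continuousOn).sub
        (Continuous.continuousOn (by fun_prop))) measurableSet_Box).enorm
    · exact Eventually.of_forall fun x => le_rfl
  have hb : TendsLp Q3 p (fun n x => (γ * ε n)⁻¹ • pd e3 (fun x => v n (x.1, x.2.2)) x)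
      (b0 A3) := by
    refine hgrad _ fun n => haeQ.mono fun x hx => ?_
    dsimp only
    rw [pd_forget (hv n).contDiffOn (hQ x hx), forgetD_e3, b0, bb0_eq]
    exact le_add_self
  have hF : ∀ n, F W (γ * ε n) (ε n) (fun x => v n (x.1, x.2.2)) Q3 =
      E2 W (γ * ε n) (ε n) (v n) := fun n => F_forget hWc (hv n).contDiffOn
  refine ⟨ε, c, fun n x => v n (x.1, x.2.2), hε0, hεt, ?_, hg, fun n x₁ x₂ x₂' x₃ => rfl, hL,
    ?_, ?_, hb, ?_, ?_, hK, ?_⟩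
  · rw [tendsto_zero_iff_enorm_tendsto_zero]
    exact tendsto_of_tendsto_of_tendsto_of_le_of_le tendsto_const_nhds
      (tendsto_add_zero (tendsto_const_mul_zero hhA (C := 2) (by finiteness))
        (tendsto_rpow_zero hGt (q := 1 / p) (by positivity))) (fun _ => zero_le)
      fun n => enorm_offset_le hp (hv n).contDiffOn (hpin n) (hpin' n)
  · refine hgrad _ fun n => ?_
    filter_upwards [haeQ, ae_fst_ne_zero] with x hx hx0
    rw [pd_forget (hv n).contDiffOn (hQ x hx), forgetD_e1, sign_eq_sg hx0]
    exact le_self_add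
  · refine hgrad _ fun n => haeQ.mono fun x hx => ?_
    rw [pd_forget (hv n).contDiffOn (hQ x hx), forgetD_e2]
    simp [qd]
  · intro n x hx h
    have := aff_eq_pinned (Or.inl rfl) a A3 (γ * ε n) 0 (x := x) (by linarith)
    rw [add_zero] at this
    rw [← this]
    exact hpin n _ (hQ x hx) h
  · intro n x hx h
    rw [← aff_eq_pinned (σ := -1) (Or.inr rfl) a A3 (γ * ε n) (c n) (x := x) (by linarith)]
    exact hpin' n _ (hQ x hx) h
  · have hlow' : Kstar W a A3 γ ≤
        liminf (fun n => F W (γ * ε n) (ε n) (fun x => v n (x.1, x.2.2)) Q3) atTop := by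
      refine Kstar_le_liminf hh0 hε0 hht hεt ?_ hg (hL.tendsL1 (by linarith) fun n => ?_)
        (hb.tendsL1 (by linarith) fun n => ?_)
      · refine tendsto_const_nhds.congr fun n => ?_
        rw [mul_div_assoc, div_self (hε0 n).ne', mul_one]
      · exact (hg n).continuousOn.aemeasurable isOpen_Q3.measurableSet |>.sub
          (Continuous.aemeasurable (by unfold u0 ub0; fun_prop))
      · refine (measurable_sub_vec (measurable_vec_const_smul _ (measurable_pd _ _))
          ?_).aemeasurable
        unfold b0
        simp only [bb0_eq]
        exact measurable_smul_vec (measurable_sg.comp measurable_fst) _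
    have hup' : limsup (fun n => F W (γ * ε n) (ε n) (fun x => v n (x.1, x.2.2)) Q3) atTop ≤
        Kstar W a A3 γ := by
      have ht : Tendsto (fun n => Kstar W a A3 γ + ENNReal.ofReal (η n)) atTop
          (𝓝 (Kstar W a A3 γ)) := by
        simpa using tendsto_const_nhds.add hηt'
      rw [← ht.limsup_eq]
      exact limsup_le_limsup (Eventually.of_forall fun n => (hF n).trans_le (hv n).energy_le)
    exact tendsto_of_le_liminf_of_limsup_le hlow' hup'
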